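/- Let F(X) = a₀Xⁿ + a₁Xⁿ⁻¹ + ⋯ + aₙ ∈ 𝓞_S[X] have degree n ≥ 3 and nonzero discriminant, and let δ ∈ 𝓞_S ∖ {0}. Then every solution x, y ∈ 𝓞_S of F(x) = δ y² satisfies h(x), h(y) ≤ c₄·|Δ_L|^{8n³}·Q^{20n³}·e^{50n⁴·d_L·ĥ}, where c₄ := (4ns)^{212n⁴s} and ĥ := Σ_{v ∈ 𝓜_L} d_v·log max(1, |δ|_v, |a₀|_v,…,|aₙ|_v). -/

import Mathlib

open scoped BigOperators Classical NumberField

open NumberField IsDedekindDomain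

noncomputable section

/-- The order of vanishing `ord_v(x) ∈ ℤ` of `x ∈ L` at a finite place (nonzero prime) `v`
of the ring of integers of `L`, with the convention `ord_v(0) = 0`. -/
noncomputable def ordAt {L : Type*} [Field L] [NumberField L]
    (v : HeightOneSpectrum (𝓞 L)) (x : L) : ℤ :=
  if hx : x = 0 then 0
  else -Multiplicative.toAdd (WithZero.unzero
    ((Valuation.ne_zero_iff (v.valuation (K := L))).mpr hx))

/-- The absolute logarithmic Weil height of an element of a number field `L`:
`h(x) = (1/[L:ℚ]) ( ∑_{w | ∞} mult(w) log⁺ w(x) + ∑_{v fin} max(0, -ord_v x) log N(v) )`. -/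
noncomputable def wHeight {L : Type*} [Field L] [NumberField L] (x : L) : ℝ :=
  ((∑ w : InfinitePlace L, (w.mult : ℝ) * Real.log (max 1 (w x))) +
    ∑ᶠ v : HeightOneSpectrum (𝓞 L),
      ((max 0 (-(ordAt v x)) : ℤ) : ℝ) * Real.log (Ideal.absNorm v.asIdeal)) /
    (Module.finrank ℚ L)
/-- The `(2n-2) × (2n-2)` matrix whose determinant is (up to sign) the discriminant of the
binary form `a₀ Xⁿ + a₁ Xⁿ⁻¹ Y + ⋯ + aₙ Yⁿ` (equivalently, of the polynomial
`a₀ Xⁿ + ⋯ + aₙ`). -/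
def discMat {R : Type*} [CommRing R] (n : ℕ) (a : ℕ → R) :
    Matrix (Fin (2*n-2)) (Fin (2*n-2)) R := fun i j =>
  if (i : ℕ) < n - 2 then
    (if (i : ℕ) ≤ (j : ℕ) ∧ (j : ℕ) ≤ (i : ℕ) + n then a ((j : ℕ) - (i : ℕ)) else 0)
  else if (i : ℕ) = n - 2 then
    (if (j : ℕ) + 1 ≤ n then (((j : ℕ) + 1 : ℕ) : R) * a ((j : ℕ) + 1) else 0)
  else
    (if (i : ℕ) - (n - 1) ≤ (j : ℕ) ∧ (j : ℕ) ≤ (i : ℕ) - (n - 1) + (n - 1)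
      then ((n - ((j : ℕ) - ((i : ℕ) - (n - 1))) : ℕ) : R) * a ((j : ℕ) - ((i : ℕ) - (n - 1)))
      else 0)

/-- The discriminant of the binary form (or polynomial) with coefficients `a 0, …, a n`. -/
noncomputable def binDisc {R : Type*} [CommRing R] (n : ℕ) (a : ℕ → R) : R := (discMat n a).det

/-- `ĥ = ∑_v d_v log max(1, |δ|_v, |a₀|_v, …, |aₙ|_v)`, the height of the coefficient tuple
of `δ` and `F = a₀ Xⁿ + ⋯ + aₙ`. -/
noncomputable def hhat {L : Type*} [Field L] [NumberField L] (n : ℕ) (δ : L) (a : ℕ → L) : ℝ :=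
  ((∑ w : InfinitePlace L, (w.mult : ℝ) *
      Real.log (max 1 (max (w δ)
        ((Finset.range (n + 1)).sup'
          (Finset.nonempty_range_iff.mpr (Nat.succ_ne_zero n)) fun j => w (a j))))) +
    ∑ᶠ v : HeightOneSpectrum (𝓞 L),
      ((max 0 (-(min (ordAt v δ)
        ((Finset.range (n + 1)).inf'
          (Finset.nonempty_range_iff.mpr (Nat.succ_ne_zero n)) fun j => ordAt v (a j)))) : ℤ) : ℝ) *
        Real.log (Ideal.absNorm v.asIdeal)) / (Module.finrank ℚ L)

namespace HyperellipticBound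

open Function Real NumberField.HeightOneSpectrum

/-! ### Places with multiplicity -/

section Places

variable {K : Type*} [Field K] [NumberField K]

/-- The places of `K`, each complex place being counted twice (once for each embedding). -/
abbrev Pl (K : Type*) [Field K] [NumberField K] := (K →+* ℂ) ⊕ HeightOneSpectrum (𝓞 K)

/-- The absolute value of a place, normalized so that the product formula holds. -/
def av : Pl K → AbsoluteValue K ℝ
  | .inl φ => place φ
  | .inr P => adicAbv K P

/-- The weight of a place in archimedean error terms: `1` at embeddings, `0` at primes. -/
def arch : Pl K → ℝ
  | .inl _ => 1
  | .inr _ => 0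

lemma arch_nonneg (v : Pl K) : 0 ≤ arch v := by cases v <;> simp [arch]

lemma arch_le_one (v : Pl K) : arch v ≤ 1 := by cases v <;> simp [arch]

@[simp] lemma av_inl (φ : K →+* ℂ) (x : K) : av (.inl φ) x = ‖φ x‖ := rfl

@[simp] lemma av_inr (P : HeightOneSpectrum (𝓞 K)) (x : K) :
    av (.inr P) x = adicAbv K P x := rfl

lemma av_pos (v : Pl K) {x : K} (hx : x ≠ 0) : 0 < av v x := (av v).pos hx

lemma hasFiniteSupport_of_inr {f : Pl K → ℝ} (h : (fun P => f (.inr P)).HasFiniteSupport) :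
    f.HasFiniteSupport := by
  refine ((Set.finite_range (Sum.inl : (K →+* ℂ) → Pl K)).union (h.image Sum.inr)).subset ?_
  rintro (φ | P) hv
  · exact Or.inl ⟨φ, rfl⟩
  · exact Or.inr ⟨P, hv, rfl⟩

lemma finsum_split {f : Pl K → ℝ} (h : f.HasFiniteSupport) :
    ∑ᶠ v, f v = ∑ φ, f (.inl φ) + ∑ᶠ P, f (.inr P) := by
  have hd : Disjoint (Set.range (Sum.inl : (K →+* ℂ) → Pl K)) (Set.range Sum.inr) := by
    rw [Set.disjoint_left]; rintro _ ⟨a, rfl⟩ ⟨b, hb⟩; simp at hb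
  rw [← finsum_mem_univ, ← Set.range_inl_union_range_inr,
    finsum_mem_union' hd (h.subset Set.inter_subset_right) (h.subset Set.inter_subset_right),
    finsum_mem_range Sum.inl_injective, finsum_mem_range Sum.inr_injective,
    finsum_eq_sum_of_fintype]

lemma hasFiniteSupport_arch : (arch : Pl K → ℝ).HasFiniteSupport :=
  hasFiniteSupport_of_inr (by simp [arch, HasFiniteSupport])

lemma finsum_arch : ∑ᶠ v : Pl K, arch v = Module.finrank ℚ K := by
  rw [finsum_split hasFiniteSupport_arch]
  simp [arch, Embeddings.card]

lemma finsum_le_finsum_of_le {ι : Type*} {f g : ι → ℝ} (hf : f.HasFiniteSupport)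
    (hg : g.HasFiniteSupport) (h : ∀ i, f i ≤ g i) : ∑ᶠ i, f i ≤ ∑ᶠ i, g i := by
  have hU := hf.union hg
  rw [finsum_eq_sum_of_support_subset (s := hU.toFinset) f (by simp),
    finsum_eq_sum_of_support_subset (s := hU.toFinset) g (by simp)]
  exact Finset.sum_le_sum fun i _ => h i

lemma hasFiniteMulSupport_adicAbv {x : K} (hx : x ≠ 0) :
    (fun P : HeightOneSpectrum (𝓞 K) => adicAbv K P x).HasFiniteMulSupport := by
  have h := (FinitePlace.hasFiniteMulSupport hx).fun_comp_of_injective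
    (FinitePlace.equivHeightOneSpectrum (K := K)).symm.injective
  convert h using 2 with P
  rw [FinitePlace.equivHeightOneSpectrum_symm_apply, FinitePlace.norm_embedding]

lemma hasFiniteSupport_comp_av {g : ℝ → ℝ} (hg : g 1 = 0) {x : K} (hx : x ≠ 0) :
    (fun v : Pl K => g (av v x)).HasFiniteSupport := by
  refine hasFiniteSupport_of_inr ?_
  refine (hasFiniteMulSupport_adicAbv hx).subset fun P hP h1 => hP ?_
  change adicAbv K P x = 1 at h1
  simp [h1, hg]

/-- Logarithm of the absolute value at a place. -/
def lg (v : Pl K) (x : K) : ℝ := Real.log (av v x)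

/-- Truncated logarithm of the absolute value at a place. -/
def lp (v : Pl K) (x : K) : ℝ := Real.log (max 1 (av v x))

@[fun_prop]
lemma hasFiniteSupport_lg (x : K) : (fun v => lg v x).HasFiniteSupport := by
  rcases eq_or_ne x 0 with rfl | hx
  · simp [lg, HasFiniteSupport]
  · exact hasFiniteSupport_comp_av (g := Real.log) (by simp) hx

@[fun_prop]
lemma hasFiniteSupport_lp (x : K) : (fun v => lp v x).HasFiniteSupport := by
  rcases eq_or_ne x 0 with rfl | hx
  · simp [lp, HasFiniteSupport]
  · exact hasFiniteSupport_comp_av (g := fun t => Real.log (max 1 t)) (by simp) hx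

attribute [fun_prop] hasFiniteSupport_arch

/-- The product formula. -/
theorem finsum_lg {x : K} (hx : x ≠ 0) : ∑ᶠ v, lg v x = 0 := by
  rw [finsum_split (hasFiniteSupport_lg x)]
  have h := prod_abs_eq_one (K := K) hx
  have h1 : ∏ᶠ w : FinitePlace K, w x = ∏ᶠ P : HeightOneSpectrum (𝓞 K), adicAbv K P x := by
    rw [← finprod_comp_equiv (FinitePlace.equivHeightOneSpectrum (K := K)).symm]
    refine finprod_congr fun P => ?_
    rw [FinitePlace.equivHeightOneSpectrum_symm_apply, FinitePlace.norm_embedding]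
  have h2 : ∏ w : InfinitePlace K, w x ^ w.mult = ∏ φ : K →+* ℂ, ‖φ x‖ := by
    rw [InfinitePlace.prod_eq_abs_norm]
    have := Algebra.norm_eq_prod_embeddings ℚ ℂ x
    have h3 : ((|Algebra.norm ℚ x| : ℚ) : ℝ) = ‖algebraMap ℚ ℂ (Algebra.norm ℚ x)‖ := by
      simp
    rw [h3, this, norm_prod]
    exact Fintype.prod_equiv (RingHom.equivRatAlgHom K ℂ).symm _ _ fun _ => rfl
  rw [h1, h2] at h
  have hne : ∏ᶠ P : HeightOneSpectrum (𝓞 K), adicAbv K P x ≠ 0 := by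
    intro h0; simp [h0] at h
  have h4 := congrArg Real.log h
  rw [Real.log_mul _ hne, Real.log_one, Real.log_prod] at h4
  · rw [← h4]
    congr 1
    rw [finprod_eq_prod _ (hasFiniteMulSupport_adicAbv hx), Real.log_prod]
    · rw [finsum_eq_sum_of_support_subset]
      · rfl
      · intro P hP
        refine Finset.mem_coe.mpr ((Set.Finite.mem_toFinset _).mpr fun h1 => hP ?_)
        change adicAbv K P x = 1 at h1
        simp [lg, h1]
    · intro P _; exact (AbsoluteValue.ne_zero _ hx)
  · intro φ _; simpa using hx
  · exact Finset.prod_ne_zero_iff.mpr fun φ _ => by simpa using hx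

/-! ### Local estimates -/

lemma lp_nonneg (v : Pl K) (x : K) : 0 ≤ lp v x := Real.log_nonneg (le_max_left _ _)

lemma lg_le_lp (v : Pl K) (x : K) : lg v x ≤ lp v x := by
  rcases eq_or_ne x 0 with rfl | hx
  · simp [lg, lp]
  · exact Real.log_le_log (av_pos v hx) (le_max_right _ _)

lemma lg_mul (v : Pl K) {x y : K} (hx : x ≠ 0) (hy : y ≠ 0) : lg v (x * y) = lg v x + lg v y := by
  rw [lg, map_mul, Real.log_mul (av_pos v hx).ne' (av_pos v hy).ne']; rfl

lemma lg_inv (v : Pl K) (x : K) : lg v x⁻¹ = -lg v x := by simp [lg]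

lemma lg_neg (v : Pl K) (x : K) : lg v (-x) = lg v x := by simp [lg]

lemma lp_neg (v : Pl K) (x : K) : lp v (-x) = lp v x := by simp [lp]

lemma lg_div (v : Pl K) {x y : K} (hx : x ≠ 0) (hy : y ≠ 0) : lg v (x / y) = lg v x - lg v y := by
  rw [div_eq_mul_inv, lg_mul v hx (inv_ne_zero hy), lg_inv, sub_eq_add_neg]

lemma lg_pow (v : Pl K) (x : K) (n : ℕ) : lg v (x ^ n) = n * lg v x := by simp [lg]

lemma lp_le_of_le {v : Pl K} {x : K} {c : ℝ} (hc : 0 ≤ c) (h : lg v x ≤ c) : lp v x ≤ c := by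
  unfold lp
  rcases le_total (av v x) 1 with h1 | h1
  · simpa [max_eq_left h1] using hc
  · rw [max_eq_right h1]; exact h

lemma lp_eq_max (v : Pl K) (x : K) : lp v x = max 0 (lg v x) :=
  le_antisymm (lp_le_of_le (le_max_left _ _) (le_max_right _ _))
    (max_le (lp_nonneg v x) (lg_le_lp v x))

lemma lp_sub_lp_inv (v : Pl K) (x : K) : lp v x - lp v x⁻¹ = lg v x := by
  rw [lp_eq_max, lp_eq_max, lg_inv]
  rcases le_total 0 (lg v x) with h | h
  · rw [max_eq_right h, max_eq_left (by linarith)]; ring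
  · rw [max_eq_left h, max_eq_right (by linarith)]; ring

lemma abs_lg (v : Pl K) (x : K) : |lg v x| = lp v x + lp v x⁻¹ := by
  rw [lp_eq_max, lp_eq_max, lg_inv]
  rcases le_total 0 (lg v x) with h | h
  · rw [max_eq_right h, max_eq_left (by linarith), abs_of_nonneg h]; ring
  · rw [max_eq_left h, max_eq_right (by linarith), abs_of_nonpos h]; ring

lemma av_le_exp (v : Pl K) (x : K) : av v x ≤ Real.exp (lp v x) := by
  rw [lp, Real.exp_log (by positivity)]; exact le_max_right _ _

lemma lp_mul_le (v : Pl K) (x y : K) : lp v (x * y) ≤ lp v x + lp v y := by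
  rcases eq_or_ne x 0 with rfl | hx
  · simpa [lp] using lp_nonneg v y
  rcases eq_or_ne y 0 with rfl | hy
  · simpa [lp] using lp_nonneg v x
  exact lp_le_of_le (add_nonneg (lp_nonneg _ _) (lp_nonneg _ _))
    (by rw [lg_mul v hx hy]; exact add_le_add (lg_le_lp _ _) (lg_le_lp _ _))

lemma lp_pow (v : Pl K) (x : K) (n : ℕ) : lp v (x ^ n) = n * lp v x := by
  rw [lp_eq_max, lp_eq_max, lg_pow, mul_max_of_nonneg _ _ (Nat.cast_nonneg n), mul_zero]

/-- The triangle inequality at all places, with the ultrametric one at primes. -/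
lemma av_add_le (v : Pl K) (x y : K) :
    av v (x + y) ≤ Real.exp (arch v * Real.log 2) * max (av v x) (av v y) := by
  rcases v with φ | P
  · simp only [arch, one_mul]
    rw [Real.exp_log (by norm_num)]
    have := (av (.inl φ)).add_le x y
    have h1 := le_max_left (av (.inl φ) x) (av (.inl φ) y)
    have h2 := le_max_right (av (.inl φ) x) (av (.inl φ) y)
    linarith
  · simpa [arch] using adicAbv_add_le_max K P x y

lemma lp_add_le (v : Pl K) (x y : K) : lp v (x + y) ≤ lp v x + lp v y + arch v * Real.log 2 := by
  have h0 : 0 ≤ arch v * Real.log 2 := mul_nonneg (arch_nonneg v) (Real.log_nonneg (by norm_num))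
  have hx := lp_nonneg v x
  have hy := lp_nonneg v y
  rw [lp, Real.log_le_iff_le_exp (by positivity)]
  refine max_le (Real.one_le_exp (by positivity)) ((av_add_le v x y).trans ?_)
  rw [add_comm _ (arch v * _), Real.exp_add]
  gcongr
  refine max_le ((av_le_exp v x).trans ?_) ((av_le_exp v y).trans ?_) <;> gcongr <;> linarith

lemma av_sum_le (v : Pl K) {ι : Type*} (s : Finset ι) (f : ι → K) {B N : ℝ} (hB : 0 ≤ B)
    (hN : 1 ≤ N) (hs : (s.card : ℝ) ≤ N) (h : ∀ i ∈ s, av v (f i) ≤ B) :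
    av v (∑ i ∈ s, f i) ≤ Real.exp (arch v * Real.log N) * B := by
  rcases v with φ | P
  · simp only [arch, one_mul]
    rw [Real.exp_log (by linarith)]
    refine ((av (.inl φ)).sum_le s f).trans ((Finset.sum_le_card_nsmul s _ B h).trans ?_)
    rw [nsmul_eq_mul]; gcongr
  · simp only [arch, zero_mul, Real.exp_zero, one_mul]
    clear hs
    induction s using Finset.induction_on with
    | empty => simpa using hB
    | insert a s ha ih =>
      rw [Finset.sum_insert ha]
      exact (adicAbv_add_le_max K P _ _).trans
        (max_le (h a (by simp)) (ih fun i hi => h i (by simp [hi])))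

lemma av_intCast_le (v : Pl K) (m : ℤ) {B : ℝ} (hB : 1 ≤ B) (hm : |(m : ℝ)| ≤ B) :
    av v (m : K) ≤ Real.exp (arch v * Real.log B) := by
  rcases v with φ | P
  · simp only [arch, one_mul]
    rw [Real.exp_log (by linarith)]
    simpa using hm
  · simpa [arch] using adicAbv_intCast_le_one K P m

lemma av_natCast_le (v : Pl K) (m : ℕ) {B : ℝ} (hB : 1 ≤ B) (hm : (m : ℝ) ≤ B) :
    av v (m : K) ≤ Real.exp (arch v * Real.log B) := by
  simpa using av_intCast_le v (m : ℤ) hB (by simpa using hm)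

/-- The unnormalized logarithmic height. -/
def ht (x : K) : ℝ := ∑ᶠ v : Pl K, lp v x

lemma ht_nonneg (x : K) : 0 ≤ ht x := finsum_nonneg fun v => lp_nonneg v x

lemma ht_inv (x : K) : ht x⁻¹ = ht x := by
  rcases eq_or_ne x 0 with rfl | hx
  · simp
  have h := finsum_lg hx
  simp_rw [← lp_sub_lp_inv] at h
  rw [finsum_sub_distrib (hasFiniteSupport_lp x) (hasFiniteSupport_lp _)] at h
  simp only [ht]; linarith

lemma ht_neg (x : K) : ht (-x) = ht x := by simp [ht, lp_neg]

lemma ht_mul_le (x y : K) : ht (x * y) ≤ ht x + ht y := by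
  rw [ht, ht, ht, ← finsum_add_distrib (hasFiniteSupport_lp x) (hasFiniteSupport_lp y)]
  exact finsum_le_finsum_of_le (hasFiniteSupport_lp _) (by fun_prop) fun v => lp_mul_le v x y

lemma ht_pow (x : K) (n : ℕ) : ht (x ^ n) = n * ht x := by
  rw [ht, ht, mul_finsum]
  simp_rw [lp_pow]

lemma ht_add_le (x y : K) : ht (x + y) ≤ ht x + ht y + Module.finrank ℚ K * Real.log 2 := by
  rw [ht, ht, ht, ← finsum_arch, finsum_mul,
    ← finsum_add_distrib (hasFiniteSupport_lp x) (hasFiniteSupport_lp y),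
    ← finsum_add_distrib (by fun_prop) (by fun_prop)]
  exact finsum_le_finsum_of_le (hasFiniteSupport_lp _) (by fun_prop) fun v => lp_add_le v x y

lemma ht_sub_le (x y : K) : ht (x - y) ≤ ht x + ht y + Module.finrank ℚ K * Real.log 2 := by
  rw [sub_eq_add_neg, ← ht_neg y]; exact ht_add_le x (-y)

end Places

end HyperellipticBound

namespace HyperellipticBound

/-! ### Zero estimate and divisibility of interpolation determinants -/

section Algebra

open Polynomial Matrix

variable {k : Type*} [Field k]

lemma natDegree_det_le_and_coeff {R n : Type*} [CommRing R] [Fintype n] [DecidableEq n]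
    (M : Matrix n n R[X]) (d : n → ℕ) (h : ∀ i j, (M i j).natDegree ≤ d j) :
    M.det.natDegree ≤ ∑ j, d j ∧
      M.det.coeff (∑ j, d j) = (Matrix.of fun i j => (M i j).coeff (d j)).det := by
  have key : ∀ (f : n → R[X]), (∀ j, (f j).natDegree ≤ d j) → ∀ s : Finset n,
      (∏ j ∈ s, f j).natDegree ≤ ∑ j ∈ s, d j ∧
      (∏ j ∈ s, f j).coeff (∑ j ∈ s, d j) = ∏ j ∈ s, (f j).coeff (d j) := by
    intro f hf s
    induction s using Finset.induction_on with
    | empty => simp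
    | insert a s ha ih =>
      rw [Finset.prod_insert ha, Finset.sum_insert ha, Finset.prod_insert ha]
      exact ⟨natDegree_mul_le.trans (add_le_add (hf a) ih.1),
        by rw [coeff_mul_add_eq_of_natDegree_le (hf a) ih.1, ih.2]⟩
  rw [det_apply, det_apply]
  constructor
  · refine natDegree_sum_le_of_forall_le _ _ fun σ _ => ?_
    refine (natDegree_smul_le _ _).trans ?_
    exact (key (fun i => M (σ i) i) (fun j => h _ _) Finset.univ).1
  · rw [finsetSum_coeff]
    refine Finset.sum_congr rfl fun σ _ => ?_
    have := (key (fun i => M (σ i) i) (fun j => h _ _) Finset.univ).2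
    rcases Int.units_eq_one_or (Equiv.Perm.sign σ) with hs | hs <;> simp [hs, this]

lemma det_shift_ne_zero {q : ℕ} (P : Fin q → k[X]) (hP : ∀ l, P l ≠ 0) (x : Fin q → k)
    (hx : Function.Injective x) :
    (Matrix.of fun i l : Fin q => (P l).comp (X + C ((i : ℕ) : k)) * C (x l ^ (i : ℕ))).det ≠ 0 ∧
    (Matrix.of fun i l : Fin q =>
      (P l).comp (X + C ((i : ℕ) : k)) * C (x l ^ (i : ℕ))).det.natDegree ≤
        ∑ l, (P l).natDegree := by
  have hM : ∀ i l : Fin q,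
      (Matrix.of (fun i l : Fin q => (P l).comp (X + C ((i : ℕ) : k)) * C (x l ^ (i : ℕ)))
        i l).natDegree ≤ (P l).natDegree := fun i l => by
    refine (natDegree_mul_C_le _ _).trans (natDegree_comp_le.trans ?_)
    rw [natDegree_X_add_C, mul_one]
  obtain ⟨hd, hc⟩ := natDegree_det_le_and_coeff _ (fun l => (P l).natDegree) hM
  refine ⟨fun h0 => ?_, hd⟩
  rw [h0, coeff_zero] at hc
  have hcoef : ∀ i l : Fin q,
      ((P l).comp (X + C ((i : ℕ) : k)) * C (x l ^ (i : ℕ))).coeff (P l).natDegree =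
        (P l).leadingCoeff * (vandermonde x)ᵀ i l := by
    intro i l
    have h2 := natDegree_comp (p := P l) (q := X + C ((i : ℕ) : k))
    rw [natDegree_X_add_C, mul_one] at h2
    rw [coeff_mul_C, ← h2]
    change leadingCoeff _ * _ = _
    rw [leadingCoeff_comp (by rw [natDegree_X_add_C]; exact one_ne_zero)]
    rw [leadingCoeff_X_add_C]; simp [vandermonde]
  simp only [Matrix.of_apply, hcoef] at hc
  rw [Matrix.det_mul_row (fun l => (P l).leadingCoeff), det_transpose] at hc
  exact mul_ne_zero (Finset.prod_ne_zero_iff.mpr fun l _ => leadingCoeff_ne_zero.mpr (hP l))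
    (det_vandermonde_ne_zero_iff.mpr hx) hc.symm

/-- An exponential polynomial `∑ P_l(n) w^l` whose coefficient polynomials have degree at most
`K` does not vanish on too large a set of points `(n, a^r' η^s')`. -/
lemma zero_estimate [CharZero k] {a η : k} {r K L R S : ℕ} (ha : a ≠ 0) (hη : η ≠ 0)
    (hinj : ∀ i < L, ∀ j < L, η ^ i = η ^ j → i = j)
    (hSr : S ≤ r) (hcard : K * L < R * (S + 1 - L))
    (P : Fin L → k[X]) (hdeg : ∀ l, (P l).natDegree ≤ K)
    (hzero : ∀ r' < R, ∀ s' < S,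
      ∑ l, (P l).eval ((s' + r * r' : ℕ) : k) * (a ^ r' * η ^ s') ^ (l : ℕ) = 0) :
    ∀ l, P l = 0 := by
  by_contra hne
  push Not at hne
  obtain ⟨l0, hl0⟩ := hne
  obtain ⟨q, ⟨e⟩⟩ := Finite.exists_equiv_fin {l : Fin L // P l ≠ 0}
  have hqL : q ≤ L := by
    have h1 := Fintype.card_subtype_le (fun l : Fin L => P l ≠ 0)
    rwa [Fintype.card_congr e, Fintype.card_fin, Fintype.card_fin] at h1
  obtain ⟨hdet, hd⟩ := det_shift_ne_zero (fun j => P (e.symm j)) (fun j => (e.symm j).2)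
    (fun j => η ^ ((e.symm j : Fin L) : ℕ)) (fun i j hij => by
      have := hinj _ (e.symm i : Fin L).2 _ (e.symm j : Fin L).2 hij
      exact e.symm.injective (Subtype.ext (Fin.ext this)))
  have hdL : ∑ j : Fin q, (P (e.symm j)).natDegree ≤ K * L := by
    refine (Finset.sum_le_card_nsmul Finset.univ _ K fun j _ => hdeg (e.symm j)).trans ?_
    rw [smul_eq_mul, mul_comm, Finset.card_univ, Fintype.card_fin]
    exact Nat.mul_le_mul_left _ hqL
  refine hdet (eq_zero_of_natDegree_lt_card_of_eval_eq_zero (ι := Fin R × Fin (S + 1 - L)) _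
      (f := fun p => (((p.2 : ℕ) + r * p.1 : ℕ) : k)) ?_ ?_ ?_)
  · rintro ⟨r1, s1⟩ ⟨r2, s2⟩ h
    have h' : (s1 : ℕ) + r * r1 = s2 + r * r2 := Nat.cast_injective (R := k) h
    have hs1 : (s1 : ℕ) < r := by have := s1.2; have := e ⟨l0, hl0⟩ |>.2; omega
    have hs2 : (s2 : ℕ) < r := by have := s2.2; have := e ⟨l0, hl0⟩ |>.2; omega
    have e1 : (r1 : ℕ) = r2 := by
      have := congrArg (· / r) h'
      simpa [Nat.add_mul_div_left _ _ (by omega : 0 < r), Nat.div_eq_of_lt hs1,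
        Nat.div_eq_of_lt hs2] using this
    rw [e1] at h'
    simp only [Prod.mk.injEq]
    exact ⟨Fin.ext e1, Fin.ext (by omega)⟩
  · rintro ⟨r1, s1⟩
    set z : k := ((s1 + r * r1 : ℕ) : k) with hz
    set w : k := a ^ (r1 : ℕ) * η ^ (s1 : ℕ) with hw
    have hw0 : w ≠ 0 := mul_ne_zero (pow_ne_zero _ ha) (pow_ne_zero _ hη)
    change (evalRingHom z) (Matrix.det _) = 0
    rw [RingHom.map_det]
    refine Matrix.exists_mulVec_eq_zero_iff.mp
      ⟨fun j => w ^ ((e.symm j : Fin L) : ℕ), ?_, ?_⟩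
    · intro h
      exact pow_ne_zero _ hw0 (congrFun h (e ⟨l0, hl0⟩))
    · funext i
      have hi : (i : ℕ) < q := i.2
      have hs := hzero r1 r1.2 (s1 + i) (by have := s1.2; omega)
      have hsum : ∀ f : Fin L → k, (∀ l, P l = 0 → f l = 0) →
          ∑ j : Fin q, f (e.symm j) = ∑ l, f l := by
        intro f hf
        rw [Equiv.sum_comp e.symm (fun l => f (l : Fin L)),
          ← Finset.sum_subtype (Finset.univ.filter fun l => P l ≠ 0) (fun l => by simp) f]
        exact Finset.sum_filter_of_ne fun l _ (h : f l ≠ 0) hl => h (hf l hl)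
      rw [← hsum _ (fun l hl => by simp [hl])] at hs
      rw [Pi.zero_apply, ← hs, Matrix.mulVec, dotProduct]
      refine Finset.sum_congr rfl fun l _ => ?_
      simp only [RingHom.mapMatrix_apply, Matrix.map_apply, Matrix.of_apply, coe_evalRingHom,
        eval_mul, eval_comp, eval_add, eval_X, eval_C, hz, hw]
      rw [← Nat.cast_add, show (s1 : ℕ) + r * r1 + i = s1 + i + r * r1 by ring]
      ring
  · rw [Fintype.card_prod, Fintype.card_fin, Fintype.card_fin]
    exact (hd.trans hdL).trans_lt hcard

lemma exists_submatrix_det_ne_zero {ι J : Type*} [Fintype ι] [Fintype J] [DecidableEq J]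
    (A : Matrix ι J k) (h : ∀ c : J → k, A *ᵥ c = 0 → c = 0) :
    ∃ f : J → ι, (A.submatrix f id).det ≠ 0 := by
  have hspan : Submodule.span k (Set.range A.row) = ⊤ := by
    refine Submodule.eq_top_of_finrank_eq ?_
    rw [← rank_eq_finrank_span_row, Matrix.rank, LinearMap.finrank_range_of_inj]
    intro x y hxy
    have := h (x - y) (by
      rw [Matrix.mulVec_sub, sub_eq_zero]; exact hxy)
    exact sub_eq_zero.mp this
  obtain ⟨κ, a, ha, hs, hli⟩ := exists_linearIndependent' k A.row
  rw [hspan] at hs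
  let b := Module.Basis.mk hli hs.ge
  have : Fintype κ := FiniteDimensional.fintypeBasisIndex b
  have hcard : Fintype.card J = Fintype.card κ := by
    rw [← Module.finrank_eq_card_basis b, Module.finrank_fintype_fun_eq_card]
  let e : J ≃ κ := Fintype.equivOfCardEq hcard
  refine ⟨a ∘ e, ?_⟩
  have h2 : LinearIndependent k (A.submatrix (a ∘ e) id).row := hli.comp e e.injective
  rw [Matrix.linearIndependent_rows_iff_isUnit, Matrix.isUnit_iff_isUnit_det] at h2
  exact h2.ne_zero

lemma exists_interpolation_det_ne_zero [CharZero k] {a η : k} {r K L R S : ℕ} (ha : a ≠ 0)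
    (hη : η ≠ 0) (hinj : ∀ i < L, ∀ j < L, η ^ i = η ^ j → i = j)
    (hSr : S ≤ r) (hcard : K * L < R * (S + 1 - L)) :
    ∃ f : Fin K × Fin L → Fin R × Fin S, (Matrix.of fun i j : Fin K × Fin L =>
      ((((f i).2 + r * (f i).1 : ℕ).choose j.1 : ℕ) : k) *
        (a ^ ((f i).1 : ℕ) * η ^ ((f i).2 : ℕ)) ^ (j.2 : ℕ)).det ≠ 0 := by
  refine exists_submatrix_det_ne_zero (Matrix.of fun (p : Fin R × Fin S) (j : Fin K × Fin L) =>
      (((p.2 + r * p.1 : ℕ).choose j.1 : ℕ) : k) * (a ^ (p.1 : ℕ) * η ^ (p.2 : ℕ)) ^ (j.2 : ℕ))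
    fun c hc => ?_
  let B : ℕ → k[X] := fun m => C (((m.factorial : ℕ) : k)⁻¹) * descPochhammer k m
  have hB : ∀ m n : ℕ, (B m).eval (n : k) = (n.choose m : k) := fun m n => by
    rw [Nat.cast_choose_eq_descPochhammer_div]; simp [B]; ring
  let P : Fin L → k[X] := fun l => ∑ i : Fin K, C (c (i, l)) * B i
  have hP : ∀ l, P l = 0 := by
    refine zero_estimate ha hη hinj hSr hcard P (fun l => ?_) fun r' hr s' hs => ?_
    · refine natDegree_sum_le_of_forall_le _ _ fun i _ => ?_
      refine (natDegree_C_mul_le _ _).trans ((natDegree_C_mul_le _ _).trans ?_)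
      rw [descPochhammer_natDegree]; exact i.2.le
    · have h := congrFun hc (⟨r', hr⟩, ⟨s', hs⟩)
      rw [Matrix.mulVec, dotProduct, Fintype.sum_prod_type, Finset.sum_comm, Pi.zero_apply] at h
      rw [← h]
      refine Finset.sum_congr rfl fun l _ => ?_
      rw [eval_finsetSum, Finset.sum_mul]
      refine Finset.sum_congr rfl fun i _ => ?_
      rw [eval_mul, eval_C, hB]; simp only [Matrix.of_apply]; ring
  have key : ∀ (l : Fin L) (m : ℕ) (hm : m < K), c (⟨m, hm⟩, l) = 0 := by
    intro l m
    induction m using Nat.strong_induction_on with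
    | _ m ih =>
      intro hm
      have h := congrArg (eval (m : k)) (hP l)
      rw [eval_finsetSum, eval_zero, Finset.sum_eq_single ⟨m, hm⟩] at h
      · rw [eval_mul, hB] at h; simpa using h
      · intro i _ hi
        rcases lt_or_gt_of_ne (fun h => hi (Fin.ext h) : (i : ℕ) ≠ m) with h1 | h1
        · rw [ih i h1 i.2]; simp
        · rw [eval_mul, hB, Nat.choose_eq_zero_of_lt h1]; simp
      · simp
  funext ⟨i, l⟩
  exact key l i i.2

lemma X_pow_dvd_det {J : Type*} [Fintype J] [DecidableEq J] (E : Matrix J J k[X]) (n : J → k)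
    (hn : Function.Injective n)
    (hE : ∀ j, ∃ P : k[X][X], ∀ i, X ^ Fintype.card J ∣ E i j - P.eval (C (n i) * X)) :
    (X : k[X]) ^ (∑ t ∈ Finset.range (Fintype.card J), t) ∣ E.det := by
  set N := Fintype.card J with hN
  let e : J ≃ Fin N := Fintype.equivFin J
  choose P hP using hE
  choose q hq using hP
  let V : Matrix J J k := Matrix.of fun i t => n i ^ (e t : ℕ)
  have hV : IsUnit V.det := by
    have : V = (vandermonde fun t : Fin N => n (e.symm t)).submatrix e e := by
      ext i t; simp [V, vandermonde]
    rw [this, det_submatrix_equiv_self, isUnit_iff_ne_zero, det_vandermonde_ne_zero_iff]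
    exact hn.comp e.symm.injective
  let V' : Matrix J J k[X] := V.map C
  have hVV : V' * (V⁻¹).map C = 1 := by
    rw [← Matrix.map_mul, Matrix.mul_nonsing_inv _ hV]; simp
  let Q : Matrix J J k[X] := Matrix.of fun i j =>
    q j i + ∑ t ∈ Finset.range ((P j).natDegree + 1),
      (P j).coeff (N + t) * C (n i ^ (N + t)) * X ^ t
  let b : Matrix J J k[X] := Matrix.of fun t j => (P j).coeff (e t)
  have hfac : E = V' * (Matrix.diagonal (fun t => (X : k[X]) ^ (e t : ℕ)) *
      (b + Matrix.diagonal (fun t => (X : k[X]) ^ (N - (e t : ℕ))) * ((V⁻¹).map C * Q))) := by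
    rw [Matrix.mul_add, Matrix.mul_add, ← Matrix.mul_assoc (Matrix.diagonal _)
      (Matrix.diagonal _), Matrix.diagonal_mul_diagonal]
    have h1 : (fun t : J => (X : k[X]) ^ (e t : ℕ) * X ^ (N - (e t : ℕ))) = fun _ => X ^ N := by
      funext t; rw [← pow_add, Nat.add_sub_cancel' (e t).2.le]
    rw [h1]
    have h2 : (Matrix.diagonal fun _ : J => (X : k[X]) ^ N) = (X : k[X]) ^ N • 1 := by
      rw [Matrix.smul_one_eq_diagonal]
    rw [h2, Matrix.smul_mul, Matrix.one_mul, Matrix.mul_smul, ← Matrix.mul_assoc V' ((V⁻¹).map C),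
      hVV, Matrix.one_mul]
    ext1 i j
    rw [Matrix.add_apply, Matrix.smul_apply, smul_eq_mul]
    have h3 : E i j = (P j).eval (C (n i) * X) + X ^ N * q j i := by rw [← hq j i]; ring
    rw [h3, Matrix.mul_apply]
    simp only [Matrix.diagonal_mul, V', Matrix.map_apply, V, Matrix.of_apply, Q, b]
    rw [mul_add, add_comm (X ^ N * q j i), ← add_assoc]
    congr 1
    rw [eval_eq_sum_range' (n := N + ((P j).natDegree + 1)) (by omega), Finset.sum_range_add,
      Finset.mul_sum]
    congr 1
    · rw [← Fin.sum_univ_eq_sum_range, ← Equiv.sum_comp e]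
      refine Finset.sum_congr rfl fun t _ => ?_
      simp only [mul_pow, C_pow]; ring
    · refine Finset.sum_congr rfl fun t _ => ?_
      simp only [mul_pow, C_pow, C_mul, pow_add]; ring
  rw [hfac, det_mul, det_mul, det_diagonal, Equiv.prod_comp e (fun t => (X : k[X]) ^ (t : ℕ)),
    Fin.prod_univ_eq_prod_range (fun t => (X : k[X]) ^ t), Finset.prod_pow_eq_pow_sum]
  exact Dvd.dvd.mul_left (Dvd.dvd.mul_right dvd_rfl _) _

/-- Functions of `n` congruent modulo `X ^ N` to a polynomial in `n X`. -/
def PolyMod (N : ℕ) (f : ℕ → k[X]) : Prop :=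
  ∃ P : k[X][X], ∀ n : ℕ, X ^ N ∣ f n - P.eval (C (n : k) * X)

lemma PolyMod.mul {N : ℕ} {f g : ℕ → k[X]} (hf : PolyMod N f) (hg : PolyMod N g) :
    PolyMod N fun n => f n * g n := by
  obtain ⟨P, hP⟩ := hf
  obtain ⟨Q, hQ⟩ := hg
  refine ⟨P * Q, fun n => ?_⟩
  rw [eval_mul, show f n * g n - P.eval (C (n : k) * X) * Q.eval (C (n : k) * X) =
    (f n - P.eval (C (n : k) * X)) * g n + P.eval (C (n : k) * X) *
      (g n - Q.eval (C (n : k) * X)) by ring]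
  exact dvd_add (Dvd.dvd.mul_right (hP n) _) (Dvd.dvd.mul_left (hQ n) _)

lemma PolyMod.sum {N : ℕ} {ι : Type*} (s : Finset ι) {f : ι → ℕ → k[X]}
    (hf : ∀ i, PolyMod N (f i)) : PolyMod N fun n => ∑ i ∈ s, f i n := by
  choose P hP using hf
  refine ⟨∑ i ∈ s, P i, fun n => ?_⟩
  rw [eval_finsetSum, ← Finset.sum_sub_distrib]
  exact Finset.dvd_sum fun i _ => hP i n

lemma PolyMod.const (N : ℕ) (p : k[X]) : PolyMod N fun _ => p :=
  ⟨C p, fun n => by simp⟩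

lemma PolyMod.congr {N : ℕ} {f g : ℕ → k[X]} (hf : PolyMod N f)
    (h : ∀ n, X ^ N ∣ g n - f n) : PolyMod N g := by
  obtain ⟨P, hP⟩ := hf
  exact ⟨P, fun n => by simpa using dvd_add (h n) (hP n)⟩

lemma PolyMod.choose [CharZero k] (N m : ℕ) :
    PolyMod N fun n => C ((n.choose m : ℕ) : k) * (X : k[X]) ^ m := by
  refine ⟨C (C (((m.factorial : ℕ) : k)⁻¹)) * ∏ i ∈ Finset.range m, (X - C (C (i : k) * X)),
    fun n => ?_⟩
  beta_reduce
  rw [Nat.cast_choose_eq_descPochhammer_div k n m, descPochhammer_eval_eq_prod_range]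
  have : ∏ i ∈ Finset.range m, (C (n : k) * X - C (i : k) * X) =
      C (∏ i ∈ Finset.range m, ((n : k) - i)) * X ^ m := by
    rw [map_prod, ← Finset.card_range m, ← Finset.prod_const, Finset.card_range,
      ← Finset.prod_mul_distrib]
    exact Finset.prod_congr rfl fun i _ => by rw [C_sub]; ring
  simp only [eval_mul, eval_C, eval_prod, eval_sub, eval_X]
  rw [this, div_eq_mul_inv, C_mul]
  ring_nf
  simp

lemma PolyMod.one_add_pow [CharZero k] (N : ℕ) (c : k) :
    PolyMod N fun n => (1 + (X : k[X]) * C c) ^ n := by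
  have h : PolyMod N fun n => ∑ m ∈ Finset.range N,
      C ((n.choose m : ℕ) : k) * (X : k[X]) ^ m * C (c ^ m) :=
    PolyMod.sum _ fun m => (PolyMod.choose N m).mul (PolyMod.const N _)
  refine h.congr fun n => ?_
  have h1 : (1 + (X : k[X]) * C c) ^ n = ∑ m ∈ Finset.range (N + (n + 1)),
      C ((n.choose m : ℕ) : k) * (X : k[X]) ^ m * C (c ^ m) := by
    rw [add_comm 1, add_pow]
    rw [Finset.sum_subset (Finset.range_mono (by omega : n + 1 ≤ N + (n + 1)))]
    · refine Finset.sum_congr rfl fun m _ => ?_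
      simp [mul_pow]; ring
    · intro m _ hm
      rw [Finset.mem_range, not_lt] at hm
      rw [Nat.choose_eq_zero_of_lt (by omega)]; simp
  rw [h1, Finset.sum_range_add, add_sub_cancel_left]
  refine Finset.dvd_sum fun m _ => ?_
  rw [pow_add]
  exact Dvd.intro (C ((n.choose (N + m) : ℕ) : k) * X ^ m * C (c ^ (N + m))) (by ring)

lemma X_pow_dvd_interpolation_det [CharZero k] {K L : ℕ} (n : Fin K × Fin L → ℕ)
    (hn : Function.Injective n) (τ : k) (m : Fin K × Fin L → Fin K × Fin L → ℕ) (c : ℕ → k) :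
    (X : k[X]) ^ (∑ t ∈ Finset.range (K * L), t) ∣
      (Matrix.of fun i j : Fin K × Fin L => C (((n i).choose j.1 : ℕ) : k) *
        (X : k[X]) ^ (j.1 : ℕ) *
        (1 + X * C (c j.2)) ^ (n i) * (1 + X ^ (K * L) * C τ) ^ (m i j)).det := by
  have hc : Fintype.card (Fin K × Fin L) = K * L := by simp
  rw [← hc]
  refine X_pow_dvd_det _ (fun i => (n i : k)) (Nat.cast_injective.comp hn) fun j => ?_
  obtain ⟨P, hP⟩ := (PolyMod.choose (k := k) (Fintype.card (Fin K × Fin L)) (j.1 : ℕ)).mul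
    (PolyMod.one_add_pow _ (c j.2))
  refine ⟨P, fun i => ?_⟩
  rw [Matrix.of_apply]
  set A := C (((n i).choose j.1 : ℕ) : k) * (X : k[X]) ^ (j.1 : ℕ) * (1 + X * C (c j.2)) ^ (n i)
  set B := 1 + (X : k[X]) ^ Fintype.card (Fin K × Fin L) * C τ with hB
  rw [show A * B ^ m i j - P.eval (C (n i : k) * X) =
    A * (B ^ m i j - 1 ^ m i j) + (A - P.eval (C (n i : k) * X)) by ring]
  refine dvd_add (Dvd.dvd.mul_left ((Dvd.intro (C τ) ?_).trans (sub_dvd_pow_sub_pow _ _ _)) _)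
    (hP (n i))
  rw [hB]; ring

end Algebra
end HyperellipticBound

namespace HyperellipticBound

open Function Real Polynomial

section WeightedNorm

variable {K : Type*} [Field K] [NumberField K]

/-- The polynomial `p` has weighted norm (of radius `2`) at most `B` at the place `v`. -/
def NormLE (v : Pl K) (p : K[X]) (B : ℝ) : Prop :=
  0 ≤ B ∧ match v with
  | .inl φ => ∑ i ∈ p.support, av (.inl φ) (p.coeff i) * 2 ^ i ≤ B
  | .inr P => ∀ i, av (.inr P) (p.coeff i) * 2 ^ i ≤ B

lemma normLE_inl {φ : K →+* ℂ} {p : K[X]} {B : ℝ} : NormLE (.inl φ) p B ↔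
    0 ≤ B ∧ ∑ i ∈ p.support, av (.inl φ) (p.coeff i) * 2 ^ i ≤ B := Iff.rfl

lemma normLE_inr {P : HeightOneSpectrum (𝓞 K)} {p : K[X]} {B : ℝ} : NormLE (.inr P) p B ↔
    0 ≤ B ∧ ∀ i, av (.inr P) (p.coeff i) * 2 ^ i ≤ B := Iff.rfl

lemma NormLE.mono {v : Pl K} {p : K[X]} {A B : ℝ} (h : NormLE v p A) (hAB : A ≤ B) :
    NormLE v p B := by
  refine ⟨h.1.trans hAB, ?_⟩
  cases v with
  | inl φ => exact h.2.trans hAB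
  | inr P => exact fun i => (h.2 i).trans hAB

lemma normLE_monomial (v : Pl K) (i : ℕ) (c : K) :
    NormLE v (monomial i c) (av v c * 2 ^ i) := by
  have h0 : 0 ≤ av v c * 2 ^ i := by positivity
  cases v with
  | inl φ =>
    refine normLE_inl.2 ⟨h0, ?_⟩
    refine (Finset.sum_le_sum_of_subset_of_nonneg (support_monomial_subset i c)
      fun _ _ _ => by positivity).trans ?_
    simp
  | inr P =>
    refine normLE_inr.2 ⟨h0, fun j => ?_⟩
    rw [coeff_monomial]
    split_ifs with h
    · rw [h]
    · simp

lemma normLE_C (v : Pl K) (c : K) : NormLE v (C c) (av v c) := by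
  simpa using normLE_monomial v 0 c

lemma normLE_X_pow (v : Pl K) (m : ℕ) : NormLE v (X ^ m) (2 ^ m) := by
  simpa [X_pow_eq_monomial] using normLE_monomial v m 1

lemma NormLE.add_inl {φ : K →+* ℂ} {p q : K[X]} {A B : ℝ} (hp : NormLE (.inl φ) p A)
    (hq : NormLE (.inl φ) q B) : NormLE (.inl φ) (p + q) (A + B) := by
  refine normLE_inl.2 ⟨add_nonneg hp.1 hq.1, ?_⟩
  have h1 : ∀ p : K[X], ∀ s : Finset ℕ, p.support ⊆ s →
      ∑ i ∈ p.support, av (.inl φ) (p.coeff i) * 2 ^ i = ∑ i ∈ s, av (.inl φ) (p.coeff i) * 2 ^ i :=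
    fun p s hs => Finset.sum_subset hs fun i _ hi => by simp [notMem_support_iff.1 hi]
  rw [h1 (p + q) _ support_add]
  refine le_trans ?_ (add_le_add (normLE_inl.1 hp).2 (normLE_inl.1 hq).2)
  rw [h1 p _ Finset.subset_union_left, h1 q (p.support ∪ q.support) Finset.subset_union_right,
    ← Finset.sum_add_distrib]
  refine Finset.sum_le_sum fun i _ => ?_
  rw [← add_mul, coeff_add]
  gcongr
  exact (av _).add_le _ _

lemma NormLE.add_inr {P : HeightOneSpectrum (𝓞 K)} {p q : K[X]} {B : ℝ}
    (hp : NormLE (.inr P) p B) (hq : NormLE (.inr P) q B) : NormLE (.inr P) (p + q) B := by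
  refine normLE_inr.2 ⟨hp.1, fun i => ?_⟩
  have := av_add_le (.inr P) (p.coeff i) (q.coeff i)
  rw [show arch (.inr P : Pl K) = 0 from rfl, zero_mul, exp_zero, one_mul] at this
  rw [coeff_add]
  refine (mul_le_mul_of_nonneg_right this (by positivity)).trans ?_
  rw [max_mul_of_nonneg _ _ (by positivity)]
  exact max_le ((normLE_inr.1 hp).2 i) ((normLE_inr.1 hq).2 i)

lemma normLE_zero (v : Pl K) {B : ℝ} (hB : 0 ≤ B) : NormLE v 0 B := by
  cases v with
  | inl φ => exact normLE_inl.2 ⟨hB, by simpa⟩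
  | inr P => exact normLE_inr.2 ⟨hB, by simpa⟩

lemma NormLE.sum_inl {φ : K →+* ℂ} {ι : Type*} (s : Finset ι) {f : ι → K[X]} {B : ι → ℝ}
    (h : ∀ i ∈ s, NormLE (.inl φ) (f i) (B i)) : NormLE (.inl φ) (∑ i ∈ s, f i) (∑ i ∈ s, B i) := by
  induction s using Finset.induction_on with
  | empty => exact normLE_zero _ (by simp)
  | insert a s ha ih =>
    rw [Finset.sum_insert ha, Finset.sum_insert ha]
    exact (h a (Finset.mem_insert_self _ _)).add_inl
      (ih fun i hi => h i (Finset.mem_insert_of_mem hi))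

lemma NormLE.sum_inr {P : HeightOneSpectrum (𝓞 K)} {ι : Type*} (s : Finset ι) {f : ι → K[X]}
    {B : ℝ} (hB : 0 ≤ B) (h : ∀ i ∈ s, NormLE (.inr P) (f i) B) :
    NormLE (.inr P) (∑ i ∈ s, f i) B := by
  induction s using Finset.induction_on with
  | empty => exact normLE_zero _ hB
  | insert a s ha ih =>
    rw [Finset.sum_insert ha]
    exact (h a (Finset.mem_insert_self _ _)).add_inr
      (ih fun i hi => h i (Finset.mem_insert_of_mem hi))

lemma NormLE.sum {v : Pl K} {ι : Type*} (s : Finset ι) {f : ι → K[X]} {B N : ℝ} (hB : 0 ≤ B)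
    (hN : 0 < N) (hs : (s.card : ℝ) ≤ N) (h : ∀ i ∈ s, NormLE v (f i) B) :
    NormLE v (∑ i ∈ s, f i) (exp (arch v * log N) * B) := by
  cases v with
  | inl φ =>
    refine (NormLE.sum_inl s h).mono ?_
    rw [show arch (.inl φ : Pl K) = 1 from rfl, one_mul, exp_log hN, Finset.sum_const,
      nsmul_eq_mul]
    gcongr
  | inr P =>
    rw [show arch (.inr P : Pl K) = 0 from rfl, zero_mul, exp_zero, one_mul]
    exact NormLE.sum_inr s hB h

lemma NormLE.mul {v : Pl K} {p q : K[X]} {A B : ℝ} (hp : NormLE v p A) (hq : NormLE v q B) :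
    NormLE v (p * q) (A * B) := by
  rw [mul_eq_sum_sum]
  simp only [sum_def]
  have h0 : 0 ≤ A * B := mul_nonneg hp.1 hq.1
  cases v with
  | inl φ =>
    refine (NormLE.sum_inl _ fun i _ => NormLE.sum_inl _ fun j _ =>
      normLE_monomial _ _ _).mono ?_
    refine le_trans (le_of_eq ?_) (mul_le_mul (normLE_inl.1 hp).2 (normLE_inl.1 hq).2
      (Finset.sum_nonneg fun _ _ => by positivity) hp.1)
    rw [Finset.sum_mul_sum]
    refine Finset.sum_congr rfl fun i _ => Finset.sum_congr rfl fun j _ => ?_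
    rw [map_mul, pow_add]; ring
  | inr P =>
    refine NormLE.sum_inr _ h0 fun i _ => NormLE.sum_inr _ h0 fun j _ =>
      (normLE_monomial _ _ _).mono ?_
    rw [map_mul, pow_add]
    calc _ = (av (.inr P) (p.coeff i) * 2 ^ i) * (av (.inr P) (q.coeff j) * 2 ^ j) := by ring
      _ ≤ A * B := mul_le_mul ((normLE_inr.1 hp).2 i) ((normLE_inr.1 hq).2 j) (by positivity) hp.1

lemma normLE_one (v : Pl K) : NormLE v (1 : K[X]) 1 := by
  simpa using normLE_C v (1 : K)

lemma NormLE.pow {v : Pl K} {p : K[X]} {A : ℝ} (hp : NormLE v p A) (m : ℕ) :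
    NormLE v (p ^ m) (A ^ m) := by
  induction m with
  | zero => simpa using normLE_one v
  | succ m ih => rw [pow_succ, pow_succ]; exact ih.mul hp

lemma NormLE.prod {v : Pl K} {ι : Type*} (s : Finset ι) {f : ι → K[X]} {B : ι → ℝ}
    (h : ∀ i ∈ s, NormLE v (f i) (B i)) : NormLE v (∏ i ∈ s, f i) (∏ i ∈ s, B i) := by
  induction s using Finset.induction_on with
  | empty => simpa using normLE_one v
  | insert a s ha ih =>
    rw [Finset.prod_insert ha, Finset.prod_insert ha]
    exact (h a (Finset.mem_insert_self _ _)).mul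
      (ih fun i hi => h i (Finset.mem_insert_of_mem hi))

lemma NormLE.one_add {v : Pl K} {p : K[X]} {A : ℝ} (hp : NormLE v p A) (hv : arch v = 0 → A ≤ 1) :
    NormLE v (1 + p) (1 + arch v * A) := by
  cases v with
  | inl φ => simpa [arch] using (normLE_one _).add_inl hp
  | inr P => simpa [arch] using (normLE_one _).add_inr (hp.mono (hv rfl))

lemma NormLE.of_X_pow_mul {v : Pl K} {p : K[X]} {B : ℝ} {m : ℕ} (h : NormLE v (X ^ m * p) B) :
    NormLE v p (B / 2 ^ m) := by
  have hB := h.1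
  cases v with
  | inl φ =>
    refine normLE_inl.2 ⟨by positivity, ?_⟩
    rw [le_div_iff₀ (by positivity), Finset.sum_mul]
    refine le_trans ?_ (normLE_inl.1 h).2
    have h1 : ∑ i ∈ p.support, av (.inl φ) (p.coeff i) * 2 ^ i * 2 ^ m =
        ∑ i ∈ p.support.map (addRightEmbedding m),
          av (.inl φ) ((X ^ m * p).coeff i) * 2 ^ i := by
      rw [Finset.sum_map]
      refine Finset.sum_congr rfl fun i _ => ?_
      rw [addRightEmbedding_apply, coeff_X_pow_mul, pow_add]; ring
    rw [h1]
    refine Finset.sum_le_sum_of_subset_of_nonneg (fun i hi => ?_) fun _ _ _ => by positivity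
    obtain ⟨j, hj, rfl⟩ := Finset.mem_map.1 hi
    simpa [coeff_X_pow_mul] using hj
  | inr P =>
    refine normLE_inr.2 ⟨by positivity, fun i => ?_⟩
    rw [le_div_iff₀ (by positivity)]
    have := (normLE_inr.1 h).2 (i + m)
    rwa [coeff_X_pow_mul, pow_add, ← mul_assoc] at this

lemma NormLE.av_eval_one_le {v : Pl K} {p : K[X]} {B : ℝ} (h : NormLE v p B) :
    av v (p.eval 1) ≤ B := by
  rw [eval_eq_sum, sum_def]
  simp only [one_pow, mul_one]
  cases v with
  | inl φ =>
    refine ((av _).sum_le _ _).trans (le_trans ?_ (normLE_inl.1 h).2)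
    exact Finset.sum_le_sum fun i _ => le_mul_of_one_le_right (by positivity)
      (one_le_pow₀ (by norm_num))
  | inr P =>
    by_cases hs : p.support.card = 0
    · rw [Finset.card_eq_zero] at hs; simpa [hs] using h.1
    · have := av_sum_le (.inr P) p.support p.coeff (B := B) (N := p.support.card) h.1
        (by exact_mod_cast Nat.one_le_iff_ne_zero.2 hs) le_rfl fun i _ =>
          (le_mul_of_one_le_right (by positivity) (one_le_pow₀ (by norm_num))).trans
            ((normLE_inr.1 h).2 i)
      simpa [arch] using this

lemma NormLE.det {v : Pl K} {n : Type*} [Fintype n] [DecidableEq n] (M : Matrix n n K[X])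
    {B : n → ℝ} (h : ∀ i j, NormLE v (M i j) (B j)) :
    NormLE v M.det (exp (arch v * log ((Fintype.card n).factorial)) * ∏ j, B j) := by
  rcases isEmpty_or_nonempty n with hn | hn
  · simpa using normLE_one v
  rw [Matrix.det_apply']
  have hB : ∀ j, 0 ≤ B j := fun j => (h hn.some j).1
  refine NormLE.sum _ (Finset.prod_nonneg fun j _ => hB j) (by positivity)
    (by simp [Fintype.card_perm]) fun σ _ => ?_
  have h1 : NormLE v ((Equiv.Perm.sign σ : ℤ) : K[X]) 1 := by
    have := normLE_C v ((Equiv.Perm.sign σ : ℤ) : K)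
    rcases Int.units_eq_one_or (Equiv.Perm.sign σ) with h | h <;> simpa [h] using this
  simpa using h1.mul (NormLE.prod Finset.univ fun i _ => h (σ i) i)

lemma av_det_le (v : Pl K) {n : Type*} [Fintype n] [DecidableEq n] (M : Matrix n n K)
    {B : n → ℝ} (h : ∀ i j, av v (M i j) ≤ B j) :
    av v M.det ≤ exp (arch v * log ((Fintype.card n).factorial)) * ∏ j, B j := by
  have := (NormLE.det (M.map C) (v := v) (B := B) fun i j =>
    (normLE_C v (M i j)).mono (h i j)).av_eval_one_le
  rw [← RingHom.mapMatrix_apply, ← RingHom.map_det] at this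
  simpa using this

end WeightedNorm
end HyperellipticBound

namespace HyperellipticBound

open Function Real Polynomial

section TwoLog

variable {K : Type*} [Field K] [NumberField K]

lemma log_factorial_le (N : ℕ) : log (N.factorial : ℝ) ≤ N * log N := by
  rw [← log_pow]
  exact log_le_log (by positivity) (by exact_mod_cast Nat.factorial_le_pow N)

lemma choose_le_exp (n k : ℕ) {δ : ℝ} (hδ : 0 < δ) :
    (n.choose k : ℝ) ≤ exp (k * log (1 / δ) + n * δ) := by
  rcases lt_or_ge n k with h | h
  · rw [Nat.choose_eq_zero_of_lt h]; simpa using (exp_pos _).le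
  have h1 : (n.choose k : ℝ) * δ ^ k ≤ (δ + 1) ^ n := by
    rw [add_pow]
    refine le_trans (le_of_eq ?_) (Finset.single_le_sum (f := fun m => δ ^ m * 1 ^ (n - m) *
      (n.choose m : ℝ)) (fun _ _ => by positivity) (Finset.mem_range.2 (Nat.lt_succ_of_le h)))
    simp [mul_comm]
  have h2 : (δ + 1) ^ n ≤ exp (n * δ) := by
    rw [mul_comm, exp_mul, rpow_natCast]
    exact pow_le_pow_left₀ (by positivity) (add_one_le_exp δ) n
  rw [exp_add, one_div, log_inv, mul_neg, exp_neg, ← log_pow, exp_log (by positivity),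
    inv_mul_eq_div,
    le_div_iff₀ (by positivity)]
  exact h1.trans h2

lemma av_choose_le (v : Pl K) {n k m A : ℕ} {δ : ℝ} (hδ : 0 < δ) (hδ1 : δ ≤ 1)
    (hn : n ≤ m) (hk : k ≤ A) :
    av v ((n.choose k : ℕ) : K) ≤ exp (arch v * (A * log (1 / δ) + m * δ)) := by
  have hE : 0 ≤ log (1 / δ) := log_nonneg (by rw [le_div_iff₀ hδ]; linarith)
  have hk' : (k : ℝ) ≤ A := by exact_mod_cast hk
  have hn' : (n : ℝ) ≤ m := by exact_mod_cast hn
  have h := av_natCast_le v (n.choose k) (B := exp (A * log (1 / δ) + m * δ))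
    (one_le_exp (by positivity)) ((choose_le_exp n k hδ).trans (exp_le_exp.2 (by gcongr)))
  rwa [log_exp] at h

lemma one_add_arch_mul_le (v : Pl K) {A B : ℝ} (h : arch v = 1 → A ≤ B) :
    1 + arch v * A ≤ exp (arch v * B) := by
  cases v with
  | inl φ =>
    simp only [arch, one_mul]
    have := add_one_le_exp B
    linarith [h rfl]
  | inr P => simp [arch]

lemma av_interpolation_det_le (v : Pl K) {A L nm mm : ℕ} (n : Fin A × Fin L → ℕ)
    (hn : Function.Injective n) (hnm : ∀ i, n i ≤ nm) (τ : K)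
    (m : Fin A × Fin L → Fin A × Fin L → ℕ) (hmm : ∀ i j, m i j ≤ mm) (c : ℕ → K)
    {δ γ : ℝ} (hδ : 0 < δ) (hδ1 : δ ≤ 1) (hγ : 0 ≤ γ)
    (hτ : av v τ * 2 ^ (A * L) ≤ 1) (hc0 : arch v = 0 → ∀ l < L, av v (c l) * 2 ≤ 1)
    (hc1 : arch v = 1 → ∀ l < L, av v (c l) * 2 ≤ γ) :
    av v (Matrix.of fun i j : Fin A × Fin L => (((n i).choose j.1 : ℕ) : K) *
        (1 + c j.2) ^ (n i) * (1 + τ) ^ (m i j)).det ≤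
      exp (arch v * log ((A * L).factorial)) *
        exp (arch v * (A * log (1 / δ) + nm * δ + nm * γ + mm) + A * log 2) ^ (A * L) /
        2 ^ (∑ t ∈ Finset.range (A * L), t) := by
  set M : Matrix (Fin A × Fin L) (Fin A × Fin L) K[X] := Matrix.of fun i j =>
    C (((n i).choose j.1 : ℕ) : K) * (X : K[X]) ^ (j.1 : ℕ) *
        (1 + X * C (c j.2)) ^ (n i) * (1 + X ^ (A * L) * C τ) ^ (m i j) with hM
  obtain ⟨p, hp⟩ := X_pow_dvd_interpolation_det n hn τ m c
  have hev : (Matrix.of fun i j : Fin A × Fin L => (((n i).choose j.1 : ℕ) : K) *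
        (1 + c j.2) ^ (n i) * (1 + τ) ^ (m i j)).det = p.eval 1 := by
    have h := congrArg (Polynomial.eval (1 : K)) hp
    rw [eval_mul, eval_pow, eval_X, one_pow, one_mul] at h
    rw [← h, ← coe_evalRingHom, RingHom.map_det]
    congr 1
    ext i j
    simp
  rw [hev]
  refine NormLE.av_eval_one_le (NormLE.of_X_pow_mul ?_)
  rw [← hp]
  have hent : ∀ i j, NormLE v (M i j)
      (exp (arch v * (A * log (1 / δ) + nm * δ + nm * γ + mm) + A * log 2)) := by
    intro i j
    have e1 := (normLE_C v (((n i).choose j.1 : ℕ) : K)).mono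
      (av_choose_le v hδ hδ1 (hnm i) j.1.2.le)
    have e2 : NormLE v ((X : K[X]) ^ (j.1 : ℕ)) (exp (A * log 2)) := (normLE_X_pow v _).mono (by
      rw [← log_pow, exp_log (by positivity)]
      exact pow_le_pow_right₀ (by norm_num) j.1.2.le)
    have hX : NormLE v (X : K[X]) 2 := by simpa using normLE_X_pow v 1
    have e3 : NormLE v ((1 + X * C (c j.2)) ^ (n i)) (exp (arch v * (nm * γ))) := by
      refine (((hX.mul (normLE_C v (c j.2))).one_add fun h => by
        linarith [hc0 h j.2 j.2.2]).pow (n i)).mono ?_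
      have h1 := one_add_arch_mul_le v (A := 2 * av v (c j.2)) (B := γ) fun h => by
        linarith [hc1 h j.2 j.2.2]
      have := arch_nonneg v
      refine (pow_le_pow_left₀ (by positivity) h1 _).trans ?_
      rw [← exp_nat_mul, exp_le_exp]
      have hn' : (n i : ℝ) ≤ nm := by exact_mod_cast hnm i
      nlinarith [mul_nonneg this hγ]
    have e4 : NormLE v ((1 + X ^ (A * L) * C τ) ^ (m i j)) (exp (arch v * mm)) := by
      refine ((((normLE_X_pow v _).mul (normLE_C v τ)).one_add fun h => by
        linarith).pow _).mono ?_
      have h1 := one_add_arch_mul_le v (A := 2 ^ (A * L) * av v τ) (B := 1) fun h => by linarith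
      have := arch_nonneg v
      refine (pow_le_pow_left₀ (by positivity) h1 _).trans ?_
      rw [← exp_nat_mul, exp_le_exp]
      have hn' : (m i j : ℝ) ≤ mm := by exact_mod_cast hmm i j
      nlinarith
    refine (((e1.mul e2).mul e3).mul e4).mono (le_of_eq ?_)
    rw [← exp_add, ← exp_add, ← exp_add]
    ring_nf
  refine (NormLE.det M hent).mono (le_of_eq ?_)
  simp

/-- The fundamental inequality for a nonvanishing interpolation determinant. -/
lemma interpolation_liouville {A L R S r : ℕ} {u η : K}
    (f : Fin A × Fin L → Fin R × Fin S) (hSr : S ≤ r)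
    (hdet : (Matrix.of fun i j : Fin A × Fin L =>
      ((((f i).2 + r * (f i).1 : ℕ).choose j.1 : ℕ) : K) *
        ((u * η ^ r) ^ ((f i).1 : ℕ) * η ^ ((f i).2 : ℕ)) ^ (j.2 : ℕ)).det ≠ 0)
    (v₀ : Pl K) {δ γ : ℝ} (hδ : 0 < δ) (hδ1 : δ ≤ 1) (hγ : 0 ≤ γ)
    (hτ : av v₀ (u - 1) * 2 ^ (A * L) ≤ 1)
    (hc0 : arch v₀ = 0 → ∀ l < L, av v₀ (η ^ l - 1) * 2 ≤ 1)
    (hc1 : arch v₀ = 1 → ∀ l < L, av v₀ (η ^ l - 1) * 2 ≤ γ) (hAL : 0 < A * L) :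
    ((A * L : ℕ) - 1 : ℝ) / 2 * log 2 ≤
      (Module.finrank ℚ K + 1) * (log (A * L : ℕ) + A * log (1 / δ) + (S + r * R) * δ) +
      (S + r * R) * γ + R * L + A * log 2 + L * (R * ht (u * η ^ r) + S * ht η) := by
  set a := u * η ^ r with ha
  set N := A * L with hN
  set E := log (1 / δ) with hE
  set Δ := (Matrix.of fun i j : Fin A × Fin L =>
      ((((f i).2 + r * (f i).1 : ℕ).choose j.1 : ℕ) : K) *
        (a ^ ((f i).1 : ℕ) * η ^ ((f i).2 : ℕ)) ^ (j.2 : ℕ)).det with hΔ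
  have hE0 : 0 ≤ E := log_nonneg (by rw [le_div_iff₀ hδ]; linarith)
  have hN1 : (1 : ℝ) ≤ N := by exact_mod_cast hAL
  let n : Fin A × Fin L → ℕ := fun i => (f i).2 + r * (f i).1
  have hn : Function.Injective n := by
    intro i i' h
    have h1 : ((f i).2 : ℕ) = (f i').2 := by
      have := congrArg (· % r) h
      simpa [n, Nat.mod_eq_of_lt ((f i).2.2.trans_le hSr),
        Nat.mod_eq_of_lt ((f i').2.2.trans_le hSr)] using this
    have h2 : ((f i).1 : ℕ) = (f i').1 := by
      have hr : 0 < r := (Nat.zero_le _).trans_lt ((f i).2.2.trans_le hSr)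
      refine Nat.eq_of_mul_eq_mul_left hr ?_
      have : n i = n i' := h
      simp only [n] at this
      omega
    by_contra hne
    refine hdet (Matrix.det_zero_of_row_eq hne ?_)
    ext j
    simp [h1, h2]
  have hnm : ∀ i, n i ≤ S + r * R := fun i =>
    Nat.add_le_add (f i).2.2.le (Nat.mul_le_mul_left _ (f i).1.2.le)
  have hsmall : lg v₀ Δ ≤ arch v₀ * log (N.factorial) +
      N * (arch v₀ * (A * E + (S + r * R : ℕ) * δ + (S + r * R : ℕ) * γ + (R * L : ℕ))
        + A * log 2) - N * (N - 1) / 2 * log 2 := by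
    have h := av_interpolation_det_le v₀ n hn hnm (u - 1)
      (fun i j => (f i).1 * j.2) (mm := R * L)
      (fun i j => Nat.mul_le_mul (f i).1.2.le j.2.2.le) (fun l => η ^ l - 1) hδ hδ1 hγ hτ hc0 hc1
    have h1 : (Matrix.of fun i j : Fin A × Fin L => (((n i).choose j.1 : ℕ) : K) *
        (1 + (η ^ (j.2 : ℕ) - 1)) ^ (n i) * (1 + (u - 1)) ^ ((f i).1 * j.2 : ℕ)).det = Δ := by
      rw [hΔ]
      congr 1
      ext i j
      simp only [Matrix.of_apply, n, ha, add_sub_cancel]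
      ring
    rw [h1] at h
    have h2 := log_le_log (av_pos v₀ hdet) h
    rw [log_div (by positivity) (by positivity), log_mul (by positivity) (by positivity), log_exp,
      log_pow, log_exp, log_pow] at h2
    have h3 : ((∑ t ∈ Finset.range N, t : ℕ) : ℝ) = N * (N - 1) / 2 := by
      rw [eq_div_iff (by norm_num)]
      have := Finset.sum_range_id_mul_two N
      have h4 : (((∑ t ∈ Finset.range N, t) * 2 : ℕ) : ℝ) = ((N * (N - 1) : ℕ) : ℝ) := by rw [this]
      rw [Nat.cast_mul, Nat.cast_mul, Nat.cast_sub hAL] at h4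
      simpa using h4
    rw [h3] at h2
    exact h2
  have hgen : ∀ v, lg v Δ ≤ arch v * log (N.factorial) +
      N * (arch v * (A * E + (S + r * R : ℕ) * δ) + L * (R * lp v a + S * lp v η)) := by
    intro v
    have h := av_det_le v (Matrix.of fun i j : Fin A × Fin L =>
      ((((f i).2 + r * (f i).1 : ℕ).choose j.1 : ℕ) : K) *
        (a ^ ((f i).1 : ℕ) * η ^ ((f i).2 : ℕ)) ^ (j.2 : ℕ))
      (B := fun _ => exp (arch v * (A * E + (S + r * R : ℕ) * δ) +
        L * (R * lp v a + S * lp v η))) fun i j => by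
      rw [Matrix.of_apply, map_mul, exp_add]
      refine mul_le_mul (av_choose_le v hδ hδ1 (hnm i) j.1.2.le) ?_ (by positivity) (by positivity)
      rw [map_pow, map_mul, map_pow, map_pow]
      have ha' := av_le_exp v a
      have hη' := av_le_exp v η
      have hR : ((f i).1 : ℝ) ≤ R := by exact_mod_cast (f i).1.2.le
      have hS : ((f i).2 : ℝ) ≤ S := by exact_mod_cast (f i).2.2.le
      have hL : (j.2 : ℝ) ≤ L := by exact_mod_cast j.2.2.le
      have := lp_nonneg v a
      have := lp_nonneg v η
      calc _ ≤ (exp (lp v a) ^ ((f i).1 : ℕ) * exp (lp v η) ^ ((f i).2 : ℕ)) ^ (j.2 : ℕ) := by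
            gcongr
        _ = exp (j.2 * ((f i).1 * lp v a + (f i).2 * lp v η)) := by
            rw [← exp_nat_mul, ← exp_nat_mul, ← exp_add, ← exp_nat_mul]
        _ ≤ _ := by
            rw [exp_le_exp]
            gcongr
    have h2 := log_le_log (av_pos v hdet) h
    rw [Finset.prod_const, Finset.card_univ, Fintype.card_prod, Fintype.card_fin, Fintype.card_fin,
      log_mul (by positivity) (by positivity), log_exp, log_pow, log_exp] at h2
    exact h2
  have hlf : log (N.factorial : ℝ) ≤ N * log N := log_factorial_le N
  set nm : ℝ := ((S + r * R : ℕ) : ℝ) with hnmR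
  have hnm' : nm = S + r * R := by simp [hnmR]
  set g : Pl K → ℝ := fun v => arch v * (log (N.factorial) + N * (A * E + nm * δ)) +
    (N * L * R * lp v a + N * L * S * lp v η) with hg
  set e₀ : ℝ := N * (nm * γ + R * L + A * log 2) - N * (N - 1) / 2 * log 2 with he₀
  have hle : ∀ v, lg v Δ ≤ g v + if v = v₀ then e₀ else 0 := by
    intro v
    split_ifs with h
    · subst h
      refine hsmall.trans ?_
      have h1 := arch_le_one v
      have h0 := arch_nonneg v
      have h2 : (0 : ℝ) ≤ N * (nm * γ + R * L) := by positivity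
      have h3 : (0 : ℝ) ≤ N * L * R * lp v a + N * L * S * lp v η := by
        have := lp_nonneg v a
        have := lp_nonneg v η
        positivity
      have h4 : arch v * (N * (nm * γ + R * L)) ≤ N * (nm * γ + R * L) := by nlinarith
      simp only [hg, he₀]
      push_cast
      nlinarith
    · refine (hgen v).trans (le_of_eq ?_)
      simp only [hg]
      ring
  have hfa := hasFiniteSupport_lp a
  have hfη := hasFiniteSupport_lp η
  have hfarch := hasFiniteSupport_arch (K := K)
  have hs1 :
      (fun v : Pl K => arch v * (log (N.factorial) + N * (A * E + nm * δ))).HasFiniteSupport :=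
    by fun_prop
  have hs2 : (fun v : Pl K => N * L * R * lp v a).HasFiniteSupport := by fun_prop
  have hs3 : (fun v : Pl K => N * L * S * lp v η).HasFiniteSupport := by fun_prop
  have hs4 : (fun v : Pl K => if v = v₀ then e₀ else 0).HasFiniteSupport :=
    (Set.finite_singleton v₀).subset fun v hv => by
      by_contra h
      exact hv (if_neg h)
  have hgf : g.HasFiniteSupport := hs1.add (hs2.add hs3)
  have hsum : ∑ᶠ v, lg v Δ ≤ ∑ᶠ v, (g v + if v = v₀ then e₀ else 0) :=
    finsum_le_finsum_of_le (hasFiniteSupport_lg Δ) (hgf.add hs4) hle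
  have hg' : ∑ᶠ v, g v = Module.finrank ℚ K * (log (N.factorial) + N * (A * E + nm * δ)) +
      (N * L * R * ht a + N * L * S * ht η) := by
    have hs5 : (fun v : Pl K => N * L * R * lp v a + N * L * S * lp v η).HasFiniteSupport :=
      hs2.add hs3
    rw [hg]
    beta_reduce
    rw [finsum_add_distrib hs1 hs5, finsum_add_distrib hs2 hs3,
      ← finsum_mul, ← mul_finsum, ← mul_finsum, finsum_arch, ht, ht]
  rw [finsum_lg hdet, finsum_add_distrib hgf hs4, finsum_eq_single _ v₀ fun v hv => if_neg hv,
    if_pos rfl, hg'] at hsum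
  have hD : (0 : ℝ) ≤ Module.finrank ℚ K := Nat.cast_nonneg _
  have hlN : 0 ≤ log (N : ℝ) := log_nonneg hN1
  have hnm0 : 0 ≤ nm := by rw [hnm']; positivity
  refine le_of_mul_le_mul_left ?_ (zero_lt_one.trans_le hN1)
  rw [← hnm']
  have h5 : (0 : ℝ) ≤ N * (log N + A * E + nm * δ) := by positivity
  have h6 := mul_le_mul_of_nonneg_left hlf hD
  rw [he₀] at hsum
  nlinarith

lemma two_log_parameters {L r : ℕ} {δ H : ℝ} (hδ : 0 < δ) (hH : 1 ≤ H) (hδr : 1 ≤ δ * r)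
    (hLδ : 2000 * L * δ ≤ 1) (hL128 : (128 : ℝ) ≤ L) :
    ∃ S R A : ℕ, S ≤ r ∧ A * L < R * (S + 1 - L) ∧ 0 < A * L ∧
      (A : ℝ) * L ≤ 300000 * (L ^ 2 * δ * r * H) ∧ 16 * (12 * (R * (δ * r)) + S * H) ≤ A := by
  have hδ1 : δ ≤ 1 / 256000 := by nlinarith
  set x := δ * r with hx
  have hrx : (256000 : ℝ) ≤ r := by
    by_contra! h
    have : x < 1 := by rw [hx]; nlinarith
    linarith
  set S := ⌈1000 * L * x⌉₊ with hS
  have hS1 : 1000 * L * x ≤ S := Nat.le_ceil _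
  have hS2 : (S : ℝ) < 1000 * L * x + 1 := Nat.ceil_lt_add_one (by positivity)
  set R := ⌈S * H / x⌉₊ with hR
  have hx0 : 0 < x := by linarith
  have hR1 : S * H ≤ R * x := by
    rw [← div_le_iff₀ hx0]; exact Nat.le_ceil _
  have hR2 : R * x < S * H + x := by
    have : (R : ℝ) < S * H / x + 1 := Nat.ceil_lt_add_one (by positivity)
    calc R * x < (S * H / x + 1) * x := by gcongr
      _ = _ := by field_simp
  set A := ⌈16 * (12 * (R * x) + S * H)⌉₊ with hA
  have hA1 : 16 * (12 * (R * x) + S * H) ≤ A := Nat.le_ceil _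
  have hA2 : (A : ℝ) < 16 * (12 * (R * x) + S * H) + 1 := Nat.ceil_lt_add_one (by positivity)
  have hLx : (128000 : ℝ) * x ≤ S := by nlinarith
  have hSH : (S : ℝ) ≤ S * H := le_mul_of_one_le_right (by positivity) hH
  have hA3 : (A : ℝ) ≤ 210 * (S * H) := by nlinarith
  have hSr : S ≤ r := by
    have h1 : 1000 * L * x ≤ r / 2 := by
      calc 1000 * L * x = 2000 * L * δ * (r / 2) := by rw [hx]; ring
        _ ≤ 1 * (r / 2) := by gcongr
        _ = _ := one_mul _
    have : (S : ℝ) ≤ r := by linarith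
    exact_mod_cast this
  have hLS : 1000 * (L : ℝ) ≤ S := by nlinarith
  have hLS' : L ≤ S := by
    have : (L : ℝ) ≤ S := by linarith
    exact_mod_cast this
  have hSHx : 0 < S * H := by nlinarith
  have hcard : A * L < R * (S + 1 - L) := by
    have : (A * L : ℝ) < R * (S + 1 - L) := by
      have h1 : (999 : ℝ) * (L * x) ≤ S - L := by nlinarith
      have h2 : 999 * (L * (R * x)) ≤ R * (S - L) := by
        nlinarith [(Nat.cast_nonneg R : (0 : ℝ) ≤ R)]
      nlinarith [(Nat.cast_nonneg R : (0 : ℝ) ≤ R)]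
    have h3 : ((S + 1 - L : ℕ) : ℝ) = S + 1 - L := by
      rw [Nat.cast_sub (by omega)]; push_cast; ring
    rw [← h3] at this
    exact_mod_cast this
  refine ⟨S, R, A, hSr, hcard, ?_, ?_, hA1⟩
  · have h1 : 0 < (A : ℝ) := by nlinarith
    have h2 : 0 < (A * L : ℝ) := by positivity
    exact_mod_cast h2
  · calc (A : ℝ) * L ≤ 210 * (S * H) * L := by gcongr
      _ ≤ 210 * ((1001 * L * x) * H) * L := by gcongr; nlinarith
      _ = 210210 * (L ^ 2 * δ * r * H) := by rw [hx]; ring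
      _ ≤ _ := by gcongr; norm_num

lemma two_log_numerics {L r S R A : ℕ} {δ H D h h' : ℝ} (hδ : 0 < δ)
    (hD : 1 ≤ D) (hH : 1 ≤ H) (hδr : 1 ≤ δ * r) (hLδ : 2000 * L * δ ≤ 1)
    (hE : 1 ≤ log (1 / δ)) (hL : 64 * (D + 1) * log (1 / δ) ≤ L) (hA1' : (1 : ℝ) ≤ A)
    (hR1' : (1 : ℝ) ≤ R) (hSr : S ≤ r) (hA1 : 16 * (12 * (R * (δ * r)) + S * H) ≤ A)
    (hh : h ≤ δ * r) (hh' : h' ≤ H) :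
    (D + 1) * (log (A * L : ℕ) + A * log (1 / δ) + (S + r * R) * δ) +
      (S + r * R) * (4 * L * δ) + R * L + A * log 2 + L * (R * h + S * h') <
      ((A * L : ℕ) - 1 : ℝ) / 2 * log 2 := by
  set E := log (1 / δ) with hEdef
  have hL128 : (128 : ℝ) ≤ L := by nlinarith
  set x := δ * r with hx
  have hlog : log (A * L : ℕ) ≤ 2 * (A * E) := by
    push_cast
    rw [log_mul (by positivity) (by positivity)]
    have h1 : log (A : ℝ) ≤ A := (log_le_sub_one_of_pos (by positivity)).trans (by linarith)
    have h2 : log (L : ℝ) ≤ E := log_le_log (by positivity) (by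
      rw [le_div_iff₀ hδ]; nlinarith)
    nlinarith
  have hSr' : (S : ℝ) ≤ r := by exact_mod_cast hSr
  have h1 : (S + r * R) * δ ≤ 2 * (R * x) := by
    have : S + r * R ≤ 2 * (r * R : ℝ) := by nlinarith
    calc _ ≤ 2 * (r * R : ℝ) * δ := by gcongr
      _ = _ := by rw [hx]; ring
  have hSH0 : (0 : ℝ) ≤ S * H := by positivity
  have hRx : 192 * (R * x) ≤ A := by linarith
  have hDE : (D + 1) * E ≤ L / 64 := by linarith
  have hDL : D + 1 ≤ L / 64 := by nlinarith
  have h2 : (D + 1) * (log (A * L : ℕ) + A * E + (S + r * R) * δ) ≤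
      3 * (A * L) / 64 + L / 64 * (A / 96) := by
    calc _ ≤ (D + 1) * (2 * (A * E) + A * E + A / 96) := by gcongr; linarith
      _ = 3 * A * ((D + 1) * E) + (D + 1) * (A / 96) := by ring
      _ ≤ 3 * A * (L / 64) + L / 64 * (A / 96) := by gcongr
      _ = _ := by ring
  have h3 : (S + r * R) * (4 * L * δ) ≤ A * L / 24 := by
    calc _ = 4 * L * ((S + r * R) * δ) := by ring
      _ ≤ 4 * L * (A / 96) := by gcongr; linarith
      _ = _ := by ring
  have h4 : (R : ℝ) * L ≤ A * L / 192 := by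
    have : (R : ℝ) ≤ R * x := le_mul_of_one_le_right (by positivity) hδr
    calc (R : ℝ) * L ≤ A / 192 * L := by gcongr; linarith
      _ = _ := by ring
  have h5 : A * log 2 ≤ A * L / 128 := by
    have := log_two_lt_d9
    calc A * log 2 ≤ A * (L / 128) := by gcongr; linarith
      _ = _ := by ring
  have h6 : L * (R * h + S * h') ≤ A * L / 16 := by
    calc _ ≤ L * (R * x + S * H) := by gcongr
      _ ≤ L * (A / 16) := by gcongr; nlinarith
      _ = _ := by ring
  have h7 : (128 : ℝ) ≤ A * L := by nlinarith
  have h8 := log_two_gt_d9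
  push_cast at h2 ⊢
  nlinarith

lemma av_pow_sub_one_le_of_arch_eq_zero {v : Pl K} {η : K} (h : arch v = 0)
    (hη : av v (η - 1) * 2 ≤ 1) (l : ℕ) : av v (η ^ l - 1) * 2 ≤ 1 := by
  rw [← mul_geom_sum, map_mul]
  have hη1 : av v η ≤ 1 := by
    have := av_add_le v (η - 1) 1
    rw [h, zero_mul, exp_zero, one_mul, sub_add_cancel, map_one] at this
    exact this.trans (max_le (by linarith [hη]) le_rfl)
  have hg : av v (∑ i ∈ Finset.range l, η ^ i) ≤ 1 := by
    rcases Nat.eq_zero_or_pos l with rfl | hl0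
    · simp
    have := av_sum_le v (Finset.range l) (fun i => η ^ i) (B := 1) (N := l) zero_le_one
      (by exact_mod_cast hl0) (by simp) fun i _ => by
        rw [map_pow]; exact pow_le_one₀ ((av v).nonneg _) hη1
    rwa [h, zero_mul, exp_zero, one_mul] at this
  have := (av v).nonneg (η - 1)
  have := (av v).nonneg (∑ i ∈ Finset.range l, η ^ i)
  nlinarith [hη]

lemma av_pow_sub_one_le {v : Pl K} {η : K} {δ : ℝ} (hδ : 0 < δ) {L l : ℕ}
    (hη : av v (η - 1) ≤ δ) (hl : l < L) (hLδ : 2000 * L * δ ≤ 1) :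
    av v (η ^ l - 1) * 2 ≤ 4 * L * δ := by
  rw [← mul_geom_sum, map_mul]
  have hη1 : av v η ≤ 1 + δ := by
    have := (av v).add_le (η - 1) 1
    rw [sub_add_cancel, map_one] at this
    linarith [hη]
  have hg : av v (∑ i ∈ Finset.range l, η ^ i) ≤ L * 2 := by
    refine ((av v).sum_le _ _).trans ?_
    have h2 : ∀ i ∈ Finset.range l, av v (η ^ i) ≤ 2 := fun i hi => by
      rw [map_pow]
      have hi' : (i : ℝ) ≤ L := by
        exact_mod_cast ((Finset.mem_range.1 hi).trans hl).le
      calc av v η ^ i ≤ exp δ ^ i := by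
            gcongr; linarith [add_one_le_exp δ]
        _ = exp (i * δ) := by rw [exp_nat_mul]
        _ ≤ exp (log 2) := exp_le_exp.2 (by
            have := log_two_gt_d9
            nlinarith)
        _ = 2 := exp_log two_pos
    refine (Finset.sum_le_card_nsmul _ _ _ h2).trans ?_
    rw [Finset.card_range, nsmul_eq_mul]
    gcongr
  calc _ ≤ δ * (L * 2) * 2 := by gcongr
    _ = 4 * L * δ := by ring

/-- An element very close to `1` at a place is not, up to a power of an element
moderately close to `1` there, of relatively small height. -/
theorem two_log {u η : K} (hu : u ≠ 0) (hη : η ≠ 0) (v₀ : Pl K) {L r : ℕ} {δ H : ℝ}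
    (hinj : ∀ i < L, ∀ j < L, η ^ i = η ^ j → i = j) (hδ : 0 < δ) (hH : 1 ≤ H)
    (hδr : 1 ≤ δ * r) (hLδ : 2000 * L * δ ≤ 1) (hE : 1 ≤ log (1 / δ))
    (hL : 64 * (Module.finrank ℚ K + 1) * log (1 / δ) ≤ L)
    (hht : ht (u * η ^ r) ≤ δ * r) (hhη : ht η ≤ H)
    (hc0 : arch v₀ = 0 → av v₀ (η - 1) * 2 ≤ 1)
    (hc1 : arch v₀ = 1 → av v₀ (η - 1) ≤ δ) :
    -lg v₀ (u - 1) < 300000 * (L ^ 2 * δ * r * H) := by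
  by_contra! hlg
  have hD : (1 : ℝ) ≤ Module.finrank ℚ K := by exact_mod_cast Module.finrank_pos
  set D : ℝ := (Module.finrank ℚ K : ℝ) with hDdef
  have hL128 : (128 : ℝ) ≤ L := by nlinarith
  obtain ⟨S, R, A, hSr, hcard, hN, h3, hA1⟩ := two_log_parameters hδ hH hδr hLδ hL128
  obtain ⟨f, hf⟩ := exists_interpolation_det_ne_zero (a := u * η ^ r) (η := η)
    (mul_ne_zero hu (pow_ne_zero _ hη)) hη hinj hSr hcard
  have hτ : av v₀ (u - 1) * 2 ^ (A * L) ≤ 1 := by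
    rcases eq_or_ne (u - 1) 0 with h | h
    · simp [h]
    have h1 : log (av v₀ (u - 1) * 2 ^ (A * L)) ≤ 0 := by
      rw [log_mul (av_pos _ h).ne' (by positivity), log_pow]
      have h2 : ((A * L : ℕ) : ℝ) * log 2 ≤ A * L := by
        push_cast
        have := log_two_lt_d9
        exact mul_le_of_le_one_right (by positivity) (by linarith)
      change log (av v₀ (u - 1)) + _ ≤ 0
      rw [lg] at hlg
      linarith
    exact (log_nonpos_iff (mul_nonneg ((av v₀).nonneg _) (by positivity))).1 h1
  have hkey := interpolation_liouville f hSr hf v₀ hδ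
    (by by_contra! h; linarith [log_nonpos (by positivity) ((div_le_one hδ).2 h.le)])
    (γ := 4 * L * δ) (by positivity) hτ (fun h l _ => av_pow_sub_one_le_of_arch_eq_zero h (hc0 h) l)
    (fun h l hl => av_pow_sub_one_le hδ (hc1 h) hl hLδ) hN
  have hA1' : (1 : ℝ) ≤ A := by
    have : 0 < A := Nat.pos_of_mul_pos_right hN
    exact_mod_cast this
  have hR1' : (1 : ℝ) ≤ R := by
    have : 0 < R := Nat.pos_of_ne_zero fun h => by rw [h] at hcard; omega
    exact_mod_cast this
  exact absurd hkey (not_le.2 (two_log_numerics hδ hD hH hδr hLδ hE hL hA1' hR1' hSr hA1 hht hhη))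

end TwoLog
end HyperellipticBound

namespace HyperellipticBound

/-! ### Counting ideals of bounded norm -/

section IdealCount

variable {K : Type*} [Field K] [NumberField K]

lemma two_le_absNorm (P : HeightOneSpectrum (𝓞 K)) : 2 ≤ Ideal.absNorm P.asIdeal := by
  exact NumberField.HeightOneSpectrum.one_lt_absNorm P

lemma absNorm_under_le (P : HeightOneSpectrum (𝓞 K)) :
    ∃ p : ℕ, p.Prime ∧ p ≤ Ideal.absNorm P.asIdeal ∧
      P.asIdeal.under ℤ = Ideal.span {(p : ℤ)} := by
  have := P.isPrime
  have hne : P.asIdeal.under ℤ ≠ ⊥ := Ideal.IsIntegral.comap_ne_bot (R := ℤ) P.ne_bot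
  obtain ⟨g, hg⟩ := (IsPrincipalIdealRing.principal (P.asIdeal.under ℤ)).principal
  have hspan : P.asIdeal.under ℤ = Ideal.span {((g.natAbs : ℕ) : ℤ)} := by
    rw [hg]; exact Ideal.span_singleton_eq_span_singleton.2 (Int.associated_natAbs g)
  have hprime : (P.asIdeal.under ℤ).IsPrime := inferInstance
  have h0 : ((g.natAbs : ℕ) : ℤ) ≠ 0 := by
    intro h; rw [h] at hspan; simp at hspan; exact hne hspan
  have hp : g.natAbs.Prime := by
    rw [hspan, Ideal.span_singleton_prime h0] at hprime
    exact Nat.prime_iff_prime_int.2 hprime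
  refine ⟨g.natAbs, hp, ?_, hspan⟩
  have hlo : P.asIdeal.LiesOver (Ideal.span {((g.natAbs : ℕ) : ℤ)}) := ⟨hspan.symm⟩
  have hpos : 0 < Ideal.absNorm P.asIdeal := lt_of_lt_of_le two_pos (two_le_absNorm P)
  have := Ideal.absNorm_eq_pow_inertiaDeg' P.asIdeal hp
  rw [this]
  refine Nat.le_self_pow ?_ _
  intro h
  rw [h, pow_zero] at this
  have := two_le_absNorm P
  omega

/-- The function `m ↦ m^{-3/2}`. -/
def wt (m : ℕ) : ℝ := 1 / (m * Real.sqrt m)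

lemma wt_nonneg (m : ℕ) : 0 ≤ wt m := by unfold wt; positivity

lemma wt_mul (m k : ℕ) : wt (m * k) = wt m * wt k := by
  simp only [wt, Nat.cast_mul, Real.sqrt_mul (Nat.cast_nonneg m)]
  rw [div_mul_div_comm, one_mul]; congr 1; ring

lemma wt_one : wt 1 = 1 := by simp [wt]

lemma wt_pow (m k : ℕ) : wt (m ^ k) = wt m ^ k := by
  induction k with
  | zero => simp [wt_one]
  | succ k ih => rw [pow_succ, wt_mul, ih, pow_succ]

lemma wt_prod {ι : Type*} (s : Finset ι) (f : ι → ℕ) : wt (∏ i ∈ s, f i) = ∏ i ∈ s, wt (f i) := by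
  induction s using Finset.induction_on with
  | empty => simp [wt_one]
  | insert a s ha ih => rw [Finset.prod_insert ha, Finset.prod_insert ha, wt_mul, ih]

lemma wt_anti {m k : ℕ} (hm : 0 < m) (h : m ≤ k) : wt k ≤ wt m := by
  unfold wt
  have : (m : ℝ) ≤ k := by exact_mod_cast h
  have : (0 : ℝ) < m := by exact_mod_cast hm
  gcongr

lemma wt_le_half {m : ℕ} (h : 2 ≤ m) : wt m ≤ 1 / 2 := by
  refine (wt_anti two_pos h).trans ?_
  unfold wt
  have : 1 ≤ Real.sqrt 2 := Real.one_le_sqrt.2 (by norm_num)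
  push_cast
  rw [div_le_div_iff₀ (by positivity) (by norm_num)]; linarith

lemma wt_telescope {m : ℕ} (h : 1 ≤ m) :
    wt (m + 1) ≤ 2 / Real.sqrt m - 2 / Real.sqrt (m + 1 : ℕ) := by
  unfold wt
  have hm : (0 : ℝ) < m := by exact_mod_cast h
  set a := Real.sqrt m with ha
  set b := Real.sqrt ((m + 1 : ℕ) : ℝ) with hb
  have ha0 : 0 < a := Real.sqrt_pos.2 hm
  have hab : a < b := Real.sqrt_lt_sqrt hm.le (by push_cast; linarith)
  have hb0 : 0 < b := ha0.trans hab
  have ha2 : a ^ 2 = m := Real.sq_sqrt hm.le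
  have hb2 : b ^ 2 = (m + 1 : ℕ) := Real.sq_sqrt (by positivity)
  have hd : b ^ 2 - a ^ 2 = 1 := by rw [ha2, hb2]; push_cast; ring
  rw [← hb2, div_sub_div _ _ ha0.ne' hb0.ne', div_le_div_iff₀ (by positivity) (by positivity)]
  have h1 : a * (a + b) ≤ 2 * b ^ 2 := by nlinarith
  have hba : 0 < b - a := sub_pos.2 hab
  have h2 : (b - a) * (a + b) = 1 := by nlinarith
  have h3 : a ≤ 2 * b ^ 2 * (b - a) := by
    calc a = a * (a + b) * (b - a) := by rw [mul_assoc, mul_comm (a+b), h2, mul_one]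
      _ ≤ _ := by gcongr
  nlinarith

lemma sum_wt_le (N : ℕ) : ∑ m ∈ Finset.Ico 2 N, wt m ≤ 2 := by
  rcases Nat.lt_or_ge N 2 with h | h
  · rw [Finset.Ico_eq_empty_of_le (by omega)]; simp
  · suffices ∑ m ∈ Finset.Ico 2 N, wt m ≤ 2 - 2 / Real.sqrt (N - 1 : ℕ) by
      have : 0 ≤ 2 / Real.sqrt (N - 1 : ℕ) := by positivity
      linarith
    induction N, h using Nat.le_induction with
    | base => simp
    | succ k hk ih =>
      rw [Finset.sum_Ico_succ_top hk]
      obtain ⟨j, rfl⟩ : ∃ j, k = j + 1 := ⟨k - 1, by omega⟩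
      have := wt_telescope (m := j) (by omega)
      simp only [Nat.add_sub_cancel] at ih ⊢
      linarith

lemma sum_wt_absNorm_le (s : Finset (HeightOneSpectrum (𝓞 K))) :
    ∑ P ∈ s, wt (Ideal.absNorm P.asIdeal) ≤ 2 * Module.finrank ℚ K := by
  choose p hp hle hunder using absNorm_under_le (K := K)
  obtain ⟨N, hN⟩ : ∃ N, ∀ P ∈ s, p P < N :=
    ⟨s.sup p + 1, fun P hP => Nat.lt_succ_of_le (Finset.le_sup hP)⟩
  calc ∑ P ∈ s, wt (Ideal.absNorm P.asIdeal)
      ≤ ∑ P ∈ s, wt (p P) := Finset.sum_le_sum fun P _ => wt_anti (hp P).pos (hle P)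
    _ = ∑ m ∈ Finset.Ico 2 N, ∑ P ∈ s with p P = m, wt (p P) :=
        (Finset.sum_fiberwise_of_maps_to
          (fun P hP => Finset.mem_Ico.2 ⟨(hp P).two_le, hN P hP⟩) _).symm
    _ ≤ ∑ m ∈ Finset.Ico 2 N, Module.finrank ℚ K * wt m := by
        refine Finset.sum_le_sum fun m hm => ?_
        rw [Finset.sum_congr rfl (g := fun _ => wt m)
          (fun P hP => by rw [(Finset.mem_filter.1 hP).2]), Finset.sum_const, nsmul_eq_mul]
        refine mul_le_mul_of_nonneg_right ?_ (wt_nonneg m)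
        norm_cast
        rcases Finset.eq_empty_or_nonempty (s.filter fun P => p P = m) with h | ⟨P₀, h₀⟩
        · rw [h]; simp
        obtain ⟨-, rfl⟩ := Finset.mem_filter.1 h₀
        have hmax : (Ideal.span {(p P₀ : ℤ)}).IsMaximal :=
          haveI := Fact.mk (hp P₀); Int.ideal_span_isMaximal_of_prime (p P₀)
        have hne : Ideal.span {(p P₀ : ℤ)} ≠ ⊥ := by
          simpa using (hp P₀).ne_zero
        refine le_trans ?_ (Ideal.card_primesOverFinset_le_finrank (𝓞 K) ℚ K hne)
        refine Finset.card_le_card_of_injOn (fun P => P.asIdeal) ?_ ?_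
        · intro P hP
          have hP' := (Finset.mem_filter.1 hP).2
          rw [Finset.mem_coe, IsDedekindDomain.mem_primesOverFinset_iff hne]
          exact ⟨P.isPrime, ⟨by rw [hunder P, hP']⟩⟩
        · intro P _ P' _ h; exact HeightOneSpectrum.ext h
    _ = Module.finrank ℚ K * ∑ m ∈ Finset.Ico 2 N, wt m := by rw [Finset.mul_sum]
    _ ≤ _ := by
        rw [mul_comm]; exact mul_le_mul_of_nonneg_right (sum_wt_le N) (Nat.cast_nonneg _)

lemma geom_le_exp {x : ℝ} (h0 : 0 ≤ x) (h : x ≤ 1 / 2) (n : ℕ) :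
    ∑ k ∈ Finset.range n, x ^ k ≤ Real.exp (2 * x) := by
  have h1 : ∑ k ∈ Finset.range n, x ^ k ≤ (1 - x)⁻¹ := by
    have : 0 < 1 - x := by linarith
    have hm := geom_sum_mul x n
    rw [inv_eq_one_div, le_div_iff₀ this]
    have : 0 ≤ x ^ n := by positivity
    nlinarith
  refine h1.trans ?_
  have : 0 < 1 - x := by linarith
  rw [inv_le_comm₀ this (Real.exp_pos _), ← Real.exp_neg]
  have := Real.quadratic_le_exp_of_nonneg (x := 2 * x) (by linarith)
  rw [Real.exp_neg, inv_le_comm₀ (Real.exp_pos _) (by linarith)]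
  refine le_trans ?_ this
  rw [inv_eq_one_div, div_le_iff₀ (by linarith)]
  nlinarith

lemma sum_wt_ideal_le (s : Finset (Ideal (𝓞 K))) (hs : ∀ I ∈ s, I ≠ ⊥) :
    ∑ I ∈ s, wt (Ideal.absNorm I) ≤ Real.exp (4 * Module.finrank ℚ K) := by
  let c : Ideal (𝓞 K) → HeightOneSpectrum (𝓞 K) → ℕ := fun I P =>
    (Associates.mk P.asIdeal).count (Associates.mk I).factors
  have hfin : ∀ I ∈ s, (Function.mulSupport fun P : HeightOneSpectrum (𝓞 K) =>
      P.asIdeal ^ c I P).Finite := fun I hI => Ideal.hasFiniteMulSupport (hs I hI)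
  choose! f hf using fun I hI => (hfin I hI).exists_finset_coe
  set p := s.biUnion f with hpdef
  have hprod : ∀ I ∈ s, I = ∏ P : p, P.1.asIdeal ^ c I P.1 := by
    intro I hI
    rw [Finset.prod_coe_sort p (fun P => P.asIdeal ^ c I P)]
    rw [← finprod_eq_prod_of_mulSupport_subset]
    · exact (Ideal.finprod_heightOneSpectrum_factorization (hs I hI)).symm
    · rw [← hf I hI, Finset.coe_subset]; exact Finset.subset_biUnion_of_mem f hI
  obtain ⟨N, hN⟩ : ∃ N, ∀ I ∈ s, ∀ P ∈ p, c I P < N :=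
    ⟨s.sup (fun I => p.sup (c I)) + 1, fun I hI P hP => Nat.lt_succ_of_le
      ((Finset.le_sup hP).trans (Finset.le_sup (f := fun I => p.sup (c I)) hI))⟩
  let k : Ideal (𝓞 K) → (p → ℕ) := fun I P => c I P.1
  have hinj : Set.InjOn k s := by
    intro I hI J hJ h
    rw [hprod I hI, hprod J hJ]
    exact Finset.prod_congr rfl fun P _ => by
      have := congrFun h P
      simp only [k] at this
      rw [this]
  calc ∑ I ∈ s, wt (Ideal.absNorm I)
      = ∑ I ∈ s, ∏ P : p, wt (Ideal.absNorm P.1.asIdeal) ^ (k I P) := by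
        refine Finset.sum_congr rfl fun I hI => ?_
        conv_lhs => rw [hprod I hI]
        rw [map_prod, wt_prod]
        simp only [map_pow, wt_pow, k]
    _ = ∑ g ∈ s.image k, ∏ P : p, wt (Ideal.absNorm P.1.asIdeal) ^ (g P) := by
        rw [Finset.sum_image hinj]
    _ ≤ ∑ g ∈ Fintype.piFinset (fun _ : p => Finset.range N),
          ∏ P : p, wt (Ideal.absNorm P.1.asIdeal) ^ (g P) := by
        refine Finset.sum_le_sum_of_subset_of_nonneg ?_ fun g _ _ =>
          Finset.prod_nonneg fun P _ => pow_nonneg (wt_nonneg _) _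
        intro g hg
        obtain ⟨I, hI, rfl⟩ := Finset.mem_image.1 hg
        exact Fintype.mem_piFinset.2 fun P => Finset.mem_range.2 (hN I hI P.1 P.2)
    _ = ∏ P : p, ∑ j ∈ Finset.range N, wt (Ideal.absNorm P.1.asIdeal) ^ j :=
        (Finset.prod_univ_sum _ _).symm
    _ ≤ ∏ P : p, Real.exp (2 * wt (Ideal.absNorm P.1.asIdeal)) :=
        Finset.prod_le_prod (fun P _ => Finset.sum_nonneg fun _ _ => pow_nonneg (wt_nonneg _) _)
          fun P _ => geom_le_exp (wt_nonneg _) (wt_le_half (two_le_absNorm P.1)) N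
    _ = Real.exp (2 * ∑ P ∈ p, wt (Ideal.absNorm P.asIdeal)) := by
        rw [← Real.exp_sum, ← Finset.mul_sum,
          Finset.sum_coe_sort p (fun P => wt (Ideal.absNorm P.asIdeal))]
    _ ≤ _ := by
        refine Real.exp_le_exp.2 ?_
        have := sum_wt_absNorm_le (K := K) p
        linarith

/-- A number field of degree `D` has at most `X^{3/2} e^{4D}` nonzero ideals of norm `≤ X`. -/
theorem card_ideal_le (s : Finset (Ideal (𝓞 K))) {X : ℝ}
    (hs : ∀ I ∈ s, I ≠ ⊥ ∧ (Ideal.absNorm I : ℝ) ≤ X) :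
    (s.card : ℝ) ≤ X * Real.sqrt X * Real.exp (4 * Module.finrank ℚ K) := by
  rcases s.eq_empty_or_nonempty with rfl | ⟨I₀, h₀⟩
  · simp only [Finset.card_empty, Nat.cast_zero]
    rcases le_or_gt 0 X with h | h
    · positivity
    · rw [Real.sqrt_eq_zero_of_nonpos h.le]; simp
  have hX : 0 ≤ X := (Nat.cast_nonneg _).trans (hs I₀ h₀).2
  calc (s.card : ℝ) = ∑ I ∈ s, 1 := by simp
    _ ≤ ∑ I ∈ s, X * Real.sqrt X * wt (Ideal.absNorm I) := by
        refine Finset.sum_le_sum fun I hI => ?_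
        have hpos : (0 : ℝ) < Ideal.absNorm I := by
          have := Ideal.absNorm_ne_zero_iff_mem_nonZeroDivisors.2
            (mem_nonZeroDivisors_iff_ne_zero.2 (hs I hI).1)
          exact_mod_cast Nat.pos_of_ne_zero this
        have h1 := (hs I hI).2
        unfold wt
        rw [mul_one_div, le_div_iff₀ (by positivity), one_mul]
        gcongr
    _ ≤ _ := by
        rw [← Finset.mul_sum]
        exact mul_le_mul_of_nonneg_left (sum_wt_ideal_le s fun I hI => (hs I hI).1)
          (by positivity)

end IdealCount

end HyperellipticBound

namespace HyperellipticBound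

/-! ### Minkowski's theorem for ideals -/

section Minkowski

variable {K : Type*} [Field K] [NumberField K]

open NumberField.mixedEmbedding NumberField.InfinitePlace MeasureTheory ENNReal
  nonZeroDivisors in
theorem exists_mem_ideal_lt (I : Ideal (𝓞 K)) (hI : I ≠ ⊥) (f : InfinitePlace K → ℝ)
    (hf : ∀ w, 0 < f w)
    (h : Ideal.absNorm I * √|(discr K : ℝ)| < ∏ w, f w ^ w.mult) :
    ∃ β : 𝓞 K, β ∈ I ∧ β ≠ 0 ∧ ∀ w : InfinitePlace K, w (β : K) < f w := by
  let J : (FractionalIdeal (𝓞 K)⁰ K)ˣ :=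
    Units.mk0 (I : FractionalIdeal (𝓞 K)⁰ K) (by simpa using hI)
  let g : InfinitePlace K → NNReal := fun w => ⟨f w, (hf w).le⟩
  have hJ : FractionalIdeal.absNorm (J : FractionalIdeal (𝓞 K)⁰ K) = Ideal.absNorm I := by
    simp [J, FractionalIdeal.coeIdeal_absNorm]
  have key : minkowskiBound K J < volume (convexBodyLT K g) := by
    have hv : volume (convexBodyLT K g) ≠ ⊤ := by
      rw [convexBodyLT_volume]; exact ENNReal.mul_ne_top coe_ne_top coe_ne_top
    rw [← ENNReal.toReal_lt_toReal (minkowskiBound_lt_top K J).ne hv, convexBodyLT_volume]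
    have hl : (minkowskiBound K J).toReal = Ideal.absNorm I * √|(discr K : ℝ)| *
        (2 ^ nrRealPlaces K * 2 ^ nrComplexPlaces K) := by
      simp_rw [minkowskiBound, volume_fundamentalDomain_fractionalIdealLatticeBasis,
        volume_fundamentalDomain_latticeBasis, toReal_mul, toReal_pow, toReal_inv, coe_toReal,
        toReal_ofNat, mixedEmbedding.finrank]
      rw [ENNReal.toReal_ofReal (Rat.cast_nonneg.mpr (FractionalIdeal.absNorm_nonneg J.1)), hJ,
        ← card_add_two_mul_card_eq_rank, pow_add, pow_mul]
      have : (2⁻¹ : ℝ) ^ nrComplexPlaces K * (2 ^ 2) ^ nrComplexPlaces K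
          = 2 ^ nrComplexPlaces K := by rw [← mul_pow]; norm_num
      rw [← this, Real.coe_sqrt, coe_nnnorm, Int.norm_eq_abs]
      push_cast
      ring
    rw [hl, convexBodyLTFactor]
    simp only [toReal_mul, coe_toReal, NNReal.coe_mul, NNReal.coe_pow, NNReal.coe_prod,
      NNReal.coe_ofNat, NNReal.coe_real_pi]
    rw [mul_comm]
    have : (2 : ℝ) ^ nrComplexPlaces K ≤ Real.pi ^ nrComplexPlaces K := by
      have := Real.two_le_pi
      gcongr
    calc _ < 2 ^ nrRealPlaces K * 2 ^ nrComplexPlaces K * ∏ w, f w ^ w.mult := by gcongr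
      _ ≤ 2 ^ nrRealPlaces K * Real.pi ^ nrComplexPlaces K * ∏ w, f w ^ w.mult := by
        have : 0 ≤ ∏ w, f w ^ w.mult :=
          Finset.prod_nonneg fun w _ => pow_nonneg (hf w).le _
        gcongr
  obtain ⟨a, ha, ha0, hlt⟩ := exists_ne_zero_mem_ideal_lt K J key
  obtain ⟨β, hβ, rfl⟩ := (FractionalIdeal.mem_coeIdeal _).1 ha
  exact ⟨β, hβ, by rintro rfl; simp at ha0, fun w => hlt w⟩

end Minkowski

end HyperellipticBound

namespace HyperellipticBound

/-! ### Orders of vanishing -/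

section Orders

variable {K : Type*} [Field K] [NumberField K]

/-- The exponent of `P` in the factorization of the ideal `I`. -/
def cnt (P : HeightOneSpectrum (𝓞 K)) (I : Ideal (𝓞 K)) : ℕ :=
  (Associates.mk P.asIdeal).count (Associates.mk I).factors

lemma cnt_mul (P : HeightOneSpectrum (𝓞 K)) {I J : Ideal (𝓞 K)} (hI : I ≠ ⊥) (hJ : J ≠ ⊥) :
    cnt P (I * J) = cnt P I + cnt P J := by
  unfold cnt
  rw [← Associates.mk_mul_mk, Associates.count_mul (Associates.mk_ne_zero.2 hI)
    (Associates.mk_ne_zero.2 hJ) P.associates_irreducible]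

lemma cnt_pow (P Q : HeightOneSpectrum (𝓞 K)) (k : ℕ) :
    cnt P (Q.asIdeal ^ k) = if P = Q then k else 0 := by
  unfold cnt
  rw [Associates.mk_pow, Associates.count_pow (Associates.mk_ne_zero.2 Q.ne_bot)
    P.associates_irreducible]
  split_ifs with h
  · rw [h, Associates.count_self Q.associates_irreducible, mul_one]
  · rw [Associates.count_eq_zero_of_ne P.associates_irreducible Q.associates_irreducible, mul_zero]
    intro h'
    rw [Associates.mk_eq_mk_iff_associated, associated_iff_eq] at h'
    exact h (HeightOneSpectrum.ext h')

lemma prod_asIdeal_pow_ne_bot {F : Type*} [Field F] (T : Finset (HeightOneSpectrum (𝓞 F)))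
    (k : HeightOneSpectrum (𝓞 F) → ℕ) : ∏ P ∈ T, P.asIdeal ^ k P ≠ ⊥ := by
  rw [← Ideal.zero_eq_bot, Finset.prod_ne_zero_iff]
  exact fun P _ => pow_ne_zero _ P.ne_bot

lemma cnt_prod (P : HeightOneSpectrum (𝓞 K)) (T : Finset (HeightOneSpectrum (𝓞 K)))
    (k : HeightOneSpectrum (𝓞 K) → ℕ) :
    cnt P (∏ Q ∈ T, Q.asIdeal ^ k Q) = if P ∈ T then k P else 0 := by
  induction T using Finset.induction_on with
  | empty =>
    simpa using cnt_pow P P 0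
  | insert a s ha ih =>
    rw [Finset.prod_insert ha, cnt_mul P (pow_ne_zero _ a.ne_bot) (prod_asIdeal_pow_ne_bot s k),
      ih, cnt_pow]
    by_cases h : P = a
    · subst h; simp [ha]
    · simp [h]

lemma valuation_eq_exp_ordAt (P : HeightOneSpectrum (𝓞 K)) {x : K} (hx : x ≠ 0) :
    P.valuation K x = WithZero.exp (-ordAt P x) := by
  rw [ordAt, dif_neg hx, neg_neg]
  exact (WithZero.coe_unzero _).symm

lemma log_absNorm_pos (P : HeightOneSpectrum (𝓞 K)) :
    0 < Real.log (Ideal.absNorm P.asIdeal) :=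
  Real.log_pos (by exact_mod_cast two_le_absNorm P)

lemma log_two_le_log_absNorm (P : HeightOneSpectrum (𝓞 K)) :
    Real.log 2 ≤ Real.log (Ideal.absNorm P.asIdeal) :=
  Real.log_le_log two_pos (by exact_mod_cast two_le_absNorm P)

lemma lg_inr (P : HeightOneSpectrum (𝓞 K)) (x : K) :
    lg (.inr P) x = -(ordAt P x : ℝ) * Real.log (Ideal.absNorm P.asIdeal) := by
  by_cases hx : x = 0
  · simp [hx, lg, ordAt]
  · rw [lg, av_inr, NumberField.HeightOneSpectrum.adicAbv_def, valuation_eq_exp_ordAt P hx,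
      WithZeroMulInt.toNNReal_neg_apply _ (by simp)]
    change Real.log (((Ideal.absNorm P.asIdeal : NNReal) ^ (-ordAt P x) : NNReal) : ℝ) = _
    rw [NNReal.coe_zpow, Real.log_zpow]
    simp

lemma ordAt_coe (P : HeightOneSpectrum (𝓞 K)) {β : 𝓞 K} (hβ : β ≠ 0) :
    ordAt P (β : K) = cnt P (Ideal.span {β}) := by
  have h0 : (β : K) ≠ 0 := by simpa using hβ
  have h := valuation_eq_exp_ordAt P h0
  rw [HeightOneSpectrum.valuation_of_algebraMap, HeightOneSpectrum.intValuation_if_neg P hβ] at h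
  have := WithZero.exp_injective h
  unfold cnt
  omega

lemma ordAt_mul (P : HeightOneSpectrum (𝓞 K)) {x y : K} (hx : x ≠ 0) (hy : y ≠ 0) :
    ordAt P (x * y) = ordAt P x + ordAt P y := by
  have h := valuation_eq_exp_ordAt P (mul_ne_zero hx hy)
  rw [map_mul, valuation_eq_exp_ordAt P hx, valuation_eq_exp_ordAt P hy, ← WithZero.exp_add] at h
  have := WithZero.exp_injective h
  omega

lemma ordAt_inv (P : HeightOneSpectrum (𝓞 K)) (x : K) : ordAt P x⁻¹ = -ordAt P x := by
  by_cases hx : x = 0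
  · simp [hx, ordAt]
  · have h := ordAt_mul P hx (inv_ne_zero hx)
    rw [mul_inv_cancel₀ hx] at h
    have h1 := ordAt_mul P (one_ne_zero (α := K)) one_ne_zero
    rw [one_mul] at h1
    omega

end Orders

/-! ### Simultaneous approximation of logarithms -/

section Approximation

variable {K : Type*} [Field K] [NumberField K]

/-- Minkowski's theorem in logarithmic form. -/
lemma exists_mem_ideal_log (I : Ideal (𝓞 K)) (hI : I ≠ ⊥) (τ : InfinitePlace K → ℝ)
    (c Λ : ℝ) (hΛ : Λ = Real.log (2 * √|(discr K : ℝ)|))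
    (hc : Module.finrank ℚ K * c = Real.log (Ideal.absNorm I) + Λ
      - ∑ w : InfinitePlace K, w.mult * τ w) :
    ∃ β : 𝓞 K, β ≠ 0 ∧ (∃ 𝔠 : Ideal (𝓞 K), 𝔠 ≠ ⊥ ∧ Ideal.span {β} = I * 𝔠 ∧
        (Ideal.absNorm 𝔠 : ℝ) ≤ 2 * √|(discr K : ℝ)|) ∧
      ∀ w : InfinitePlace K, Real.log (w (β : K)) - τ w - c ≤ 0 ∧
        -Λ ≤ Real.log (w (β : K)) - τ w - c := by
  have hd : 0 < √|(discr K : ℝ)| := by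
    have := discr_ne_zero K
    have : (discr K : ℝ) ≠ 0 := by exact_mod_cast this
    positivity
  have hpos : ∀ {J : Ideal (𝓞 K)}, J ≠ ⊥ → (0 : ℝ) < Ideal.absNorm J := fun {J} hJ => by
    exact_mod_cast Nat.pos_of_ne_zero (Ideal.absNorm_ne_zero_iff_mem_nonZeroDivisors.2
      (mem_nonZeroDivisors_iff_ne_zero.2 hJ))
  have hprod : ∏ w : InfinitePlace K, Real.exp (τ w + c) ^ w.mult
      = Ideal.absNorm I * (2 * √|(discr K : ℝ)|) := by
    rw [← Real.exp_log (mul_pos (hpos hI) (mul_pos two_pos hd)),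
      Real.log_mul (hpos hI).ne' (by positivity), ← hΛ]
    simp_rw [← Real.exp_nat_mul]
    rw [← Real.exp_sum]
    congr 1
    have : ∑ w : InfinitePlace K, (w.mult : ℝ) = Module.finrank ℚ K := by
      exact_mod_cast InfinitePlace.sum_mult_eq (K := K)
    simp_rw [mul_add]
    rw [Finset.sum_add_distrib, ← Finset.sum_mul, this, hc]
    ring
  obtain ⟨β, hβI, hβ0, hlt⟩ := exists_mem_ideal_lt I hI (fun w => Real.exp (τ w + c))
    (fun w => Real.exp_pos _) (by
      rw [hprod]; nlinarith [mul_pos (hpos hI) hd])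
  have hβK : (β : K) ≠ 0 := by simpa using hβ0
  have hle : ∀ w : InfinitePlace K, Real.log (w (β : K)) - τ w - c ≤ 0 := fun w => by
    have := Real.log_lt_log (w.pos_iff.2 hβK) (hlt w)
    rw [Real.log_exp] at this
    linarith
  obtain ⟨𝔠, h𝔠⟩ : I ∣ Ideal.span {β} := Ideal.dvd_span_singleton.2 hβI
  have h𝔠0 : 𝔠 ≠ ⊥ := by
    rintro rfl; simp at h𝔠; exact hβ0 h𝔠
  have hnorm : ∏ w : InfinitePlace K, w (β : K) ^ w.mult = Ideal.absNorm I * Ideal.absNorm 𝔠 := by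
    rw [InfinitePlace.prod_eq_abs_norm]
    have := congrArg Ideal.absNorm h𝔠
    rw [map_mul, Ideal.absNorm_span_singleton] at this
    rw [← Algebra.coe_norm_int]
    have h2 : ((Ideal.absNorm I * Ideal.absNorm 𝔠 : ℕ) : ℝ) = |((Algebra.norm ℤ β : ℤ) : ℝ)| := by
      rw [← this, Nat.cast_natAbs]; simp
    push_cast at h2 ⊢
    rw [h2]
  have hle2 : (Ideal.absNorm 𝔠 : ℝ) ≤ 2 * √|(discr K : ℝ)| := by
    have : ∏ w : InfinitePlace K, w (β : K) ^ w.mult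
        ≤ ∏ w : InfinitePlace K, Real.exp (τ w + c) ^ w.mult :=
      Finset.prod_le_prod (fun w _ => by positivity) fun w _ => by
        have := (hlt w).le
        gcongr
    rw [hnorm, hprod] at this
    exact le_of_mul_le_mul_left this (hpos hI)
  refine ⟨β, hβ0, ⟨𝔠, h𝔠0, h𝔠, hle2⟩, fun w => ⟨hle w, ?_⟩⟩
  have hsum : ∑ w : InfinitePlace K, w.mult * (Real.log (w (β : K)) - τ w - c) ≥ -Λ := by
    have h1 : ∑ w : InfinitePlace K, w.mult * Real.log (w (β : K))
        = Real.log (Ideal.absNorm I) + Real.log (Ideal.absNorm 𝔠) := by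
      rw [← Real.log_mul (hpos hI).ne' (hpos h𝔠0).ne', ← hnorm, Real.log_prod]
      · simp [Real.log_pow]
      · exact fun w _ => pow_ne_zero _ (w.pos_iff.2 hβK).ne'
    have h2 : 0 ≤ Real.log (Ideal.absNorm 𝔠) := Real.log_natCast_nonneg _
    have : ∑ w : InfinitePlace K, (w.mult : ℝ) = Module.finrank ℚ K := by
      exact_mod_cast InfinitePlace.sum_mult_eq (K := K)
    simp_rw [mul_sub]
    rw [Finset.sum_sub_distrib, Finset.sum_sub_distrib, ← Finset.sum_mul, this, h1, hc]
    linarith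
  have hm : (1 : ℝ) ≤ w.mult := by exact_mod_cast w.one_le_mult
  have hw : ∑ w : InfinitePlace K, w.mult * (Real.log (w (β : K)) - τ w - c)
      ≤ w.mult * (Real.log (w (β : K)) - τ w - c) := by
    rw [← Finset.add_sum_erase _ _ (Finset.mem_univ w)]
    have : ∑ x ∈ Finset.univ.erase w, (x.mult : ℝ) * (Real.log (x (β : K)) - τ x - c) ≤ 0 :=
      Finset.sum_nonpos fun x _ => mul_nonpos_of_nonneg_of_nonpos (Nat.cast_nonneg _) (hle x)
    linarith
  nlinarith [hle w]

end Approximation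

end HyperellipticBound

namespace HyperellipticBound

section Pigeonhole

variable {K : Type*} [Field K] [NumberField K]

lemma sum_embeddings (f : InfinitePlace K → ℝ) :
    ∑ φ : K →+* ℂ, f (InfinitePlace.mk φ) = ∑ w, w.mult * f w := by
  rw [← Finset.sum_fiberwise (s := Finset.univ) (g := fun φ : K →+* ℂ => InfinitePlace.mk φ)]
  refine Finset.sum_congr rfl fun w _ => ?_
  rw [Finset.sum_congr rfl (g := fun _ => f w)
    (fun φ hφ => by rw [(Finset.mem_filter.1 hφ).2]), Finset.sum_const, nsmul_eq_mul]
  congr 2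
  convert InfinitePlace.card_filter_mk_eq w

lemma lg_inl (φ : K →+* ℂ) (x : K) : lg (.inl φ) x = Real.log (InfinitePlace.mk φ x) := rfl

lemma abs_sub_le_of_floor_eq {a b d : ℝ} (ha : 0 ≤ a) (hb : 0 ≤ b) (hd : 0 < d)
    (h : ⌊a / d⌋₊ = ⌊b / d⌋₊) : |a - b| ≤ d := by
  have h1 := Nat.floor_le (div_nonneg ha hd.le)
  have h2 := Nat.lt_floor_add_one (a / d)
  have h3 := Nat.floor_le (div_nonneg hb hd.le)
  have h4 := Nat.lt_floor_add_one (b / d)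
  rw [h] at h1 h2
  have h5 : |a / d - b / d| ≤ 1 := by rw [abs_le]; constructor <;> linarith
  rw [← sub_div, abs_div, abs_of_pos hd, div_le_one hd] at h5
  exact h5

lemma log_absNorm_prod (T : Finset (HeightOneSpectrum (𝓞 K))) (k : HeightOneSpectrum (𝓞 K) → ℕ) :
    Real.log (Ideal.absNorm (∏ P ∈ T, P.asIdeal ^ k P))
      = ∑ P ∈ T, k P * Real.log (Ideal.absNorm P.asIdeal) := by
  rw [map_prod, Nat.cast_prod, Real.log_prod]
  · simp [Real.log_pow]
  · intro P _
    have := two_le_absNorm P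
    rw [map_pow]
    positivity

/-- Simultaneous approximation of the logarithmic vector of `u` by that of an element close to
an `S`-unit: among `J + 1` multiples of the logarithmic vector two have approximations which agree
up to `δ₀` at the places of `S` and have the same order at all other places. -/
theorem exists_approximation (u : K) (T : Finset (HeightOneSpectrum (𝓞 K)))
    {W δ₀ h₀ Λ : ℝ} (hW : 0 < W) (hδ₀ : 0 < δ₀)
    (hh₀ : |∑ φ, lg (.inl φ) u + ∑ P ∈ T, lg (.inr P) u| ≤ h₀)
    {κ : Type*} [Fintype κ] (key : 𝓞 K → κ) (J : ℕ)
    (hΛ : Λ = Real.log (2 * √|(discr K : ℝ)|))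
    (hJ : (2 * √|(discr K : ℝ)|) * √(2 * √|(discr K : ℝ)|) * Real.exp (4 * Module.finrank ℚ K)
      * (∏ P ∈ T, (Real.log (Ideal.absNorm P.asIdeal) / δ₀ + 1))
      * (Λ / δ₀ + 1) ^ Fintype.card (InfinitePlace K) * Fintype.card κ < J + 1) :
    ∃ (q : ℕ) (β β' : 𝓞 K), 1 ≤ q ∧ q ≤ J ∧ β ≠ 0 ∧ β' ≠ 0 ∧ key β = key β' ∧
      (∀ P ∉ T, ordAt P ((β' : K) / β) = 0) ∧
      (∀ P ∈ T, |lg (.inr P) ((β' : K) / β) - q * (lg (.inr P) u / W)| ≤ δ₀) ∧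
      ∀ φ, |lg (.inl φ) ((β' : K) / β) - q * (lg (.inl φ) u / W)|
        ≤ δ₀ + (T.card * δ₀ + J * h₀ / W) / Module.finrank ℚ K := by
  set D : ℝ := (Module.finrank ℚ K : ℝ) with hD
  have hD0 : 0 < D := by rw [hD]; exact_mod_cast Module.finrank_pos (R := ℚ) (M := K)
  set X : ℝ := 2 * √|(discr K : ℝ)| with hX
  set ℓ : HeightOneSpectrum (𝓞 K) → ℝ := fun P => Real.log (Ideal.absNorm P.asIdeal) with hℓ
  have hℓ0 : ∀ P, 0 < ℓ P := log_absNorm_pos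
  set t : HeightOneSpectrum (𝓞 K) → ℝ := fun P => lg (.inr P) u / W with ht
  set τ : InfinitePlace K → ℝ := fun w => Real.log (w u) / W with hτ
  let C : HeightOneSpectrum (𝓞 K) → ℕ := fun P => ⌈J * |t P| / ℓ P⌉₊
  let k : ℕ → HeightOneSpectrum (𝓞 K) → ℕ := fun j P => ⌈C P - j * t P / ℓ P⌉₊
  let e : ℕ → HeightOneSpectrum (𝓞 K) → ℝ := fun j P => (k j P - C P) * ℓ P + j * t P
  have he : ∀ j ≤ J, ∀ P, 0 ≤ e j P ∧ e j P ≤ ℓ P := by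
    intro j hj P
    have h1 : (j : ℝ) * t P / ℓ P ≤ C P := by
      refine le_trans ?_ (Nat.le_ceil _)
      have : (j : ℝ) ≤ J := by exact_mod_cast hj
      have h3 := le_abs_self (t P)
      have h2 : (j : ℝ) * t P ≤ J * |t P| :=
        (mul_le_mul_of_nonneg_left h3 (Nat.cast_nonneg j)).trans
          (mul_le_mul_of_nonneg_right this (abs_nonneg _))
      exact div_le_div_of_nonneg_right h2 (hℓ0 P).le
    have h2 := Nat.le_ceil ((C P : ℝ) - j * t P / ℓ P)
    have h3 := Nat.ceil_lt_add_one (sub_nonneg.2 h1)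
    have h4 : (j : ℝ) * t P = (j * t P / ℓ P) * ℓ P := (div_mul_cancel₀ _ (hℓ0 P).ne').symm
    have h5 : e j P = ((k j P : ℝ) - C P + j * t P / ℓ P) * ℓ P := by
      simp only [e]; rw [add_mul, ← h4]
    rw [h5]
    change ((C P : ℝ) - j * t P / ℓ P) ≤ k j P at h2
    change (k j P : ℝ) < _ at h3
    exact ⟨mul_nonneg (by linarith) (hℓ0 P).le,
      mul_le_of_le_one_left (hℓ0 P).le (by linarith)⟩
  let I : ℕ → Ideal (𝓞 K) := fun j => ∏ P ∈ T, P.asIdeal ^ k j P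
  have hI : ∀ j, I j ≠ ⊥ := fun j => prod_asIdeal_pow_ne_bot T (k j)
  let c : ℕ → ℝ := fun j => (Real.log (Ideal.absNorm (I j)) + Λ
    - ∑ w : InfinitePlace K, w.mult * (j * τ w)) / D
  have hex := fun j => exists_mem_ideal_log (I j) (hI j) (fun w => j * τ w) (c j) Λ hΛ
    (mul_div_cancel₀ _ hD0.ne')
  choose β hβ0 h𝔠 hβw using hex
  choose 𝔠 h𝔠0 h𝔠I h𝔠N using h𝔠
  let y : ℕ → InfinitePlace K → ℝ := fun j w => -(Real.log (w (β j : K)) - j * τ w - c j)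
  have hy : ∀ j w, 0 ≤ y j w ∧ y j w ≤ Λ := fun j w => by
    have := hβw j w
    simp only [y]; constructor <;> linarith
  let w₀ : InfinitePlace K := Classical.arbitrary _
  have hΛ0 : 0 ≤ Λ := (hy 0 w₀).1.trans (hy 0 w₀).2
  -- pigeonhole
  let f : ℕ → Ideal (𝓞 K) × (T → ℕ) × (InfinitePlace K → ℕ) × κ := fun j =>
    (𝔠 j, fun P => ⌊e j P.1 / δ₀⌋₊, fun w => ⌊y j w / δ₀⌋₊, key (β j))
  let A : Finset (Ideal (𝓞 K)) := (Finset.range (J + 1)).image 𝔠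
  let B : Finset (Ideal (𝓞 K) × (T → ℕ) × (InfinitePlace K → ℕ) × κ) :=
    A ×ˢ (Fintype.piFinset fun P : T => Finset.range (⌊ℓ P.1 / δ₀⌋₊ + 1)) ×ˢ
      (Fintype.piFinset fun _ : InfinitePlace K => Finset.range (⌊Λ / δ₀⌋₊ + 1)) ×ˢ Finset.univ
  have hcard : B.card < (Finset.range (J + 1)).card := by
    rw [Finset.card_range]
    have hA : (A.card : ℝ) ≤ X * √X * Real.exp (4 * D) := card_ideal_le A fun I hI => by
      obtain ⟨j, -, rfl⟩ := Finset.mem_image.1 hI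
      exact ⟨h𝔠0 j, h𝔠N j⟩
    have hB : (B.card : ℝ) ≤ X * √X * Real.exp (4 * D) * (∏ P ∈ T, (ℓ P / δ₀ + 1))
        * (Λ / δ₀ + 1) ^ Fintype.card (InfinitePlace K) * Fintype.card κ := by
      simp only [B, Finset.card_product, Fintype.card_piFinset, Finset.card_range,
        Finset.prod_const, Finset.card_univ]
      push_cast
      rw [← Finset.prod_coe_sort T, ← mul_assoc, ← mul_assoc]
      have h1 : ∀ x : ℝ, 0 ≤ x → ((⌊x⌋₊ : ℝ) + 1) ≤ x + 1 := fun x hx => by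
        linarith [Nat.floor_le hx]
      have h2 : ∏ P : T, ((⌊ℓ P.1 / δ₀⌋₊ : ℝ) + 1) ≤ ∏ P : T, (ℓ P.1 / δ₀ + 1) :=
        Finset.prod_le_prod (fun _ _ => by positivity)
          fun P _ => h1 _ (div_nonneg (hℓ0 P.1).le hδ₀.le)
      have h3 : ((⌊Λ / δ₀⌋₊ : ℝ) + 1) ^ Fintype.card (InfinitePlace K)
          ≤ (Λ / δ₀ + 1) ^ Fintype.card (InfinitePlace K) := by
        have := h1 _ (div_nonneg hΛ0 hδ₀.le)
        gcongr
      have h4 : 0 ≤ ∏ P : T, ((⌊ℓ P.1 / δ₀⌋₊ : ℝ) + 1) :=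
        Finset.prod_nonneg fun _ _ => by positivity
      gcongr
    have := hB.trans_lt hJ
    exact_mod_cast this
  have hmaps : ∀ j ∈ Finset.range (J + 1), f j ∈ B := by
    intro j hj
    have hj' : j ≤ J := Nat.lt_succ_iff.1 (Finset.mem_range.1 hj)
    simp only [B, f, Finset.mem_product, Fintype.mem_piFinset, Finset.mem_range,
      Finset.mem_univ, and_true]
    refine ⟨Finset.mem_image_of_mem _ hj, fun P => Nat.lt_succ_of_le (Nat.floor_mono ?_),
      fun w => Nat.lt_succ_of_le (Nat.floor_mono ?_)⟩
    · exact div_le_div_of_nonneg_right (he j hj' P.1).2 hδ₀.le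
    · exact div_le_div_of_nonneg_right (hy j w).2 hδ₀.le
  obtain ⟨j, j', hj', hlt, hf⟩ : ∃ j j', j' ≤ J ∧ j < j' ∧ f j = f j' := by
    obtain ⟨a, ha, b, hb, hne, hab⟩ :=
      Finset.exists_ne_map_eq_of_card_lt_of_maps_to hcard hmaps
    have ha' := Nat.lt_succ_iff.1 (Finset.mem_range.1 ha)
    have hb' := Nat.lt_succ_iff.1 (Finset.mem_range.1 hb)
    rcases lt_or_gt_of_ne hne with h | h
    · exact ⟨a, b, hb', h, hab⟩
    · exact ⟨b, a, ha', h, hab.symm⟩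
  simp only [f, Prod.mk.injEq] at hf
  obtain ⟨hf1, hf2, hf3, hf4⟩ := hf
  have hβK : ∀ j, (β j : K) ≠ 0 := fun j => by simpa using hβ0 j
  have hδe : ∀ P ∈ T, |e j P - e j' P| ≤ δ₀ := fun P hP =>
    abs_sub_le_of_floor_eq (he j (hlt.le.trans hj') P).1 (he j' hj' P).1 hδ₀
      (congrFun hf2 ⟨P, hP⟩)
  have hδy : ∀ w, |y j w - y j' w| ≤ δ₀ := fun w =>
    abs_sub_le_of_floor_eq (hy j w).1 (hy j' w).1 hδ₀ (congrFun hf3 w)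
  have hord : ∀ j P, ordAt P (β j : K) = (if P ∈ T then (k j P : ℤ) else 0) + cnt P (𝔠 j) := by
    intro j P
    rw [ordAt_coe P (hβ0 j), h𝔠I j, cnt_mul P (hI j) (h𝔠0 j), cnt_prod]
    split_ifs <;> simp
  have hordη : ∀ P, ordAt P ((β j' : K) / β j)
      = if P ∈ T then (k j' P : ℤ) - k j P else 0 := by
    intro P
    rw [div_eq_mul_inv, ordAt_mul P (hβK j') (inv_ne_zero (hβK j)), ordAt_inv, hord, hord, hf1]
    split_ifs <;> ring
  have hq : ((j' - j : ℕ) : ℝ) = j' - j := by rw [Nat.cast_sub hlt.le]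
  refine ⟨j' - j, β j, β j', by omega, by omega, hβ0 j, hβ0 j', hf4, fun P hP => ?_,
    fun P hP => ?_, fun φ => ?_⟩
  · rw [hordη, if_neg hP]
  · rw [lg_inr, hordη, if_pos hP, hq]
    have : -(((k j' P : ℤ) - k j P : ℤ) : ℝ) * Real.log (Ideal.absNorm P.asIdeal)
        - (j' - j) * (lg (.inr P) u / W) = e j P - e j' P := by
      simp only [e, ht, hℓ]; push_cast; ring
    rw [this]
    exact hδe P hP
  · have h1 : lg (.inl φ) ((β j' : K) / β j) - ((j' - j : ℕ) : ℝ) * (lg (.inl φ) u / W)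
        = (y j (.mk φ) - y j' (.mk φ)) + (c j' - c j) := by
      rw [lg_div _ (hβK j') (hβK j), hq]
      simp only [y, hτ, lg_inl]
      ring
    have h2 : D * (c j' - c j) = -∑ P ∈ T, (e j P - e j' P)
        - (j' - j) * ((∑ φ, lg (.inl φ) u + ∑ P ∈ T, lg (.inr P) u) / W) := by
      have hs : ∑ φ, lg (.inl φ) u = ∑ w : InfinitePlace K, w.mult * Real.log (w u) :=
        sum_embeddings fun w => Real.log (w u)
      have hs2 : ∀ j : ℕ, ∑ w : InfinitePlace K, w.mult * (j * τ w)
          = j * (∑ φ, lg (.inl φ) u) / W := fun j => by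
        rw [hs, mul_div_assoc, Finset.sum_div, Finset.mul_sum]
        exact Finset.sum_congr rfl fun w _ => by simp only [hτ]; ring
      have hs3 : ∑ P ∈ T, (e j P - e j' P) = ∑ P ∈ T, k j P * ℓ P - ∑ P ∈ T, k j' P * ℓ P
          - (j' - j) * ((∑ P ∈ T, lg (.inr P) u) / W) := by
        rw [Finset.sum_div, Finset.mul_sum, ← Finset.sum_sub_distrib, ← Finset.sum_sub_distrib]
        exact Finset.sum_congr rfl fun P _ => by simp only [e, ht]; ring
      rw [mul_sub, mul_div_cancel₀ _ hD0.ne', mul_div_cancel₀ _ hD0.ne', hs3, hs2, hs2,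
        log_absNorm_prod, log_absNorm_prod]
      ring
    have h3 : |D * (c j' - c j)| ≤ T.card * δ₀ + J * h₀ / W := by
      rw [h2]
      refine (abs_sub _ _).trans (add_le_add ?_ ?_)
      · rw [abs_neg]
        refine (Finset.abs_sum_le_sum_abs _ _).trans ?_
        refine (Finset.sum_le_sum hδe).trans ?_
        simp
      · rw [abs_mul, abs_div, abs_of_pos hW, mul_div_assoc]
        have h5 : |(j' : ℝ) - j| ≤ J := by
          rw [← hq, abs_of_nonneg (Nat.cast_nonneg _)]
          exact_mod_cast (Nat.sub_le _ _).trans hj'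
        gcongr
    rw [h1]
    refine (abs_add_le _ _).trans (add_le_add (hδy _) ?_)
    rw [le_div_iff₀ hD0, mul_comm, ← abs_of_pos hD0, ← abs_mul]
    exact h3

end Pigeonhole

end HyperellipticBound

namespace HyperellipticBound

section Closeness

variable {K : Type*} [Field K] [NumberField K]

/-- The number of residue classes at a place: `N(P)` at a prime `P`, and `1` at embeddings. -/
def plNorm : Pl K → ℕ
  | .inl _ => 1
  | .inr P => Ideal.absNorm P.asIdeal

lemma av_eq_exp_lg (v : Pl K) {x : K} (hx : x ≠ 0) : av v x = Real.exp (lg v x) :=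
  (Real.exp_log (av_pos v hx)).symm

lemma complex_close {z w : ℂ} (hz : z ≠ 0) (hw : w ≠ 0) {δ : ℝ} (hδ : 0 < δ) (hδ1 : δ ≤ 1 / 2)
    (h1 : |Real.log ‖z / w‖| ≤ 3 * δ / 8) (h2 : |z.arg - w.arg| ≤ δ / 4) :
    ‖z / w - 1‖ ≤ δ := by
  have h3 : z / w = Complex.exp (Complex.log z - Complex.log w) := by
    rw [Complex.exp_sub, Complex.exp_log hz, Complex.exp_log hw]
  set ζ := Complex.log z - Complex.log w with hζ
  have hre : ζ.re = Real.log ‖z / w‖ := by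
    rw [hζ, Complex.sub_re, Complex.log_re, Complex.log_re, norm_div, Real.log_div]
    · exact norm_ne_zero_iff.2 hz
    · exact norm_ne_zero_iff.2 hw
  have him : ζ.im = z.arg - w.arg := by
    rw [hζ, Complex.sub_im, Complex.log_im, Complex.log_im]
  have hn : ‖ζ‖ ≤ 5 * δ / 8 := by
    have := Complex.norm_le_abs_re_add_abs_im ζ
    rw [hre, him] at this
    linarith
  have h4 := Complex.norm_exp_sub_one_sub_id_le (x := ζ) (by linarith)
  have h5 : ‖Complex.exp ζ - 1‖ ≤ ‖Complex.exp ζ - 1 - ζ‖ + ‖ζ‖ := by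
    have := norm_add_le (Complex.exp ζ - 1 - ζ) ζ
    simpa using this
  rw [h3]
  nlinarith [norm_nonneg ζ]

/-- The elements of `𝓞 K` fall into at most `27 N(v₀) / δ` classes such that the quotient of two
elements of one class is close to `1` at `v₀` as soon as its absolute value is. -/
lemma exists_key_close (v₀ : Pl K) {δ : ℝ} (hδ : 0 < δ) (hδ1 : δ ≤ 1 / 2) :
    ∃ (n : ℕ) (key : 𝓞 K → Fin n), (n : ℝ) ≤ 27 / δ * plNorm v₀ ∧
      ∀ β β' : 𝓞 K, β ≠ 0 → β' ≠ 0 → key β = key β' →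
        |lg v₀ ((β : K) / β')| ≤ 3 * δ / 8 →
        (arch v₀ = 0 → av v₀ ((β : K) / β' - 1) * 2 ≤ 1) ∧
        (arch v₀ = 1 → av v₀ ((β : K) / β' - 1) ≤ δ) := by
  cases v₀ with
  | inl φ =>
    have hpi := Real.pi_lt_d2
    have hpi0 := Real.pi_pos
    let a : 𝓞 K → ℝ := fun β => (φ (β : K)).arg + Real.pi
    have ha : ∀ β, 0 ≤ a β ∧ a β ≤ 2 * Real.pi := fun β => by
      have h1 := Complex.neg_pi_lt_arg (φ (β : K))
      have h2 := Complex.arg_le_pi (φ (β : K))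
      simp only [a]; constructor <;> linarith
    refine ⟨⌊2 * Real.pi / (δ / 4)⌋₊ + 1, fun β => ⟨⌊a β / (δ / 4)⌋₊, Nat.lt_succ_of_le
      (Nat.floor_mono (div_le_div_of_nonneg_right (ha β).2 (by positivity)))⟩, ?_, ?_⟩
    · have := Nat.floor_le (a := 2 * Real.pi / (δ / 4)) (by positivity)
      have h3 : (1 : ℝ) ≤ 1 / 2 / δ := by rw [le_div_iff₀ hδ]; linarith
      simp only [plNorm, Nat.cast_add, Nat.cast_one, mul_one]
      calc (⌊2 * Real.pi / (δ / 4)⌋₊ : ℝ) + 1 ≤ 2 * Real.pi / (δ / 4) + 1 / 2 / δ := by gcongr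
        _ = (8 * Real.pi + 1 / 2) / δ := by field_simp; ring
        _ ≤ _ := by gcongr; linarith
    · intro β β' hβ hβ' hk hlg
      refine ⟨fun h => by simp [arch] at h, fun _ => ?_⟩
      have h1 : |a β - a β'| ≤ δ / 4 :=
        abs_sub_le_of_floor_eq (ha β).1 (ha β').1 (by positivity) (by simpa using hk)
      have hz : φ (β : K) ≠ 0 := by simpa using hβ
      have hw : φ (β' : K) ≠ 0 := by simpa using hβ'
      have := complex_close hz hw hδ hδ1 (by simpa [lg] using hlg)
        (by simpa only [a, add_sub_add_right_eq_sub] using h1)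
      simpa using this
  | inr P =>
    have hN0 : Ideal.absNorm P.asIdeal ≠ 0 := by have := two_le_absNorm P; omega
    obtain ⟨π, hπ⟩ := P.valuation_exists_uniformizer K
    have hπ0 : π ≠ 0 := by rintro rfl; simp at hπ; exact WithZero.exp_ne_zero hπ.symm
    -- normalize to a local unit and take its residue
    have hunit : ∀ β : 𝓞 K, β ≠ 0 →
        P.valuation K ((β : K) * π ^ (-ordAt P (β : K))) = 1 := fun β hβ => by
      rw [map_mul, map_zpow₀, hπ, valuation_eq_exp_ordAt P (by simpa using hβ : (β : K) ≠ 0),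
        ← WithZero.exp_zsmul, ← WithZero.exp_add]
      simp
    have hres : ∀ β : 𝓞 K, ∃ b : 𝓞 K, β ≠ 0 →
        P.valuation K ((β : K) * π ^ (-ordAt P (β : K)) - b) < 1 := fun β => by
      by_cases hβ : β = 0
      · exact ⟨0, fun h => absurd hβ h⟩
      · obtain ⟨b, hb⟩ := P.exists_valuation_sub_lt_of_integer (hunit β hβ).le
          (γ := 1)
        exact ⟨b, fun _ => by rw [Valuation.map_sub_swap]; exact hb⟩
    choose b hb using hres
    have hfin : Finite (𝓞 K ⧸ P.asIdeal) := by
      rw [← Ideal.absNorm_ne_zero_iff]; exact hN0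
    have hcard : Nat.card (𝓞 K ⧸ P.asIdeal) = Ideal.absNorm P.asIdeal := by
      rw [Ideal.absNorm_apply, Submodule.cardQuot_apply]
    let e : (𝓞 K ⧸ P.asIdeal) ≃ Fin (Ideal.absNorm P.asIdeal) := Finite.equivFinOfCardEq hcard
    refine ⟨Ideal.absNorm P.asIdeal, fun β => e (Ideal.Quotient.mk _ (b β)), ?_, ?_⟩
    · simp only [plNorm]
      have : 1 ≤ 27 / δ := by rw [le_div_iff₀ hδ]; linarith
      exact le_mul_of_one_le_left (Nat.cast_nonneg _) this
    · intro β β' hβ hβ' hk hlg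
      refine ⟨fun _ => ?_, fun h => by simp [arch] at h⟩
      have hβK : (β : K) ≠ 0 := by simpa using hβ
      have hβK' : (β' : K) ≠ 0 := by simpa using hβ'
      have hlog := log_two_le_log_absNorm P
      have hlog2 := Real.log_two_gt_d9
      have hordeq : ordAt P ((β : K) / β') = 0 := by
        rw [lg_inr, abs_mul, abs_neg, abs_of_pos (log_absNorm_pos P)] at hlg
        by_contra h
        have h1 : (1 : ℝ) ≤ |(ordAt P ((β : K) / β') : ℝ)| := by
          exact_mod_cast Int.one_le_abs h
        nlinarith
      have hord' : ordAt P (β : K) = ordAt P (β' : K) := by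
        rw [div_eq_mul_inv, ordAt_mul P hβK (inv_ne_zero hβK'), ordAt_inv] at hordeq
        omega
      have hbb : P.valuation K ((b β : K) - b β') < 1 := by
        have h1 := Ideal.Quotient.eq.1 (e.injective hk)
        have := (HeightOneSpectrum.valuation_lt_one_iff_mem (K := K) P (b β - b β')).2 h1
        simpa using this
      have hsub : P.valuation K (((β : K) - β') * π ^ (-ordAt P (β : K))) < 1 := by
        have h1 := hb β hβ
        have h2 := hb β' hβ'
        rw [← hord'] at h2
        have h3 : ((β : K) - β') * π ^ (-ordAt P (β : K))
            = ((β : K) * π ^ (-ordAt P (β : K)) - b β)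
              - ((β' : K) * π ^ (-ordAt P (β : K)) - b β') + ((b β : K) - b β') := by ring
        rw [h3]
        exact Valuation.map_add_lt _ (Valuation.map_sub_lt _ h1 h2) hbb
      have hlt : P.valuation K ((β : K) / β' - 1) < 1 := by
        have h1 := hunit β' hβ'
        rw [← hord'] at h1
        have h2 : (β : K) / β' - 1 = (((β : K) - β') * π ^ (-ordAt P (β : K)))
            * ((β' : K) * π ^ (-ordAt P (β : K)))⁻¹ := by
          have := zpow_ne_zero (-ordAt P (β : K)) hπ0
          field_simp
        rw [h2, map_mul, map_inv₀, h1, inv_one, mul_one]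
        exact hsub
      set x := (β : K) / β' - 1
      by_cases hx : x = 0
      · simp [hx]
      rw [valuation_eq_exp_ordAt P hx, ← WithZero.exp_zero, WithZero.exp_lt_exp] at hlt
      have h1 : (1 : ℝ) ≤ ordAt P x := by
        exact_mod_cast (by omega : (1 : ℤ) ≤ ordAt P x)
      rw [av_eq_exp_lg _ hx, lg_inr]
      have h2 : -(ordAt P x : ℝ) * Real.log (Ideal.absNorm P.asIdeal) ≤ -Real.log 2 := by nlinarith
      have h3 := Real.exp_le_exp.2 h2
      rw [Real.exp_neg, Real.exp_log two_pos] at h3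
      linarith

end Closeness

end HyperellipticBound

namespace HyperellipticBound

section UnitBound

variable {K : Type*} [Field K] [NumberField K]

lemma finsum_abs_lg {x : K} : ∑ᶠ v, |lg v x| = 2 * ht x := by
  have h : ∀ v, |lg v x| = lp v x + lp v x⁻¹ := fun v => abs_lg v x
  simp_rw [h]
  rw [finsum_add_distrib (hasFiniteSupport_lp x) (hasFiniteSupport_lp x⁻¹)]
  change ht x + ht x⁻¹ = _
  rw [ht_inv]; ring

lemma hasFiniteSupport_abs_lg (x : K) : (fun v => |lg v x|).HasFiniteSupport :=
  (hasFiniteSupport_lg x).subset fun v hv => by simpa using hv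

lemma finsum_split_finset {ι : Type*} (T : Finset ι) {f : ι → ℝ} (hf : f.HasFiniteSupport) :
    ∑ᶠ i, f i = ∑ i ∈ T, f i + ∑ᶠ i, if i ∈ T then 0 else f i := by
  have h1 : (fun i => if i ∈ T then f i else 0).HasFiniteSupport :=
    T.finite_toSet.subset fun i hi => by by_contra h; simp_all
  have h2 : (fun i => if i ∈ T then 0 else f i).HasFiniteSupport :=
    hf.subset fun i hi => by simp at hi ⊢; exact hi.2
  have h3 : ∑ i ∈ T, f i = ∑ᶠ i, if i ∈ T then f i else 0 := by
    rw [finsum_eq_sum_of_support_subset (s := T)]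
    · exact Finset.sum_congr rfl fun i hi => by simp [hi]
    · intro i hi; by_contra h; simp_all
  rw [h3, ← finsum_add_distrib h1 h2]
  exact finsum_congr fun i => by split_ifs <;> simp

lemma hasFiniteSupport_inr {f : Pl K → ℝ} (hf : f.HasFiniteSupport) :
    (fun P => f (.inr P)).HasFiniteSupport :=
  hf.preimage Sum.inr_injective.injOn

/-- The part of a sum over all places outside the embeddings and the primes of `T`. -/
def offSum (T : Finset (HeightOneSpectrum (𝓞 K))) (f : Pl K → ℝ) : ℝ :=
  ∑ᶠ P, if P ∈ T then 0 else f (.inr P)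

lemma finsum_eq_add_offSum (T : Finset (HeightOneSpectrum (𝓞 K))) {f : Pl K → ℝ}
    (hf : f.HasFiniteSupport) :
    ∑ᶠ v, f v = ∑ φ, f (.inl φ) + ∑ P ∈ T, f (.inr P) + offSum T f := by
  rw [finsum_split hf, finsum_split_finset T (hasFiniteSupport_inr hf), add_assoc, offSum]

lemma hasFiniteSupport_off (T : Finset (HeightOneSpectrum (𝓞 K))) {f : Pl K → ℝ}
    (hf : f.HasFiniteSupport) : (fun P => if P ∈ T then 0 else f (.inr P)).HasFiniteSupport :=
  (hasFiniteSupport_inr hf).subset fun i hi => by simp at hi ⊢; exact hi.2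

lemma abs_finsum_le {ι : Type*} {f : ι → ℝ} (hf : f.HasFiniteSupport) :
    |∑ᶠ i, f i| ≤ ∑ᶠ i, |f i| := by
  have h2 : (fun i => |f i|).HasFiniteSupport := hf.subset fun v hv => by simpa using hv
  rw [abs_le, ← finsum_neg_distrib]
  exact ⟨finsum_le_finsum_of_le (h2.subset fun v hv => by simpa using hv) hf
    fun i => neg_abs_le _, finsum_le_finsum_of_le hf h2 fun i => le_abs_self _⟩

lemma abs_sum_lg_le (u : K) (hu : u ≠ 0) (T : Finset (HeightOneSpectrum (𝓞 K))) {h₀ : ℝ}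
    (hoff : offSum T (fun v => |lg v u|) ≤ h₀) :
    |∑ φ, lg (.inl φ) u + ∑ P ∈ T, lg (.inr P) u| ≤ h₀ := by
  have h := finsum_eq_add_offSum T (hasFiniteSupport_lg u)
  rw [finsum_lg hu] at h
  have h1 : ∑ φ, lg (.inl φ) u + ∑ P ∈ T, lg (.inr P) u = -offSum T (fun v => lg v u) := by
    linarith
  rw [h1, abs_neg]
  refine le_trans ?_ hoff
  refine (abs_finsum_le (hasFiniteSupport_off T (hasFiniteSupport_lg u))).trans (le_of_eq ?_)
  exact finsum_congr fun P => by split_ifs <;> simp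

lemma pow_injective_of_ht_pos {η : K} (h : 0 < ht η) (i j : ℕ) (hij : η ^ i = η ^ j) : i = j := by
  have h1 := congrArg ht hij
  rw [ht_pow, ht_pow] at h1
  exact_mod_cast mul_right_cancel₀ h.ne' h1

/-- From a simultaneous approximation of the logarithmic vector of `u` to the heights entering the
two-logarithm estimate. -/
lemma approximation_heights {u η : K} (hu : u ≠ 0) (hη : η ≠ 0)
    (T : Finset (HeightOneSpectrum (𝓞 K)))
    {W q δ₀ h₀ ε : ℝ} (hW : 0 < W) (hWu : W = ht u) (hq : 0 ≤ q)
    (hoff : offSum T (fun v => |lg v u|) ≤ h₀)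
    (h1 : ∀ P ∉ T, lg (.inr P) η = 0)
    (h2 : ∀ P ∈ T, |lg (.inr P) η - q * (lg (.inr P) u / W)| ≤ δ₀)
    (h3 : ∀ φ, |lg (.inl φ) η - q * (lg (.inl φ) u / W)| ≤ ε) :
    let E := Module.finrank ℚ K * ε + T.card * δ₀ + q * h₀ / W
    ht η ≤ q + E / 2 ∧ q - E / 2 ≤ ht η ∧
      ∀ r : ℕ, r * q ≤ W → W ≤ (r + 1) * q → ht (u * (η⁻¹) ^ r) ≤ q + r * (E / 2) := by
  intro E
  let g : Pl K → ℝ := fun v => lg v η - q * (lg v u / W)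
  have hg : g.HasFiniteSupport := by
    have h2 : (fun v => -(q * (lg v u / W))).HasFiniteSupport :=
      (hasFiniteSupport_lg u).subset fun v hv => by
        simp at hv ⊢; exact hv.2.1
    exact ((hasFiniteSupport_lg η).add h2).subset fun v hv => by
      simpa [g, sub_eq_add_neg] using hv
  have hg' : (fun v => |g v|).HasFiniteSupport := hg.subset fun v hv => by simpa using hv
  have hE : ∑ᶠ v, |g v| ≤ E := by
    rw [finsum_eq_add_offSum T hg']
    refine add_le_add (add_le_add ?_ ?_) ?_
    · refine (Finset.sum_le_sum fun φ _ => h3 φ).trans ?_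
      rw [Finset.sum_const, Finset.card_univ, nsmul_eq_mul, ← Embeddings.card K ℂ]
    · refine (Finset.sum_le_sum h2).trans ?_
      simp
    · have : offSum T (fun v => |g v|) = q / W * offSum T (fun v => |lg v u|) := by
        unfold offSum
        rw [mul_finsum]
        refine finsum_congr fun P => ?_
        split_ifs with h
        · simp
        · simp only [g, h1 P h, zero_sub, abs_neg, abs_mul, abs_div, abs_of_nonneg hq,
            abs_of_pos hW]
          ring
      rw [this]
      calc q / W * offSum T (fun v => |lg v u|) ≤ q / W * h₀ := by gcongr
        _ = _ := by ring
  have hlu : ∑ᶠ v, q / W * |lg v u| = 2 * q := by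
    rw [← mul_finsum, finsum_abs_lg, ← hWu]; field_simp
  have hlu' : (fun v => q / W * |lg v u|).HasFiniteSupport :=
    (hasFiniteSupport_abs_lg u).subset fun v hv => by simp at hv ⊢; exact hv.2
  have habs : ∀ v, |q * (lg v u / W)| = q / W * |lg v u| := fun v => by
    rw [abs_mul, abs_div, abs_of_nonneg hq, abs_of_pos hW]; ring
  refine ⟨?_, ?_, fun r hr1 hr2 => ?_⟩
  · have : ∑ᶠ v, |lg v η| ≤ ∑ᶠ v, (q / W * |lg v u| + |g v|) :=
      finsum_le_finsum_of_le (hasFiniteSupport_abs_lg η) (hlu'.add hg') fun v => by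
        have := abs_add_le (q * (lg v u / W)) (g v)
        rw [habs] at this
        simpa [g] using this
    rw [finsum_add_distrib hlu' hg', hlu, finsum_abs_lg] at this
    linarith
  · have : ∑ᶠ v, q / W * |lg v u| ≤ ∑ᶠ v, (|lg v η| + |g v|) :=
      finsum_le_finsum_of_le hlu' ((hasFiniteSupport_abs_lg η).add hg') fun v => by
        have := abs_sub (lg v η) (g v)
        rw [show lg v η - g v = q * (lg v u / W) by simp [g], habs] at this
        exact this
    rw [finsum_add_distrib (hasFiniteSupport_abs_lg η) hg', hlu, finsum_abs_lg] at this
    linarith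
  · have hc : |1 - r * q / W| ≤ q / W := by
      rw [abs_of_nonneg (by rw [sub_nonneg, div_le_one hW]; exact hr1), sub_le_iff_le_add,
        ← add_div, le_div_iff₀ hW]
      linarith
    have hs : (fun v => (r : ℝ) * |g v|).HasFiniteSupport :=
      hg'.subset fun v hv => by simp at hv ⊢; exact hv.2
    have : ∑ᶠ v, |lg v (u * (η⁻¹) ^ r)| ≤ ∑ᶠ v, (q / W * |lg v u| + r * |g v|) :=
      finsum_le_finsum_of_le (hasFiniteSupport_abs_lg _) (hlu'.add hs) fun v => by
        rw [lg_mul v hu (pow_ne_zero _ (inv_ne_zero hη)), lg_pow, lg_inv]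
        have h4 : lg v u + r * -lg v η = (1 - r * q / W) * lg v u - r * g v := by
          simp only [g]; ring
        rw [h4]
        refine (abs_sub _ _).trans (add_le_add ?_ ?_)
        · rw [abs_mul]; gcongr
        · rw [abs_mul, abs_of_nonneg (Nat.cast_nonneg r)]
    rw [finsum_add_distrib hlu' hs, hlu, ← mul_finsum, finsum_abs_lg] at this
    have h5 : (r : ℝ) * ∑ᶠ v, |g v| ≤ r * E := by gcongr
    linarith

lemma abs_log_le_one {x : ℝ} (h : |x - 1| ≤ 1 / 2) : |Real.log x| ≤ 1 := by
  rw [abs_le] at h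
  have hx : 1 / 2 ≤ x := by linarith
  have h1 := Real.log_le_sub_one_of_pos (show 0 < x by linarith)
  have h2 := Real.one_sub_inv_le_log_of_pos (show 0 < x by linarith)
  have h3 : x⁻¹ ≤ 2 := by rw [inv_le_comm₀ (by linarith) two_pos]; linarith
  rw [abs_le]; constructor <;> linarith

lemma abs_lg_le_of_close (v₀ : Pl K) {u : K} (h : av v₀ (u - 1) ≤ 1 / 2) : |lg v₀ u| ≤ 1 := by
  apply abs_log_le_one
  have := (av v₀).abs_abv_sub_le_abv_sub u 1
  rw [map_one] at this
  exact this.trans h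

lemma lg_eq_zero_of_close (P : HeightOneSpectrum (𝓞 K)) {u : K} (h : av (.inr P) (u - 1) ≤ 1 / 2) :
    lg (.inr P) u = 0 := by
  have h1 : av (.inr P) u = 1 := by
    have hna := NumberField.HeightOneSpectrum.adicAbv_add_le_max K P
    have h2 := hna (u - 1) 1
    have h3 := hna u (-(u - 1))
    simp only [sub_add_cancel, map_one, AbsoluteValue.map_neg] at h2 h3
    have h4 : u + -(u - 1) = 1 := by ring
    rw [h4, map_one] at h3
    simp only [av_inr] at h ⊢
    refine le_antisymm (h2.trans (max_le (by linarith) le_rfl)) ?_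
    rcases le_max_iff.1 h3 with h | h <;> linarith
  rw [lg, h1, Real.log_one]

end UnitBound

end HyperellipticBound

namespace HyperellipticBound

section UnitBoundMain

variable {K : Type*} [Field K] [NumberField K]

lemma unit_bound_numerics {D m δ δ₀ h₀ J W q ε E : ℝ} (hD : 1 ≤ D) (hm : 0 ≤ m) (hδ : 0 < δ)
    (hδ₀ : δ₀ = δ / (8 * (D + m))) (hh₀ : 0 ≤ h₀) (hq : 1 ≤ q) (hqJ : q ≤ J)
    (hWb : 8 * J * (J + h₀) / δ < W)
    (hε : ε = δ₀ + (m * δ₀ + J * h₀ / W) / D) (hE : E = D * ε + m * δ₀ + q * h₀ / W) :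
    0 < W ∧ q / W ≤ δ / 8 ∧ E / 2 ≤ δ / 4 ∧ ε ≤ δ / 4 ∧ δ₀ ≤ δ / 8 ∧ 8 * J / δ * q ≤ W := by
  have hJ : 1 ≤ J := hq.trans hqJ
  have h1 : 8 * J * (J + h₀) < W * δ := by rwa [div_lt_iff₀ hδ] at hWb
  have hW : 0 < W := by
    by_contra! h
    nlinarith [mul_nonneg (by linarith : (0:ℝ) ≤ J) hh₀]
  have hs : 0 < D + m := by linarith
  have h2 : (D + m) * δ₀ = δ / 8 := by rw [hδ₀]; field_simp
  have hδ₀0 : 0 < δ₀ := by rw [hδ₀]; positivity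
  have h3 : J * h₀ / W ≤ δ / 8 := by rw [div_le_iff₀ hW]; nlinarith
  have h4 : q * h₀ / W ≤ J * h₀ / W := by gcongr
  have hDε : D * ε = D * δ₀ + (m * δ₀ + J * h₀ / W) := by rw [hε]; field_simp
  have h7 : 0 ≤ m * δ₀ := by positivity
  have h8 : 0 ≤ J * h₀ / W := by positivity
  refine ⟨hW, ?_, ?_, ?_, ?_, ?_⟩
  · rw [div_le_iff₀ hW]; nlinarith [mul_nonneg (by linarith : (0:ℝ) ≤ J) hh₀]
  · rw [hE, hDε]; nlinarith [mul_pos (by linarith : (0:ℝ) < D) hδ₀0]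
  · have : (m * δ₀ + J * h₀ / W) / D ≤ m * δ₀ + J * h₀ / W := div_le_self (by positivity) hD
    rw [hε]; nlinarith
  · nlinarith
  · rw [div_mul_eq_mul_div, div_le_iff₀ hδ]; nlinarith [mul_nonneg (by linarith : (0:ℝ) ≤ J) hh₀]

set_option maxHeartbeats 1600000 in
/-- A number whose absolute values outside `T` are under control, and which is close to `1` at a
place of `T` or at infinity, has bounded height. -/
theorem unit_bound {u : K} (hu : u ≠ 0) (T : Finset (HeightOneSpectrum (𝓞 K))) (v₀ : Pl K)
    (hv₀ : ∀ P, v₀ = .inr P → P ∈ T) {h₀ δ δ₀ D m Λ : ℝ} {L J : ℕ}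
    (hD : D = Module.finrank ℚ K) (hm : m = T.card) (hh₀ : 0 ≤ h₀)
    (hoff : offSum T (fun v => |lg v u|) ≤ h₀)
    (hclose : ht u / (2 * (D + m)) ≤ -lg v₀ (u - 1)) (hlarge : 2 * (D + m) ≤ ht u)
    (hδ : 0 < δ) (hLδ : 2000 * L * δ ≤ 1) (hE : 1 ≤ Real.log (1 / δ))
    (hL : 64 * (D + 1) * Real.log (1 / δ) ≤ L) (hLs : 1200000 * (L ^ 2 * δ * (D + m)) ≤ 1)
    (hδ₀ : δ₀ = δ / (8 * (D + m))) (hΛ : Λ = Real.log (2 * √|(discr K : ℝ)|))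
    (hJ : (2 * √|(discr K : ℝ)|) * √(2 * √|(discr K : ℝ)|) * Real.exp (4 * D)
      * (∏ P ∈ T, (Real.log (Ideal.absNorm P.asIdeal) / δ₀ + 1))
      * (Λ / δ₀ + 1) ^ Fintype.card (InfinitePlace K) * (27 / δ * plNorm v₀) < J + 1) :
    ht u ≤ 8 * J * (J + h₀) / δ := by
  by_contra! hWb
  have hD1 : 1 ≤ D := by rw [hD]; exact_mod_cast Module.finrank_pos (R := ℚ) (M := K)
  have hm0 : 0 ≤ m := by rw [hm]; positivity
  have hs : 0 < D + m := by linarith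
  have hW : 0 < ht u := by linarith
  have hδ₀0 : 0 < δ₀ := by rw [hδ₀]; positivity
  have hL1 : (1 : ℝ) ≤ L := by nlinarith
  have hδ2 : δ ≤ 1 / 2 := by nlinarith
  have hΛ0 : 0 ≤ Λ := by
    rw [hΛ]
    have h1 : (1 : ℝ) ≤ |(discr K : ℝ)| := by
      exact_mod_cast Int.one_le_abs (discr_ne_zero K)
    apply Real.log_nonneg
    have := Real.one_le_sqrt.mpr h1
    linarith
  have hprod : 0 ≤ ∏ P ∈ T, (Real.log (Ideal.absNorm P.asIdeal) / δ₀ + 1) :=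
    Finset.prod_nonneg fun P _ => by have := log_absNorm_pos P; positivity
  obtain ⟨N, key, hN, hkey⟩ := exists_key_close v₀ hδ hδ2
  have habs := abs_sum_lg_le u hu T hoff
  subst hD hm
  obtain ⟨q, β, β', hq1, hqJ, hβ, hβ', hk, ha, hb, hc⟩ := exists_approximation u T hW hδ₀0 habs
    key J hΛ (lt_of_le_of_lt (by
      rw [Fintype.card_fin]
      refine mul_le_mul_of_nonneg_left hN ?_
      positivity) hJ)
  have hq1' : (1 : ℝ) ≤ q := by exact_mod_cast hq1
  have hqJ' : (q : ℝ) ≤ J := by exact_mod_cast hqJ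
  obtain ⟨-, hqW, hE2, hε4, hδ8, hr0⟩ := unit_bound_numerics hD1 hm0 hδ hδ₀ hh₀ hq1' hqJ'
      hWb rfl rfl
  have hβK : (β : K) ≠ 0 := by simpa using hβ
  have hβK' : (β' : K) ≠ 0 := by simpa using hβ'
  have hη : (β' : K) / β ≠ 0 := div_ne_zero hβK' hβK
  obtain ⟨hh1, hh2, hh3⟩ := approximation_heights hu hη T hW rfl (by positivity : (0:ℝ) ≤ q) hoff
    (fun P hP => by rw [lg_inr, ha P hP]; simp) hb hc
  rw [inv_div] at hh3
  have hhinv : ht ((β : K) / β') = ht ((β' : K) / β) := by rw [← ht_inv, inv_div]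
  have hfar : av v₀ (u - 1) ≤ 1 / 2 := by
    have h1 : 1 ≤ ht u / (2 * (Module.finrank ℚ K + T.card)) := by
      rw [le_div_iff₀ (by positivity)]; linarith
    have h2 : lg v₀ (u - 1) ≤ -1 := by linarith
    rcases eq_or_ne (u - 1) 0 with h | h
    · rw [h, map_zero]; norm_num
    · rw [av_eq_exp_lg v₀ h]
      have := Real.exp_le_exp.mpr h2
      have h3 := Real.exp_neg_one_lt_d9
      linarith
  have hclose' : |lg v₀ ((β : K) / β')| ≤ 3 * δ / 8 := by
    rw [← inv_div, lg_inv, abs_neg]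
    cases v₀ with
    | inl φ =>
      have h1 := abs_lg_le_of_close _ hfar
      have h2 := hc φ
      have h3 : |(q : ℝ) * (lg (.inl φ) u / ht u)| ≤ δ / 8 := by
        have : (q : ℝ) * (lg (.inl φ) u / ht u) = q / ht u * lg (.inl φ) u := by ring
        rw [this, abs_mul, abs_of_nonneg (by positivity)]
        calc (q : ℝ) / ht u * |lg (.inl φ) u| ≤ q / ht u * 1 := by gcongr
          _ ≤ δ / 8 := by linarith
      have h4 := abs_sub_abs_le_abs_sub (lg (.inl φ) ((β' : K) / β)) (q * (lg (.inl φ) u / ht u))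
      linarith
    | inr P =>
      have h1 := lg_eq_zero_of_close P hfar
      have h2 := hb P (hv₀ P rfl)
      rw [h1] at h2
      simp only [zero_div, mul_zero, sub_zero] at h2
      linarith
  obtain ⟨hc0, hc1⟩ := hkey β β' hβ hβ' hk hclose'
  set r : ℕ := ⌊ht u / q⌋₊ with hr
  have hq0 : (0 : ℝ) < q := by linarith
  have hr1 : (r : ℝ) * q ≤ ht u := by
    rw [← le_div_iff₀ hq0]; exact Nat.floor_le (by positivity)
  have hr2 : ht u ≤ (r + 1) * q := by
    rw [← div_le_iff₀ hq0]; exact (Nat.lt_floor_add_one _).le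
  have hr3 : 7 * J ≤ δ * r := by
    have h1 : 8 * J / δ ≤ r + 1 := le_of_mul_le_mul_right (hr0.trans hr2) hq0
    rw [div_le_iff₀ hδ] at h1
    nlinarith
  have key2 := two_log hu (div_ne_zero hβK hβK') v₀ (L := L) (r := r) (δ := δ) (H := q + 1)
    (fun i _ j _ hij => pow_injective_of_ht_pos (by rw [hhinv]; linarith) i j hij) hδ (by linarith)
    (by linarith) hLδ hE hL (by
      have := hh3 r hr1 hr2
      have h2 : (0:ℝ) ≤ r := by positivity
      nlinarith) (by rw [hhinv]; linarith) hc0 hc1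
  have h5 : (L : ℝ) ^ 2 * δ * r * (q + 1) ≤ L ^ 2 * δ * (2 * ht u) := by
    rw [mul_assoc]
    refine mul_le_mul_of_nonneg_left ?_ (by positivity)
    have : (0:ℝ) ≤ r := by positivity
    nlinarith
  have h6 : ht u / (2 * (Module.finrank ℚ K + T.card)) < 300000 * (L ^ 2 * δ * (2 * ht u)) := by
    linarith
  rw [div_lt_iff₀ (by positivity)] at h6
  nlinarith

end UnitBoundMain

end HyperellipticBound

namespace HyperellipticBound

section Extension

variable {K K' : Type*} [Field K] [NumberField K] [Field K'] [NumberField K'] [Algebra K K']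

variable (K) in
/-- Restriction of a place of `K'` to `K`. -/
def res : Pl K' → Pl K
  | .inl φ => .inl (φ.comp (algebraMap K K'))
  | .inr P => .inr (P.under (𝓞 K))

@[simp] lemma res_inr (P : HeightOneSpectrum (𝓞 K')) :
    res K (.inr P) = .inr (P.under (𝓞 K)) := rfl

variable (K) in
/-- The local degree of a place of `K'` over `K`. -/
def mlt : Pl K' → ℕ
  | .inl _ => 1
  | .inr P => (P.under (𝓞 K)).asIdeal.ramificationIdx' P.asIdeal *
      (P.under (𝓞 K)).asIdeal.inertiaDeg' P.asIdeal

instance liesOver_under (P : HeightOneSpectrum (𝓞 K')) :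
    P.asIdeal.LiesOver (P.under (𝓞 K)).asIdeal := ⟨rfl⟩

lemma log_absNorm_extension (P : HeightOneSpectrum (𝓞 K')) :
    Real.log (Ideal.absNorm P.asIdeal) = (P.under (𝓞 K)).asIdeal.inertiaDeg' P.asIdeal *
      Real.log (Ideal.absNorm (P.under (𝓞 K)).asIdeal) := by
  rw [Ideal.absNorm_eq_pow_inertiaDeg'_of_liesOver P.asIdeal (P.under (𝓞 K)).asIdeal
    (P.under (𝓞 K)).isPrime (P.under (𝓞 K)).ne_bot]
  push_cast
  rw [Real.log_pow]

lemma ordAt_algebraMap (P : HeightOneSpectrum (𝓞 K')) (x : K) :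
    ordAt P (algebraMap K K' x) =
      (P.under (𝓞 K)).asIdeal.ramificationIdx' P.asIdeal * ordAt (P.under (𝓞 K)) x := by
  rcases eq_or_ne x 0 with rfl | hx
  · simp [ordAt]
  have h := HeightOneSpectrum.valuation_liesOver K' (P.under (𝓞 K)) P x
  rw [valuation_eq_exp_ordAt _ hx, valuation_eq_exp_ordAt _ (by simpa using hx),
    ← WithZero.exp_nsmul, WithZero.exp_inj] at h
  rw [nsmul_eq_mul] at h
  linarith

lemma lg_algebraMap (w : Pl K') (x : K) :
    lg w (algebraMap K K' x) = mlt K w * lg (res K w) x := by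
  cases w with
  | inl φ => simp [lg, mlt, res]
  | inr P =>
    simp only [res, mlt]
    rw [lg_inr, lg_inr, ordAt_algebraMap, log_absNorm_extension (K := K) P]
    push_cast; ring

lemma inertiaDeg_pos (P : HeightOneSpectrum (𝓞 K')) :
    0 < (P.under (𝓞 K)).asIdeal.inertiaDeg' P.asIdeal := by
  by_contra! h
  have h1 := log_absNorm_extension (K := K) P
  have h2 := log_absNorm_pos P
  rw [Nat.le_zero.mp h, Nat.cast_zero, zero_mul] at h1
  linarith

lemma ramificationIdx_pos {F : Type*} [Field F] [Algebra F K'] (P : HeightOneSpectrum (𝓞 K')) :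
    0 < (P.under (𝓞 F)).asIdeal.ramificationIdx' P.asIdeal :=
  Nat.pos_of_ne_zero (Ideal.IsDedekindDomain.ramificationIdx'_ne_zero_of_liesOver P.asIdeal
    (P.under (𝓞 F)).ne_bot)

lemma mlt_pos (w : Pl K') : 0 < mlt K w := by
  cases w with
  | inl φ => simp [mlt]
  | inr P => exact Nat.mul_pos (ramificationIdx_pos P) (inertiaDeg_pos P)

lemma lp_algebraMap (w : Pl K') (x : K) :
    lp w (algebraMap K K' x) = mlt K w * lp (res K w) x := by
  have h : (0 : ℝ) ≤ mlt K w := by positivity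
  rw [lp_eq_max, lp_eq_max, lg_algebraMap, mul_max_of_nonneg _ _ h, mul_zero]

lemma finite_under_eq (P : HeightOneSpectrum (𝓞 K)) :
    {Q : HeightOneSpectrum (𝓞 K') | Q.under (𝓞 K) = P}.Finite := by
  have := P.isMaximal
  refine Set.Finite.of_finite_image (f := HeightOneSpectrum.asIdeal)
    ((IsDedekindDomain.primesOver_finite P.asIdeal (𝓞 K')).subset ?_)
    (fun _ _ _ _ h => HeightOneSpectrum.ext h)
  rintro _ ⟨Q, rfl, rfl⟩
  exact ⟨Q.isPrime, ⟨rfl⟩⟩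

variable (K') in
/-- The primes of `K'` above a prime of `K`. -/
def above (P : HeightOneSpectrum (𝓞 K)) : Finset (HeightOneSpectrum (𝓞 K')) :=
  (finite_under_eq P).toFinset

@[simp] lemma mem_above {P : HeightOneSpectrum (𝓞 K)} {Q : HeightOneSpectrum (𝓞 K')} :
    Q ∈ above K' P ↔ Q.under (𝓞 K) = P := by simp [above]

lemma sum_mlt_above (P : HeightOneSpectrum (𝓞 K)) :
    ∑ Q ∈ above K' P, mlt K (.inr Q) = Module.finrank K K' := by
  have := P.isMaximal
  rw [← Ideal.sum_ramification_inertia (𝓞 K') K K' P.ne_bot]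
  refine Finset.sum_bij (fun Q _ => Q.asIdeal) ?_ (fun _ _ _ _ h => HeightOneSpectrum.ext h) ?_ ?_
  · intro Q hQ
    rw [mem_above] at hQ
    exact (IsDedekindDomain.mem_primesOverFinset_iff P.ne_bot _).mpr
      ⟨Q.isPrime, ⟨by rw [← hQ]; rfl⟩⟩
  · intro Q hQ
    obtain ⟨h1, h2⟩ := (IsDedekindDomain.mem_primesOverFinset_iff P.ne_bot _).mp hQ
    refine ⟨⟨Q, h1, ?_⟩, ?_, rfl⟩
    · exact Ideal.ne_bot_of_mem_primesOver P.ne_bot ⟨h1, h2⟩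
    · rw [mem_above]; exact HeightOneSpectrum.ext h2.over.symm
  · intro Q hQ
    rw [mem_above] at hQ
    subst hQ
    rfl

lemma card_above_le (P : HeightOneSpectrum (𝓞 K)) :
    (above K' P).card ≤ Module.finrank K K' := by
  rw [← sum_mlt_above (K' := K') P, Finset.card_eq_sum_ones]
  exact Finset.sum_le_sum fun Q _ => mlt_pos _

lemma pairwiseDisjoint_above (s : Set (HeightOneSpectrum (𝓞 K))) :
    s.PairwiseDisjoint (above K') := by
  intro P _ P' _ hne
  refine Finset.disjoint_left.mpr fun Q hQ hQ' => ?_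
  rw [mem_above] at hQ hQ'
  exact hne (hQ.symm.trans hQ')

variable (K') in
/-- The primes of `K'` above the primes in `T`. -/
def lift (T : Finset (HeightOneSpectrum (𝓞 K))) : Finset (HeightOneSpectrum (𝓞 K')) :=
  T.biUnion (above K')

@[simp] lemma mem_lift {T : Finset (HeightOneSpectrum (𝓞 K))} {Q : HeightOneSpectrum (𝓞 K')} :
    Q ∈ lift K' T ↔ Q.under (𝓞 K) ∈ T := by simp [lift]

lemma card_lift_le (T : Finset (HeightOneSpectrum (𝓞 K))) :
    (lift K' T).card ≤ Module.finrank K K' * T.card := by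
  rw [mul_comm]
  exact Finset.card_biUnion_le_card_mul _ _ _ fun P _ => card_above_le P

lemma sum_lift_log_le (T : Finset (HeightOneSpectrum (𝓞 K))) :
    ∑ Q ∈ lift K' T, Real.log (Ideal.absNorm Q.asIdeal) ≤
      Module.finrank K K' * ∑ P ∈ T, Real.log (Ideal.absNorm P.asIdeal) := by
  rw [lift, Finset.sum_biUnion, Finset.mul_sum]
  · refine Finset.sum_le_sum fun P _ => ?_
    rw [← sum_mlt_above (K' := K') P, Nat.cast_sum, Finset.sum_mul]
    refine Finset.sum_le_sum fun Q hQ => ?_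
    rw [mem_above] at hQ
    subst hQ
    rw [log_absNorm_extension (K := K) Q]
    refine mul_le_mul_of_nonneg_right ?_ (log_absNorm_pos _).le
    have h := Nat.le_mul_of_pos_left ((Q.under (𝓞 K)).asIdeal.inertiaDeg' Q.asIdeal)
      (ramificationIdx_pos (F := K) Q)
    exact Nat.cast_le.mpr h
  · exact pairwiseDisjoint_above _

lemma hasFiniteSupport_res {f : Pl K → ℝ} (hf : f.HasFiniteSupport) :
    (fun w => (mlt K w : ℝ) * f (res K w) : Pl K' → ℝ).HasFiniteSupport := by
  apply hasFiniteSupport_of_inr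
  have h : (Function.support fun P => f (.inr P)).Finite := hasFiniteSupport_inr hf
  refine ((lift K' h.toFinset).finite_toSet).subset fun Q hQ => ?_
  simp only [Function.mem_support, ne_eq, mul_eq_zero, not_or] at hQ
  simpa [res] using hQ.2

lemma card_extensions (φ : K →+* ℂ) :
    (Finset.univ.filter fun ψ : K' →+* ℂ => ψ.comp (algebraMap K K') = φ).card =
      Module.finrank K K' := by
  let : Algebra K ℂ := φ.toAlgebra
  rw [← AlgHom.card K K' ℂ, ← Finset.card_univ]
  symm
  refine Finset.card_bij (fun ψ _ => ψ.toRingHom) ?_ ?_ ?_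
  · intro ψ _
    simp only [Finset.mem_filter, Finset.mem_univ, true_and]
    ext x
    exact ψ.commutes x
  · intro ψ _ ψ' _ h
    ext x
    exact RingHom.congr_fun h x
  · intro ψ hψ
    simp only [Finset.mem_filter, Finset.mem_univ, true_and] at hψ
    exact ⟨{ ψ with commutes' := fun x => RingHom.congr_fun hψ x }, Finset.mem_univ _, rfl⟩

/-- Compatibility of sums over places with extension of the ground field. -/
lemma finsum_res {f : Pl K → ℝ} (hf : f.HasFiniteSupport) :
    ∑ᶠ w : Pl K', (mlt K w : ℝ) * f (res K w) = Module.finrank K K' * ∑ᶠ v, f v := by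
  rw [finsum_split (hasFiniteSupport_res hf), finsum_split hf, mul_add]
  congr 1
  · rw [← Finset.sum_fiberwise_of_maps_to (g := fun ψ : K' →+* ℂ => ψ.comp (algebraMap K K'))
      (fun _ _ => Finset.mem_univ _), Finset.mul_sum]
    refine Finset.sum_congr rfl fun φ _ => ?_
    rw [← card_extensions (K' := K') φ, ← nsmul_eq_mul, ← Finset.sum_const]
    refine Finset.sum_congr rfl fun ψ hψ => ?_
    simp only [Finset.mem_filter, Finset.mem_univ, true_and] at hψ
    simp [mlt, res, hψ]
  · have h : (Function.support fun P => f (.inr P)).Finite := hasFiniteSupport_inr hf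
    rw [finsum_eq_sum_of_support_subset (s := lift K' h.toFinset) _ (by
        intro Q hQ
        simp only [Function.mem_support, ne_eq, mul_eq_zero, not_or] at hQ
        simpa [res] using hQ.2),
      finsum_eq_sum_of_support_subset (s := h.toFinset) _ (by simp),
      lift, Finset.sum_biUnion, Finset.mul_sum]
    · refine Finset.sum_congr rfl fun P _ => ?_
      rw [← sum_mlt_above (K' := K') P]
      push_cast
      rw [Finset.sum_mul]
      refine Finset.sum_congr rfl fun Q hQ => ?_
      rw [mem_above] at hQ
      simp [res, hQ]
    · exact pairwiseDisjoint_above _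

lemma ht_algebraMap (x : K) : ht (algebraMap K K' x) = Module.finrank K K' * ht x := by
  rw [ht, ht, ← finsum_res (hasFiniteSupport_lp x)]
  exact finsum_congr fun w => lp_algebraMap w x

end Extension

end HyperellipticBound

namespace HyperellipticBound

section Normalization

variable {K : Type*} [Field K] [NumberField K]

lemma finrank_pos_real : (0 : ℝ) < Module.finrank ℚ K := by
  exact_mod_cast Module.finrank_pos (R := ℚ) (M := K)

lemma lp_inr (P : HeightOneSpectrum (𝓞 K)) (x : K) :
    lp (.inr P) x = ((max 0 (-(ordAt P x)) : ℤ) : ℝ) * Real.log (Ideal.absNorm P.asIdeal) := by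
  have h := (log_absNorm_pos P).le
  rw [lp_eq_max, lg_inr]
  push_cast
  rw [max_mul_of_nonneg _ _ h, zero_mul]

lemma finrank_mul_wHeight (x : K) : Module.finrank ℚ K * wHeight x = ht x := by
  rw [wHeight, mul_div_cancel₀ _ (finrank_pos_real (K := K)).ne', ht,
    finsum_split (hasFiniteSupport_lp x),
    ← sum_embeddings fun w : InfinitePlace K => Real.log (max 1 (w x))]
  simp_rw [lp_inr]
  rfl

/-- Logarithm of the largest absolute value of `1`, `δ` and the coefficients. -/
def lA (n : ℕ) (δ : K) (a : ℕ → K) (v : Pl K) : ℝ :=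
  max (lp v δ) ((Finset.range (n + 1)).sup'
    (Finset.nonempty_range_iff.mpr (Nat.succ_ne_zero n)) fun j => lp v (a j))

variable {n : ℕ} {δ : K} {a : ℕ → K}

lemma lp_le_lA (v : Pl K) : lp v δ ≤ lA n δ a v := le_max_left _ _

lemma lp_coeff_le_lA (v : Pl K) {j : ℕ} (hj : j ≤ n) : lp v (a j) ≤ lA n δ a v :=
  (Finset.le_sup' (fun j => lp v (a j)) (Finset.mem_range_succ_iff.mpr hj)).trans
    (le_max_right _ _)

lemma lA_nonneg (v : Pl K) : 0 ≤ lA n δ a v := (lp_nonneg v δ).trans (lp_le_lA v)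

lemma lA_le {v : Pl K} {c : ℝ} (hδ : lp v δ ≤ c) (ha : ∀ j ≤ n, lp v (a j) ≤ c) :
    lA n δ a v ≤ c :=
  max_le hδ (Finset.sup'_le _ _ fun j hj => ha j (Finset.mem_range_succ_iff.mp hj))

lemma lA_le_sum (v : Pl K) : lA n δ a v ≤ lp v δ + ∑ j ∈ Finset.range (n + 1), lp v (a j) := by
  have h0 : ∀ j ∈ Finset.range (n + 1), 0 ≤ lp v (a j) := fun j _ => lp_nonneg v _
  refine lA_le (by linarith [Finset.sum_nonneg h0]) fun j hj => ?_
  have := Finset.single_le_sum h0 (Finset.mem_range_succ_iff.mpr hj)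
  linarith [lp_nonneg v δ]

lemma hasFiniteSupport_lA : (fun v => lA n δ a v).HasFiniteSupport := by
  have h : (fun v => lp v δ + ∑ j ∈ Finset.range (n + 1), lp v (a j)).HasFiniteSupport := by
    refine (hasFiniteSupport_lp δ).add ?_
    refine ((Finset.range (n + 1)).finite_toSet.biUnion
      fun j _ => hasFiniteSupport_lp (a j)).subset fun v hv => ?_
    obtain ⟨j, hj, h⟩ := Finset.exists_ne_zero_of_sum_ne_zero hv
    exact Set.mem_biUnion (Finset.mem_coe.mpr hj) h
  refine h.subset fun v hv h0 => hv (le_antisymm ?_ (lA_nonneg v))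
  exact (lA_le_sum v).trans h0.le

/-- The unnormalized height of the tuple `(1, δ, a₀, …, aₙ)`. -/
def hA (n : ℕ) (δ : K) (a : ℕ → K) : ℝ := ∑ᶠ v, lA n δ a v

lemma hA_nonneg : 0 ≤ hA n δ a := finsum_nonneg fun v => lA_nonneg v

lemma ht_le_hA : ht δ ≤ hA n δ a :=
  finsum_le_finsum_of_le (hasFiniteSupport_lp δ) hasFiniteSupport_lA fun v => lp_le_lA v

lemma ht_coeff_le_hA {j : ℕ} (hj : j ≤ n) : ht (a j) ≤ hA n δ a :=
  finsum_le_finsum_of_le (hasFiniteSupport_lp _) hasFiniteSupport_lA fun v => lp_coeff_le_lA v hj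

lemma hA_le_finrank_mul_hhat : hA n δ a ≤ Module.finrank ℚ K * hhat n δ a := by
  set g : Pl K → ℝ := Sum.elim
    (fun φ => Real.log (max 1 (max (InfinitePlace.mk φ δ) ((Finset.range (n + 1)).sup'
      (Finset.nonempty_range_iff.mpr (Nat.succ_ne_zero n)) fun j => InfinitePlace.mk φ (a j)))))
    (fun v => ((max 0 (-(min (ordAt v δ) ((Finset.range (n + 1)).inf'
      (Finset.nonempty_range_iff.mpr (Nat.succ_ne_zero n)) fun j => ordAt v (a j)))) : ℤ) : ℝ) *
        Real.log (Ideal.absNorm v.asIdeal)) with hg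
  have hgf : g.HasFiniteSupport := by
    refine hasFiniteSupport_of_inr ((hasFiniteSupport_inr
      (hasFiniteSupport_lA (n := n) (δ := δ) (a := a))).subset fun P hP h0 => hP ?_)
    have h1 : ∀ x : K, lp (.inr P) x ≤ 0 → 0 ≤ ordAt P x := by
      intro x hx
      rw [lp_inr] at hx
      have := log_absNorm_pos P
      have h2 : ((max 0 (-(ordAt P x)) : ℤ) : ℝ) ≤ 0 := by
        by_contra! h
        nlinarith
      have h3 : max 0 (-(ordAt P x)) ≤ 0 := by exact_mod_cast h2
      have := (le_max_right _ _).trans h3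
      omega
    have h2 : 0 ≤ min (ordAt P δ) ((Finset.range (n + 1)).inf'
      (Finset.nonempty_range_iff.mpr (Nat.succ_ne_zero n)) fun j => ordAt P (a j)) := by
      refine le_min (h1 _ (by rw [← h0]; exact lp_le_lA _)) (Finset.le_inf' _ _ fun j hj => ?_)
      exact h1 _ (by rw [← h0]; exact lp_coeff_le_lA _ (Finset.mem_range_succ_iff.mp hj))
    have h3 : max 0 (-(min (ordAt P δ) ((Finset.range (n + 1)).inf'
      (Finset.nonempty_range_iff.mpr (Nat.succ_ne_zero n)) fun j => ordAt P (a j)))) = 0 :=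
      max_eq_left (by omega)
    simp only [hg, Sum.elim_inr, h3, Int.cast_zero, zero_mul]
  have h1 : Module.finrank ℚ K * hhat n δ a = ∑ᶠ v, g v := by
    rw [hhat, mul_div_cancel₀ _ (finrank_pos_real (K := K)).ne', finsum_split hgf,
      ← sum_embeddings fun w : InfinitePlace K => Real.log (max 1 (max (w δ)
        ((Finset.range (n + 1)).sup'
          (Finset.nonempty_range_iff.mpr (Nat.succ_ne_zero n)) fun j => w (a j))))]
    rfl
  rw [h1]
  refine finsum_le_finsum_of_le hasFiniteSupport_lA hgf fun v => ?_
  cases v with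
  | inl φ =>
    have h2 : ∀ x : K, ‖φ x‖ ≤ max (InfinitePlace.mk φ δ) ((Finset.range (n + 1)).sup'
        (Finset.nonempty_range_iff.mpr (Nat.succ_ne_zero n)) fun j => InfinitePlace.mk φ (a j)) →
        lp (.inl φ) x ≤ g (.inl φ) := by
      intro x hx
      exact Real.log_le_log (by positivity) (max_le_max le_rfl hx)
    refine lA_le (h2 _ (le_max_left _ _)) fun j hj => h2 _ (le_max_of_le_right ?_)
    exact Finset.le_sup' (fun j => InfinitePlace.mk φ (a j)) (Finset.mem_range_succ_iff.mpr hj)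
  | inr P =>
    have h2 : ∀ x : K, min (ordAt P δ) ((Finset.range (n + 1)).inf'
        (Finset.nonempty_range_iff.mpr (Nat.succ_ne_zero n)) fun j => ordAt P (a j)) ≤ ordAt P x →
        lp (.inr P) x ≤ g (.inr P) := by
      intro x hx
      rw [lp_inr]
      refine mul_le_mul_of_nonneg_right ?_ (log_absNorm_pos P).le
      exact_mod_cast max_le_max le_rfl (neg_le_neg hx)
    refine lA_le (h2 _ (min_le_left _ _)) fun j hj => h2 _ (min_le_of_right_le ?_)
    exact Finset.inf'_le (fun j => ordAt P (a j)) (Finset.mem_range_succ_iff.mpr hj)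

variable {K' : Type*} [Field K'] [NumberField K'] [Algebra K K']

lemma lA_algebraMap (w : Pl K') :
    lA n (algebraMap K K' δ) (fun j => algebraMap K K' (a j)) w
      = mlt K w * lA n δ a (res K w) := by
  have h : (0 : ℝ) < mlt K w := by exact_mod_cast mlt_pos w
  apply le_antisymm
  · refine lA_le ?_ fun j hj => ?_ <;> rw [lp_algebraMap] <;> gcongr
    · exact lp_le_lA _
    · exact lp_coeff_le_lA _ hj
  · rw [← le_div_iff₀' h]
    refine lA_le ?_ fun j hj => ?_ <;> rw [le_div_iff₀' h, ← lp_algebraMap]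
    · exact lp_le_lA _
    · exact lp_coeff_le_lA (a := fun j => algebraMap K K' (a j)) _ hj

lemma hA_algebraMap : hA n (algebraMap K K' δ) (fun j => algebraMap K K' (a j))
    = Module.finrank K K' * hA n δ a := by
  rw [hA, hA, ← finsum_res hasFiniteSupport_lA]
  exact finsum_congr fun w => lA_algebraMap w

end Normalization

end HyperellipticBound

namespace HyperellipticBound

section Roots

/-- The value at `x` of `a₀ Xⁿ + ⋯ + aₙ`. -/
def ev {R : Type*} [CommRing R] (n : ℕ) (a : ℕ → R) (x : R) : R :=
  ∑ j ∈ Finset.range (n + 1), a j * x ^ (n - j)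

/-- The value at `x` of the derivative of `a₀ Xⁿ + ⋯ + aₙ`. -/
def dev {R : Type*} [CommRing R] (n : ℕ) (a : ℕ → R) (x : R) : R :=
  ∑ j ∈ Finset.range n, ((n - j : ℕ) : R) * a j * x ^ (n - 1 - j)

variable {K : Type*} [Field K] [NumberField K] {n : ℕ} {δ : K} {a : ℕ → K}

lemma av_coeff_le (v : Pl K) {j : ℕ} (hj : j ≤ n) : av v (a j) ≤ Real.exp (lA n δ a v) :=
  (av_le_exp v _).trans (Real.exp_le_exp.mpr (lp_coeff_le_lA v hj))

lemma av_pow_le (v : Pl K) (x : K) {k m : ℕ} (h : k ≤ m) :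
    av v (x ^ k) ≤ Real.exp (m * lp v x) := by
  rw [map_pow]
  calc av v x ^ k ≤ Real.exp (lp v x) ^ k := pow_le_pow_left₀ (apply_nonneg _ _) (av_le_exp v x) k
    _ ≤ Real.exp (lp v x) ^ m := pow_le_pow_right₀ (Real.one_le_exp (lp_nonneg v x)) h
    _ = _ := by rw [← Real.exp_nat_mul]

lemma lp_le_of_av_le {v : Pl K} {x : K} {c : ℝ} (hc : 0 ≤ c) (h : av v x ≤ Real.exp c) :
    lp v x ≤ c := by
  rw [lp, Real.log_le_iff_le_exp (by positivity)]
  exact max_le (Real.one_le_exp hc) h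

lemma log_nat_nonneg (n : ℕ) : 0 ≤ Real.log n := Real.log_natCast_nonneg n

lemma arch_mul_log_nonneg (v : Pl K) (n : ℕ) : 0 ≤ arch v * Real.log n :=
  mul_nonneg (arch_nonneg v) (log_nat_nonneg n)

lemma lp_ev_le (v : Pl K) (x : K) :
    lp v (ev n a x) ≤ lA n δ a v + n * lp v x + arch v * Real.log (n + 1 : ℕ) := by
  have h0 := lA_nonneg (n := n) (δ := δ) (a := a) v
  have h1 := lp_nonneg v x
  have h2 := arch_mul_log_nonneg v (n + 1)
  refine lp_le_of_av_le (by positivity) ?_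
  refine (av_sum_le v _ _ (B := Real.exp (lA n δ a v + n * lp v x)) (N := (n + 1 : ℕ))
    (by positivity) (by norm_num) (by simp) fun j hj => ?_).trans_eq
    (by rw [← Real.exp_add, add_comm])
  rw [Real.exp_add, map_mul]
  exact mul_le_mul (av_coeff_le v (Finset.mem_range_succ_iff.mp hj)) (av_pow_le v x (by omega))
    (apply_nonneg _ _) (by positivity)

lemma lp_dev_le (hn : 1 ≤ n) (v : Pl K) (x : K) :
    lp v (dev n a x) ≤ lA n δ a v + (n - 1 : ℕ) * lp v x + arch v * (2 * Real.log n) := by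
  have h0 := lA_nonneg (n := n) (δ := δ) (a := a) v
  have h1 := lp_nonneg v x
  have h2 := arch_mul_log_nonneg v n
  have hn' : (1 : ℝ) ≤ n := by exact_mod_cast hn
  refine lp_le_of_av_le (by linarith [mul_nonneg (Nat.cast_nonneg (α := ℝ) (n - 1)) h1]) ?_
  refine (av_sum_le v _ _
    (B := Real.exp (arch v * Real.log n + lA n δ a v + (n - 1 : ℕ) * lp v x)) (N := n)
    (by positivity) hn' (by simp) fun j hj => ?_).trans_eq
    (by rw [← Real.exp_add]; congr 1; ring)
  rw [Finset.mem_range] at hj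
  rw [Real.exp_add, Real.exp_add, map_mul, map_mul]
  refine mul_le_mul (mul_le_mul ?_ (av_coeff_le v hj.le) (apply_nonneg _ _) (by positivity))
    (av_pow_le v x (by omega)) (apply_nonneg _ _) (by positivity)
  exact av_natCast_le v _ hn' (by exact_mod_cast Nat.sub_le _ _)

/-- Cauchy's bound for the roots of a polynomial. -/
lemma lp_root_le (hn : 1 ≤ n) (ha0 : a 0 ≠ 0) {α : K} (hα : ev n a α = 0) (v : Pl K) :
    lp v α ≤ lA n δ a v - lg v (a 0) + arch v * Real.log n := by
  have h0 : lg v (a 0) ≤ lA n δ a v := (lg_le_lp _ _).trans (lp_coeff_le_lA v (Nat.zero_le n))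
  have h2 := arch_mul_log_nonneg v n
  have hn' : (1 : ℝ) ≤ n := by exact_mod_cast hn
  refine lp_le_of_le (by linarith) ?_
  rcases le_or_gt (av v α) 1 with h | h
  · have := Real.log_nonpos (apply_nonneg (av v) α) h
    rw [lg]; linarith
  have hα0 : α ≠ 0 := by rintro rfl; simp at h; linarith
  have hp := av_pos v hα0
  have h3 : av v (a 0 * α ^ n) ≤
      Real.exp (arch v * Real.log n) * (Real.exp (lA n δ a v) * av v α ^ (n - 1)) := by
    have h4 : a 0 * α ^ n = -∑ j ∈ Finset.range n, a (j + 1) * α ^ (n - (j + 1)) := by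
      rw [ev, Finset.sum_range_succ'] at hα
      rw [eq_neg_iff_add_eq_zero, add_comm]; simpa using hα
    rw [h4, AbsoluteValue.map_neg]
    refine av_sum_le v _ _ (by positivity) hn' (by simp) fun j hj => ?_
    rw [Finset.mem_range] at hj
    rw [map_mul, map_pow]
    exact mul_le_mul (av_coeff_le v (by omega)) (pow_le_pow_right₀ h.le (by omega))
      (by positivity) (by positivity)
  rw [map_mul, map_pow] at h3
  have h5 := Real.log_le_log (mul_pos (av_pos v ha0) (pow_pos hp n)) h3
  rw [Real.log_mul (av_pos v ha0).ne' (pow_pos hp n).ne', Real.log_mul (Real.exp_pos _).ne'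
    (by positivity), Real.log_mul (Real.exp_pos _).ne' (by positivity), Real.log_exp, Real.log_exp,
    Real.log_pow, Real.log_pow, Nat.cast_sub hn] at h5
  push_cast at h5
  change lg v (a 0) + n * lg v α ≤ _ + (_ + (_ - 1) * lg v α) at h5
  linarith

lemma ht_le_of_lp_le {x : K} {c : ℝ} {f : Pl K → ℝ} (hf : f.HasFiniteSupport)
    (h : ∀ v, lp v x ≤ f v + arch v * c) : ht x ≤ ∑ᶠ v, f v + Module.finrank ℚ K * c := by
  have h2 : (fun v : Pl K => arch v * c).HasFiniteSupport :=
    hasFiniteSupport_arch.subset fun v hv => by simp at hv ⊢; exact hv.1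
  rw [← finsum_arch, finsum_mul, ← finsum_add_distrib hf h2]
  exact finsum_le_finsum_of_le (hasFiniteSupport_lp x) (hf.add h2) h

lemma ht_ev_le (x : K) : ht (ev n a x) ≤ hA n δ a + n * ht x
    + Module.finrank ℚ K * Real.log (n + 1 : ℕ) := by
  have h2 : (fun v : Pl K => n * lp v x).HasFiniteSupport :=
    (hasFiniteSupport_lp x).subset fun v hv => by simp at hv ⊢; exact hv.2
  have h3 : (n : ℝ) * ht x = ∑ᶠ v : Pl K, (n : ℝ) * lp v x := by rw [ht, mul_finsum]
  rw [hA, h3, ← finsum_add_distrib hasFiniteSupport_lA h2]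
  exact ht_le_of_lp_le (hasFiniteSupport_lA.add h2) fun v => lp_ev_le v x

lemma ht_dev_le (hn : 1 ≤ n) (x : K) : ht (dev n a x) ≤ hA n δ a + (n - 1 : ℕ) * ht x
    + Module.finrank ℚ K * (2 * Real.log n) := by
  have h2 : (fun v : Pl K => (n - 1 : ℕ) * lp v x).HasFiniteSupport :=
    (hasFiniteSupport_lp x).subset fun v hv => by
      simp only [Function.mem_support, ne_eq, mul_eq_zero, not_or] at hv ⊢; exact hv.2
  have h3 : ((n - 1 : ℕ) : ℝ) * ht x = ∑ᶠ v : Pl K, ((n - 1 : ℕ) : ℝ) * lp v x := by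
    rw [ht, mul_finsum]
  rw [hA, h3, ← finsum_add_distrib hasFiniteSupport_lA h2]
  exact ht_le_of_lp_le (hasFiniteSupport_lA.add h2) fun v => lp_dev_le hn v x

lemma ht_root_le (hn : 1 ≤ n) (ha0 : a 0 ≠ 0) {α : K} (hα : ev n a α = 0) :
    ht α ≤ hA n δ a + Module.finrank ℚ K * Real.log n := by
  have h2 : (fun v : Pl K => -lg v (a 0)).HasFiniteSupport :=
    (hasFiniteSupport_lg (a 0)).subset fun v hv => by simpa using hv
  have h3 : ∑ᶠ v : Pl K, -lg v (a 0) = 0 := by rw [finsum_neg_distrib, finsum_lg ha0, neg_zero]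
  rw [hA, ← add_zero (∑ᶠ v, lA n δ a v), ← h3, ← finsum_add_distrib hasFiniteSupport_lA h2]
  exact ht_le_of_lp_le (hasFiniteSupport_lA.add h2) fun v => by
    have := lp_root_le (δ := δ) hn ha0 hα v
    linarith

lemma ht_dev_root_le (hn : 1 ≤ n) (ha0 : a 0 ≠ 0) {α : K} (hα : ev n a α = 0) :
    ht (dev n a α) ≤ n * hA n δ a + Module.finrank ℚ K * ((n + 1) * Real.log n) := by
  have h1 := ht_dev_le (δ := δ) (a := a) hn α
  have h2 := ht_root_le (δ := δ) hn ha0 hα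
  rw [Nat.cast_sub hn] at h1
  push_cast at h1
  have h3 : (1 : ℝ) ≤ n := by exact_mod_cast hn
  have h4 := mul_le_mul_of_nonneg_left h2 (by linarith : (0 : ℝ) ≤ n - 1)
  linarith

end Roots

end HyperellipticBound

namespace HyperellipticBound

section Different

variable {K : Type*} [Field K] [NumberField K]

lemma hasFiniteSupport_cnt {I : Ideal (𝓞 K)} (hI : I ≠ ⊥) :
    (fun P : HeightOneSpectrum (𝓞 K) => cnt P I).HasFiniteSupport :=
  (Filter.eventually_cofinite.mp (Associates.finite_factors hI)).subset
    fun P hP => by simpa [cnt] using hP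

lemma log_absNorm_eq {I : Ideal (𝓞 K)} (hI : I ≠ ⊥) :
    Real.log (Ideal.absNorm I)
      = ∑ᶠ P : HeightOneSpectrum (𝓞 K), cnt P I * Real.log (Ideal.absNorm P.asIdeal) := by
  have hf : (Function.support fun P : HeightOneSpectrum (𝓞 K) => cnt P I).Finite :=
    hasFiniteSupport_cnt hI
  have h1 : ∏ P ∈ hf.toFinset, P.asIdeal ^ cnt P I = I := by
    conv_rhs => rw [← Ideal.finprod_heightOneSpectrum_factorization hI]
    symm
    refine finprod_eq_prod_of_mulSupport_subset _ fun P hP => ?_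
    rw [Set.Finite.coe_toFinset, Function.mem_support]
    rintro h0
    exact hP (by simp only [HeightOneSpectrum.maxPowDividing]; rw [← cnt, h0, pow_zero])
  have h2 := log_absNorm_prod hf.toFinset fun P => cnt P I
  rw [h1] at h2
  rw [h2]
  symm
  refine finsum_eq_sum_of_support_subset _ fun P hP => ?_
  rw [Set.Finite.coe_toFinset, Function.mem_support]
  intro h0
  exact hP (by simp [h0])

lemma one_le_cnt_iff (P : HeightOneSpectrum (𝓞 K)) {I : Ideal (𝓞 K)} (hI : I ≠ ⊥) :
    1 ≤ cnt P I ↔ P.asIdeal ∣ I := by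
  rw [Nat.one_le_iff_ne_zero, cnt]
  exact Associates.count_ne_zero_iff_dvd hI P.irreducible

/-- Integers with prescribed order at one prime, and orders bounded below at all primes. -/
lemma exists_ordAt_eq (k : HeightOneSpectrum (𝓞 K) → ℕ) (hk : (Function.support k).Finite)
    (𝔭 : HeightOneSpectrum (𝓞 K)) : ∃ c : 𝓞 K, c ≠ 0 ∧
      (∀ P : HeightOneSpectrum (𝓞 K), (k P : ℤ) ≤ ordAt P (c : K)) ∧ ordAt 𝔭 (c : K) = k 𝔭 := by
  set I : Ideal (𝓞 K) := ∏ P ∈ hk.toFinset, P.asIdeal ^ k P with hI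
  have hI0 : I ≠ ⊥ := prod_asIdeal_pow_ne_bot _ _
  have hcI (P) : cnt P I = k P := by
    rw [hI, cnt_prod]
    split_ifs with h
    · rfl
    · simpa using (not_congr hk.mem_toFinset |>.mp h : ¬ P ∈ Function.support k) |> fun h => by
        rw [Function.mem_support, not_not] at h; exact h.symm
  have hlt : ¬ I ≤ I * 𝔭.asIdeal := by
    intro h
    have h1 : I * 𝔭.asIdeal = I * 1 := by
      rw [mul_one]; exact le_antisymm (Ideal.mul_le_inf.trans inf_le_left) h
    have h2 := mul_left_cancel₀ hI0 h1
    exact 𝔭.isPrime.ne_top (by rw [h2, Ideal.one_eq_top])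
  obtain ⟨c, hc, hc'⟩ := SetLike.not_le_iff_exists.mp hlt
  have hc0 : c ≠ 0 := by rintro rfl; exact hc' (zero_mem _)
  have hcb : Ideal.span {c} ≠ ⊥ := by simpa using hc0
  obtain ⟨J, hJ⟩ : I ∣ Ideal.span {c} := by
    rw [Ideal.dvd_span_singleton]; exact hc
  have hJ0 : J ≠ ⊥ := by
    rintro rfl
    rw [← Ideal.zero_eq_bot, mul_zero] at hJ
    exact hcb hJ
  refine ⟨c, hc0, fun P => ?_, ?_⟩
  · rw [ordAt_coe P hc0, hJ, cnt_mul P hI0 hJ0, hcI]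
    push_cast; omega
  · rw [ordAt_coe 𝔭 hc0, hJ, cnt_mul 𝔭 hI0 hJ0, hcI]
    have : ¬ 1 ≤ cnt 𝔭 J := by
      rw [one_le_cnt_iff 𝔭 hJ0]
      intro h
      refine hc' ?_
      rw [← Ideal.dvd_span_singleton, hJ]
      exact mul_dvd_mul_left _ h
    push_cast; omega

lemma exists_coe_eq {x : K} (h : ∀ P : HeightOneSpectrum (𝓞 K), 0 ≤ ordAt P x) :
    ∃ y : 𝓞 K, (y : K) = x := by
  rcases eq_or_ne x 0 with rfl | hx
  · exact ⟨0, rfl⟩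
  refine HeightOneSpectrum.mem_integers_of_valuation_le_one K x fun P => ?_
  rw [valuation_eq_exp_ordAt P hx, ← WithZero.exp_zero, WithZero.exp_le_exp]
  have := h P
  omega

lemma ordAt_coe_nonneg (P : HeightOneSpectrum (𝓞 K)) (x : 𝓞 K) : 0 ≤ ordAt P (x : K) := by
  rcases eq_or_ne x 0 with rfl | hx
  · simp [ordAt]
  · rw [ordAt_coe P hx]; positivity

lemma ordAt_pow (P : HeightOneSpectrum (𝓞 K)) {x : K} (hx : x ≠ 0) (k : ℕ) :
    ordAt P (x ^ k) = k * ordAt P x := by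
  induction k with
  | zero => simpa using ordAt_coe P (one_ne_zero (α := 𝓞 K)) |>.trans (by
      rw [Ideal.span_singleton_one]; simpa using cnt_pow P P 0)
  | succ k ih => rw [pow_succ, ordAt_mul P (pow_ne_zero k hx) hx, ih]; push_cast; ring

lemma hasFiniteSupport_ordAt (x : K) :
    (Function.support fun P : HeightOneSpectrum (𝓞 K) => ordAt P x).Finite :=
  (hasFiniteSupport_inr (hasFiniteSupport_lg x)).subset fun P hP => by
    rw [Function.mem_support] at hP ⊢
    rw [lg_inr]
    exact mul_ne_zero (by simpa using hP) (log_absNorm_pos P).ne'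

variable {K' : Type*} [Field K'] [NumberField K'] [Algebra K K']

lemma log_discr_extension :
    Real.log |(discr K' : ℝ)| = Real.log (Ideal.absNorm (differentIdeal (𝓞 K) (𝓞 K')))
      + Module.finrank K K' * Real.log |(discr K : ℝ)| := by
  have h := natAbs_discr_eq_absNorm_differentIdeal_mul_natAbs_discr_pow K (𝓞 K) K' (𝓞 K')
  have h1 : |(discr K' : ℝ)| = Ideal.absNorm (differentIdeal (𝓞 K) (𝓞 K')) *
      |(discr K : ℝ)| ^ Module.finrank K K' := by
    rw [← Int.cast_abs, ← Int.cast_abs, Int.abs_eq_natAbs, Int.abs_eq_natAbs, h]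
    push_cast; rfl
  have h2 : (discr K : ℝ) ≠ 0 := by exact_mod_cast discr_ne_zero K
  have h3 : (discr K' : ℝ) ≠ 0 := by exact_mod_cast discr_ne_zero K'
  have h4 : (Ideal.absNorm (differentIdeal (𝓞 K) (𝓞 K')) : ℝ) ≠ 0 := by
    intro h0
    rw [h0, zero_mul] at h1
    exact h3 (by simpa using h1)
  rw [h1, Real.log_mul h4 (by positivity), Real.log_pow]

open Polynomial in
lemma aeval_derivative_mem_different {θ : 𝓞 K'}
    (hθ : Algebra.adjoin K {(θ : K')} = ⊤) {G : (𝓞 K)[X]} (hG : aeval θ G = 0) :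
    aeval θ (derivative G) ∈ differentIdeal (𝓞 K) (𝓞 K') := by
  have hθ' : Algebra.adjoin K {algebraMap (𝓞 K') K' θ} = ⊤ := hθ
  have h := aeval_derivative_mem_differentIdeal (𝓞 K) K K' θ hθ'
  obtain ⟨H, rfl⟩ := minpoly.isIntegrallyClosed_dvd
    (Algebra.IsIntegral.isIntegral (R := 𝓞 K) θ) hG
  rw [derivative_mul, map_add, map_mul, map_mul, minpoly.aeval, zero_mul, add_zero]
  exact Ideal.mul_mem_right _ _ h

lemma cnt_le_ordAt {I : Ideal (𝓞 K)} (hI : I ≠ ⊥) {x : 𝓞 K} (hx : x ≠ 0) (hxI : x ∈ I)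
    (P : HeightOneSpectrum (𝓞 K)) : (cnt P I : ℤ) ≤ ordAt P (x : K) := by
  obtain ⟨J, hJ⟩ : I ∣ Ideal.span {x} := by rw [Ideal.dvd_span_singleton]; exact hxI
  have hJ0 : J ≠ ⊥ := by
    rintro rfl
    rw [← Ideal.zero_eq_bot, mul_zero] at hJ
    exact hx (by simpa using hJ)
  rw [ordAt_coe P hx, hJ, cnt_mul P hI hJ0]
  push_cast; omega

lemma differentIdeal_ne_bot' : differentIdeal (𝓞 K) (𝓞 K') ≠ ⊥ := by
  intro h
  have h1 := natAbs_discr_eq_absNorm_differentIdeal_mul_natAbs_discr_pow K (𝓞 K) K' (𝓞 K')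
  rw [h, Ideal.absNorm_bot, zero_mul] at h1
  exact discr_ne_zero K' (by simpa using h1)

/-- Bounding the norm of the different by local data. -/
lemma log_absNorm_different_le {g : Pl K' → ℝ} (hg : g.HasFiniteSupport) (hg0 : ∀ v, 0 ≤ g v)
    (h : ∀ P : HeightOneSpectrum (𝓞 K'), cnt P (differentIdeal (𝓞 K) (𝓞 K'))
      * Real.log (Ideal.absNorm P.asIdeal) ≤ g (.inr P)) :
    Real.log (Ideal.absNorm (differentIdeal (𝓞 K) (𝓞 K'))) ≤ ∑ᶠ v, g v := by
  rw [log_absNorm_eq differentIdeal_ne_bot', finsum_split hg]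
  have h1 := finsum_le_finsum_of_le (f := fun P : HeightOneSpectrum (𝓞 K') =>
      (cnt P (differentIdeal (𝓞 K) (𝓞 K')) : ℝ) * Real.log (Ideal.absNorm P.asIdeal))
    ((hasFiniteSupport_cnt (differentIdeal_ne_bot' (K := K))).subset fun P hP => by
      rw [Function.mem_support] at hP ⊢; intro h0; exact hP (by simp [h0]))
    (hasFiniteSupport_inr hg) h
  have h2 : 0 ≤ ∑ φ : K' →+* ℂ, g (.inl φ) := Finset.sum_nonneg fun φ _ => hg0 _
  linarith

end Different

end HyperellipticBound

namespace HyperellipticBound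

section Root

variable {K : Type*} [Field K] [NumberField K] {K' : Type*} [Field K'] [NumberField K']
  [Algebra K K']

lemma exists_integer_of_monic {F E : Type*} [Field F] [Field E] [Algebra F E]
    {θ : E} {G : Polynomial (𝓞 F)} (hm : G.Monic)
    (h : Polynomial.aeval θ G = 0) :
    ∃ η : 𝓞 E, (η : E) = θ ∧ Polynomial.aeval η G = 0 ∧
      ((Polynomial.aeval η (Polynomial.derivative G) : 𝓞 E) : E) =
        Polynomial.aeval θ (Polynomial.derivative G) := by
  have h1 : IsIntegral (𝓞 F) θ := ⟨G, hm, by rwa [Polynomial.aeval_def] at h⟩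
  have h2 : IsIntegral ℤ θ := isIntegral_trans (R := ℤ) (A := 𝓞 F) θ h1
  have h3 := fun H : Polynomial (𝓞 F) =>
    Polynomial.aeval_algebraMap_apply E (show 𝓞 E from ⟨θ, h2⟩) H
  refine ⟨⟨θ, h2⟩, rfl, ?_, (h3 _).symm⟩
  apply RingOfIntegers.coe_injective
  rw [map_zero]
  exact (h3 G).symm.trans h

/-- The monic polynomial satisfied by the multiple `b₀ α` of a root `α` of `∑ bⱼ Xⁿ⁻ʲ`. -/
def monicized {R : Type*} [CommRing R] (m : ℕ) (b : ℕ → R) : Polynomial R :=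
  Polynomial.X ^ (m + 2) + ∑ j ∈ Finset.range (m + 2),
    Polynomial.C (b (j + 1) * b 0 ^ j) * Polynomial.X ^ (m + 1 - j)

lemma monic_monicized {R : Type*} [CommRing R] (m : ℕ) (b : ℕ → R) : (monicized m b).Monic := by
  refine Polynomial.monic_X_pow_add ?_
  refine (Polynomial.degree_sum_le _ _).trans_lt ?_
  rw [Finset.sup_lt_iff (WithBot.bot_lt_coe _)]
  intro j _
  refine (Polynomial.degree_C_mul_X_pow_le _ _).trans_lt ?_
  exact_mod_cast (by omega : m + 1 - j < m + 2)

lemma aeval_monicized {R S : Type*} [CommRing R] [CommRing S] [Algebra R S] (m : ℕ) (b : ℕ → R)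
    (α : S) : Polynomial.aeval (algebraMap R S (b 0) * α) (monicized m b) =
      algebraMap R S (b 0) ^ (m + 1) * ev (m + 2) (fun j => algebraMap R S (b j)) α := by
  rw [monicized, ev, Finset.sum_range_succ' _ (m + 2), mul_add, Finset.mul_sum, map_add, map_sum,
    add_comm]
  congr 1
  · refine Finset.sum_congr rfl fun j hj => ?_
    rw [Finset.mem_range] at hj
    obtain ⟨k, hk⟩ : ∃ k, m + 1 = j + k := ⟨m + 1 - j, by omega⟩
    rw [show m + 1 - j = k by omega, show m + 2 - (j + 1) = k by omega, hk, pow_add]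
    simp only [map_mul, map_pow, Polynomial.aeval_C, Polynomial.aeval_X]
    ring
  · simp; ring

lemma aeval_derivative_monicized {R S : Type*} [CommRing R] [CommRing S] [Algebra R S] (m : ℕ)
    (b : ℕ → R) (α : S) :
    Polynomial.aeval (algebraMap R S (b 0) * α) (Polynomial.derivative (monicized m b)) =
      algebraMap R S (b 0) ^ m * dev (m + 2) (fun j => algebraMap R S (b j)) α := by
  conv_rhs => rw [dev, Finset.sum_range_succ', mul_add, Finset.mul_sum]
  rw [monicized, map_add, map_add, add_comm, Finset.sum_range_succ]
  congr 1
  · simp only [map_add, map_sum, Polynomial.derivative_mul, Polynomial.derivative_C]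
    rw [show m + 1 - (m + 1) = 0 by omega]
    simp only [pow_zero, Polynomial.derivative_one, zero_mul, mul_zero, add_zero, zero_add,
      map_zero]
    refine Finset.sum_congr rfl fun j hj => ?_
    rw [Finset.mem_range] at hj
    obtain ⟨k, rfl⟩ : ∃ k, m = j + k := ⟨m - j, by omega⟩
    rw [show j + k + 1 - j = k + 1 by omega, show j + k + 2 - (j + 1) = k + 1 by omega,
      show j + k + 2 - 1 - (j + 1) = k by omega]
    rw [Polynomial.derivative_X_pow, pow_add]
    simp only [map_mul, map_pow, Polynomial.aeval_C, Polynomial.aeval_X, add_tsub_cancel_right,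
      map_natCast]
    ring
  · simp; ring

variable {n : ℕ} {δ : K} {a : ℕ → K}

/-- Clearing denominators of the coefficients with a multiplier minimal at one prime. -/
lemma exists_denominator (n : ℕ) (δ : K) (a : ℕ → K) (𝔭 : HeightOneSpectrum (𝓞 K)) :
    ∃ (c : K) (b : ℕ → 𝓞 K), c ≠ 0 ∧ (∀ j ≤ n, (b j : K) = c * a j) ∧
      -lg (.inr 𝔭) c ≤ lA n δ a (.inr 𝔭) := by
  set k : HeightOneSpectrum (𝓞 K) → ℕ := fun P =>
    (Finset.range (n + 1)).sup fun j => (-ordAt P (a j)).toNat with hk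
  have hfin : (Function.support k).Finite := by
    refine ((Finset.range (n + 1)).finite_toSet.biUnion
      fun j _ => hasFiniteSupport_ordAt (a j)).subset fun P hP => ?_
    by_contra h
    simp only [Set.mem_iUnion, not_exists, Function.mem_support, not_not] at h
    refine hP ?_
    rw [hk]
    apply Nat.eq_zero_of_le_zero
    refine Finset.sup_le fun j hj => ?_
    rw [h j hj]; simp
  obtain ⟨c, hc0, hc, hc'⟩ := exists_ordAt_eq k hfin 𝔭
  have hcK : (c : K) ≠ 0 := by simpa using hc0
  have hb : ∀ j, ∃ b : 𝓞 K, j ≤ n → (b : K) = c * a j := by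
    intro j
    by_cases hj : j ≤ n
    · obtain ⟨b, hb⟩ := exists_coe_eq (x := (c : K) * a j) fun P => by
        rcases eq_or_ne (a j) 0 with h0 | h0
        · simp [h0, ordAt]
        rw [ordAt_mul P hcK h0]
        have h1 := hc P
        have h2 : (-ordAt P (a j)).toNat ≤ k P :=
          Finset.le_sup (f := fun j => (-ordAt P (a j)).toNat) (Finset.mem_range_succ_iff.mpr hj)
        omega
      exact ⟨b, fun _ => hb⟩
    · exact ⟨0, fun h => absurd h hj⟩
  choose b hb using hb
  refine ⟨c, b, hcK, hb, ?_⟩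
  rw [lg_inr, hc', neg_mul, neg_neg]
  obtain ⟨j, hj, hj'⟩ := Finset.exists_mem_eq_sup (Finset.range (n + 1)) (by simp)
    fun j => (-ordAt 𝔭 (a j)).toNat
  refine le_trans ?_ (lp_coeff_le_lA _ (Finset.mem_range_succ_iff.mp hj))
  rw [lp_inr, hk]
  simp only [hj']
  refine mul_le_mul_of_nonneg_right ?_ (log_absNorm_pos 𝔭).le
  rw [← Int.cast_natCast]
  exact_mod_cast (by omega)

lemma adjoin_mul_eq_top {F E : Type*} [Field F] [Field E] [Algebra F E]
    {α : E} (h : Algebra.adjoin F {α} = ⊤) {c : F} (hc : c ≠ 0) :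
    Algebra.adjoin F {algebraMap F E c * α} = ⊤ := by
  rw [eq_top_iff, ← h]
  refine Algebra.adjoin_le ?_
  rw [Set.singleton_subset_iff]
  have h1 : algebraMap F E c ≠ 0 := by simpa using hc
  have h2 := Subalgebra.smul_mem _ (Algebra.self_mem_adjoin_singleton F (algebraMap F E c * α)) c⁻¹
  rwa [Algebra.smul_def, map_inv₀, ← mul_assoc, inv_mul_cancel₀ h1, one_mul] at h2

/-- The different of the extension generated by a root of `a₀Xⁿ + ⋯ + aₙ`. -/
lemma log_different_root_le (hn : 2 ≤ n) (ha0 : a 0 ≠ 0) {α : K'}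
    (hα : ev n (fun j => algebraMap K K' (a j)) α = 0)
    (hd : dev n (fun j => algebraMap K K' (a j)) α ≠ 0)
    (htop : Algebra.adjoin K {α} = ⊤) :
    Real.log (Ideal.absNorm (differentIdeal (𝓞 K) (𝓞 K'))) ≤
      (n + 1) * hA n (algebraMap K K' δ) (fun j => algebraMap K K' (a j))
        + Module.finrank ℚ K' * ((n + 1) * Real.log n) := by
  set a' : ℕ → K' := fun j => algebraMap K K' (a j) with ha'
  set δ' := algebraMap K K' δ with hδ'
  have ha0' : a' 0 ≠ 0 := by simpa [ha'] using ha0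
  obtain ⟨m, rfl⟩ : ∃ m, n = m + 2 := ⟨n - 2, by omega⟩
  set g : Pl K' → ℝ := fun v => ((m + 2 : ℕ) * lA (m + 2) δ' a' v + lp v (a' 0)⁻¹
    + arch v * ((m + 3) * Real.log (m + 2 : ℕ))) + (-m * lg v (a' 0) + -lg v (dev (m + 2) a' α))
    with hg
  have f1 : (fun v : Pl K' => ((m + 2 : ℕ) : ℝ) * lA (m + 2) δ' a' v).HasFiniteSupport :=
    (hasFiniteSupport_lA (n := m + 2) (δ := δ') (a := a')).subset fun v hv => by
      simp only [Function.mem_support, ne_eq, mul_eq_zero, not_or] at hv ⊢; exact hv.2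
  have f2 := hasFiniteSupport_lp (a' 0)⁻¹
  have f3 : (fun v : Pl K' => arch v * ((m + 3) * Real.log (m + 2 : ℕ))).HasFiniteSupport :=
    hasFiniteSupport_arch.subset fun v hv => by
      simp only [Function.mem_support, ne_eq, mul_eq_zero, not_or] at hv ⊢; exact hv.1
  have f4 : (fun v : Pl K' => -m * lg v (a' 0)).HasFiniteSupport :=
    (hasFiniteSupport_lg (a' 0)).subset fun v hv => by
      simp only [Function.mem_support, ne_eq, mul_eq_zero, not_or] at hv ⊢; exact hv.2
  have f5 : (fun v : Pl K' => -lg v (dev (m + 2) a' α)).HasFiniteSupport :=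
    (hasFiniteSupport_lg (dev (m + 2) a' α)).subset fun v hv => by
      simpa only [Function.mem_support, ne_eq, neg_eq_zero] using hv
  have hgf : g.HasFiniteSupport := ((f1.add f2).add f3).add (f4.add f5)
  have hsum : ∑ᶠ v, g v ≤ ((m + 2 : ℕ) + 1) * hA (m + 2) δ' a'
        + Module.finrank ℚ K' * (((m + 2 : ℕ) + 1) * Real.log (m + 2 : ℕ)) := by
    have f12 : (fun v : Pl K' => ((m + 2 : ℕ) : ℝ) * lA (m + 2) δ' a' v
        + lp v (a' 0)⁻¹).HasFiniteSupport := f1.add f2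
    have f123 : (fun v : Pl K' => ((m + 2 : ℕ) : ℝ) * lA (m + 2) δ' a' v + lp v (a' 0)⁻¹
        + arch v * ((m + 3) * Real.log (m + 2 : ℕ))).HasFiniteSupport := f12.add f3
    have f45 : (fun v : Pl K' => -m * lg v (a' 0) + -lg v (dev (m + 2) a' α)).HasFiniteSupport :=
      f4.add f5
    rw [hg, finsum_add_distrib f123 f45, finsum_add_distrib f12 f3, finsum_add_distrib f1 f2,
      finsum_add_distrib f4 f5,
      ← mul_finsum, ← mul_finsum, finsum_neg_distrib, finsum_lg ha0', finsum_lg hd, ← finsum_mul,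
      finsum_arch]
    have h1 : ∑ᶠ v : Pl K', lp v (a' 0)⁻¹ ≤ hA (m + 2) δ' a' := by
      change ht (a' 0)⁻¹ ≤ _
      rw [ht_inv]; exact ht_coeff_le_hA (Nat.zero_le _)
    change ((m + 2 : ℕ) : ℝ) * hA (m + 2) δ' a' + _ + _ + _ ≤ _
    push_cast at h1 ⊢
    linarith
  have hpos : ∀ v, 0 ≤ g v := by
    intro v
    have h1 := (lg_le_lp v _).trans (lp_dev_le (n := m + 2) (δ := δ') (a := a') (by omega) v α)
    have h2 := lp_root_le (δ := δ') (by omega : 1 ≤ m + 2) ha0' hα v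
    have h3 := lp_sub_lp_inv v (a' 0)
    have h4 := lp_nonneg v (a' 0)
    have h5 := mul_le_mul_of_nonneg_left h2 (by positivity : (0 : ℝ) ≤ m + 1)
    simp only [hg]
    push_cast at h1 h5 ⊢
    nlinarith
  refine (log_absNorm_different_le hgf hpos fun P => ?_).trans hsum
  obtain ⟨c, b, hc0, hb, hc⟩ := exists_denominator (m + 2) δ a (P.under (𝓞 K))
  have hb0 : (b 0 : K) ≠ 0 := by rw [hb 0 (by omega)]; exact mul_ne_zero hc0 ha0
  have hbα : algebraMap (𝓞 K) K' (b 0) = algebraMap K K' (b 0 : K) := rfl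
  have hev : ∀ j ≤ m + 2, algebraMap (𝓞 K) K' (b j) = algebraMap K K' c * a' j := by
    intro j hj
    change algebraMap K K' (b j : K) = _
    rw [hb j hj, map_mul]
  have hE : ev (m + 2) (fun j => algebraMap (𝓞 K) K' (b j)) α = 0 := by
    have : ev (m + 2) (fun j => algebraMap (𝓞 K) K' (b j)) α
        = algebraMap K K' c * ev (m + 2) a' α := by
      rw [ev, ev, Finset.mul_sum]
      refine Finset.sum_congr rfl fun j hj => ?_
      rw [hev j (Finset.mem_range_succ_iff.mp hj), mul_assoc]
    rw [this, hα, mul_zero]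
  have hD : dev (m + 2) (fun j => algebraMap (𝓞 K) K' (b j)) α
        = algebraMap K K' c * dev (m + 2) a' α := by
    rw [dev, dev, Finset.mul_sum]
    refine Finset.sum_congr rfl fun j hj => ?_
    rw [hev j (Finset.mem_range.mp hj).le]
    ring
  have h0 := aeval_monicized m b α
  rw [hE, mul_zero] at h0
  obtain ⟨η, hη, hη0, hηd⟩ := exists_integer_of_monic (monic_monicized m b) h0
  have hmem := aeval_derivative_mem_different (K := K) (θ := η)
    (by rw [hη]; exact adjoin_mul_eq_top htop hb0) hη0
  set z := Polynomial.aeval η (Polynomial.derivative (monicized m b)) with hz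
  have hc0' : algebraMap K K' c ≠ 0 := by simpa using hc0
  have hzK : (z : K') = algebraMap K K' c ^ (m + 1) * a' 0 ^ m * dev (m + 2) a' α := by
    rw [hηd, aeval_derivative_monicized, hD, hev 0 (by omega)]
    ring
  have hzK0 : (z : K') ≠ 0 := by
    rw [hzK]
    exact mul_ne_zero (mul_ne_zero (pow_ne_zero _ hc0') (pow_ne_zero _ ha0')) hd
  have hz0 : z ≠ 0 := by intro h; rw [h] at hzK0; exact hzK0 rfl
  have h1 : (cnt P (differentIdeal (𝓞 K) (𝓞 K')) : ℝ) ≤ (ordAt P (z : K') : ℝ) := by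
    exact_mod_cast cnt_le_ordAt differentIdeal_ne_bot' hz0 hmem P
  refine (mul_le_mul_of_nonneg_right h1 (log_absNorm_pos P).le).trans ?_
  have h2 := lg_inr P (z : K')
  rw [hzK, lg_mul _ (mul_ne_zero (pow_ne_zero _ hc0') (pow_ne_zero _ ha0')) hd,
    lg_mul _ (pow_ne_zero _ hc0') (pow_ne_zero _ ha0'), lg_pow, lg_pow, ← hzK] at h2
  have h3 : -lg (.inr P) (algebraMap K K' c) ≤ lA (m + 2) δ' a' (.inr P) := by
    rw [hδ', ha', lA_algebraMap, lg_algebraMap, res_inr, ← mul_neg]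
    exact mul_le_mul_of_nonneg_left hc (by positivity)
  have h4 := lp_nonneg (.inr P) (a' 0)⁻¹
  have h5 := mul_le_mul_of_nonneg_left h3 (by positivity : (0 : ℝ) ≤ m + 1)
  have h6 := lA_nonneg (n := m + 2) (δ := δ') (a := a') (.inr P)
  have h7 : 0 ≤ arch (.inr P : Pl K') * ((m + 3) * Real.log (m + 2 : ℕ)) :=
    mul_nonneg (arch_nonneg _) (mul_nonneg (by positivity) (log_nat_nonneg _))
  simp only [hg]
  push_cast at h2 h5 ⊢
  push_cast at h7
  linarith

end Root

end HyperellipticBound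

namespace HyperellipticBound

section Sqrt

variable {K : Type*} [Field K] [NumberField K] {K' : Type*} [Field K'] [NumberField K']
  [Algebra K K']

/-- Multiplying by a square to make an element integral, and nearly a unit at one prime. -/
lemma exists_sq_mul_integer {γ : K} (hγ : γ ≠ 0) (𝔭 : HeightOneSpectrum (𝓞 K)) :
    ∃ (c : K) (g : 𝓞 K), c ≠ 0 ∧ (g : K) = c ^ 2 * γ ∧
      2 * ordAt 𝔭 c + ordAt 𝔭 γ ≤ (if Odd (ordAt 𝔭 γ) then 1 else 0) := by
  obtain ⟨p, q, hq, hpq⟩ := IsFractionRing.div_surjective (A := 𝓞 K) γ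
  have hq0 : q ≠ 0 := nonZeroDivisors.ne_zero hq
  have hqK : (q : K) ≠ 0 := by simpa using hq0
  have hpK : (p : K) ≠ 0 := by
    intro h
    apply hγ
    rw [← hpq]
    change (p : K) / (q : K) = 0
    rw [h, zero_div]
  have hγ' : ∀ P : HeightOneSpectrum (𝓞 K), ordAt P γ = ordAt P (p : K) - ordAt P (q : K) := by
    intro P
    rw [← hpq]
    change ordAt P ((p : K) / (q : K)) = _
    rw [div_eq_mul_inv, ordAt_mul P hpK (inv_ne_zero hqK), ordAt_inv]
    ring
  set k : HeightOneSpectrum (𝓞 K) → ℕ := fun P =>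
    ((2 * ordAt P (p : K) - ordAt P γ + 1) / 2).toNat with hk
  have hfin : (Function.support k).Finite := by
    refine ((hasFiniteSupport_ordAt (p : K)).union (hasFiniteSupport_ordAt γ)).subset
      fun P hP => ?_
    by_contra h
    simp only [Set.mem_union, Function.mem_support, not_or, not_not] at h
    refine hP ?_
    simp [hk, h.1, h.2]
  obtain ⟨d, hd0, hd, hd'⟩ := exists_ordAt_eq k hfin 𝔭
  have hdK : (d : K) ≠ 0 := by simpa using hd0
  have hc0 : (d : K) * (p : K)⁻¹ ≠ 0 := mul_ne_zero hdK (inv_ne_zero hpK)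
  have hc : ∀ P, ordAt P ((d : K) * (p : K)⁻¹) = ordAt P (d : K) - ordAt P (p : K) := by
    intro P
    rw [ordAt_mul P hdK (inv_ne_zero hpK), ordAt_inv]; ring
  have hkk : ∀ P, (k P : ℤ) = (2 * ordAt P (p : K) - ordAt P γ + 1) / 2 := by
    intro P
    have h1 := ordAt_coe_nonneg P p
    have h2 := ordAt_coe_nonneg P q
    have h3 := hγ' P
    rw [hk]
    simp only
    rw [Int.toNat_of_nonneg]
    omega
  obtain ⟨g, hg⟩ := exists_coe_eq (x := ((d : K) * (p : K)⁻¹) ^ 2 * γ) fun P => by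
    rw [ordAt_mul P (pow_ne_zero 2 hc0) hγ, ordAt_pow P hc0, hc]
    have h1 := hd P
    rw [hkk] at h1
    push_cast
    omega
  refine ⟨_, g, hc0, hg, ?_⟩
  rw [hc, hd', hkk]
  split_ifs with h
  · omega
  · rw [Int.not_odd_iff_even] at h
    obtain ⟨r, hr⟩ := h
    omega

/-- The different of the extension generated by a square root of `γ`. -/
lemma log_different_sqrt_le {γ : K} (hγ : γ ≠ 0) {t : K'} (ht : t ^ 2 = algebraMap K K' γ)
    (htop : Algebra.adjoin K {t} = ⊤) {h : Pl K → ℝ} (hf : h.HasFiniteSupport)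
    (h0 : ∀ v, 0 ≤ h v)
    (hodd : ∀ P : HeightOneSpectrum (𝓞 K), Odd (ordAt P γ) →
      Real.log (Ideal.absNorm P.asIdeal) ≤ h (.inr P)) :
    Real.log (Ideal.absNorm (differentIdeal (𝓞 K) (𝓞 K'))) ≤
      Module.finrank ℚ K' * Real.log 2 + Module.finrank K K' * (∑ᶠ v, h v) / 2 := by
  set g : Pl K' → ℝ := fun w => (arch w * Real.log 2 + -lg w 2)
    + (1 / 2) * (mlt K w * h (res K w)) with hg
  have f1 : (fun w : Pl K' => arch w * Real.log 2).HasFiniteSupport :=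
    hasFiniteSupport_arch.subset fun v hv => by
      simp only [Function.mem_support, ne_eq, mul_eq_zero, not_or] at hv ⊢; exact hv.1
  have f2 : (fun w : Pl K' => -lg w 2).HasFiniteSupport :=
    (hasFiniteSupport_lg 2).subset fun v hv => by
      simpa only [Function.mem_support, ne_eq, neg_eq_zero] using hv
  have f3 : (fun w : Pl K' => (1 / 2) * (mlt K w * h (res K w))).HasFiniteSupport :=
    (hasFiniteSupport_res hf).subset fun v hv => by
      simp only [Function.mem_support, ne_eq] at hv ⊢
      exact fun h => hv (by rw [h, mul_zero])
  have f12 : (fun w : Pl K' => arch w * Real.log 2 + -lg w 2).HasFiniteSupport := f1.add f2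
  have hgf : g.HasFiniteSupport := f12.add f3
  have hsum : ∑ᶠ w, g w = Module.finrank ℚ K' * Real.log 2
      + Module.finrank K K' * (∑ᶠ v, h v) / 2 := by
    rw [hg, finsum_add_distrib f12 f3, finsum_add_distrib f1 f2, ← mul_finsum, finsum_res hf,
      finsum_neg_distrib, finsum_lg two_ne_zero, ← finsum_mul, finsum_arch]
    ring
  have h2 : ∀ w : Pl K', lg w 2 ≤ arch w * Real.log 2 := by
    intro w
    have := av_natCast_le w 2 (B := 2) (by norm_num) (by norm_num)
    have h3 := Real.log_le_log (av_pos w (by norm_num : ((2 : ℕ) : K') ≠ 0)) this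
    rw [Real.log_exp] at h3
    simpa [lg] using h3
  have h3 : ∀ w : Pl K', 0 ≤ (mlt K w : ℝ) * h (res K w) := fun w =>
    mul_nonneg (Nat.cast_nonneg _) (h0 _)
  refine (log_absNorm_different_le hgf (fun w => ?_) fun P => ?_).trans hsum.le
  · have := h2 w
    have := h3 w
    simp only [hg]
    linarith
  obtain ⟨c, b, hc0, hb, hc⟩ := exists_sq_mul_integer hγ (P.under (𝓞 K))
  have hc0' : algebraMap K K' c ≠ 0 := by simpa using hc0
  have ht0 : t ≠ 0 := by
    rintro rfl
    rw [zero_pow two_ne_zero] at ht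
    exact hγ (by simpa using ht.symm)
  have hb' : algebraMap (𝓞 K) K' b = algebraMap K K' c ^ 2 * t ^ 2 := by
    change algebraMap K K' (b : K) = _
    rw [hb, ht, map_mul, map_pow]
  obtain ⟨η, hη, hη0, hηd⟩ := exists_integer_of_monic (F := K) (E := K')
    (θ := algebraMap K K' c * t) (G := Polynomial.X ^ 2 - Polynomial.C b)
    (Polynomial.monic_X_pow_sub_C b two_ne_zero) (by
      simp only [map_sub, map_pow, Polynomial.aeval_X, Polynomial.aeval_C, hb']
      ring)
  have hmem := aeval_derivative_mem_different (K := K) (θ := η)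
    (by rw [hη]; exact adjoin_mul_eq_top htop hc0) hη0
  set z := Polynomial.aeval η (Polynomial.derivative (Polynomial.X ^ 2 - Polynomial.C b)) with hz
  have hzK : (z : K') = 2 * (algebraMap K K' c * t) := by
    rw [hηd]; simp [one_add_one_eq_two]; exact Or.inl (map_ofNat (algebraMap (𝓞 K) K') 2)
  have hzK0 : (z : K') ≠ 0 := by
    rw [hzK]
    exact mul_ne_zero two_ne_zero (mul_ne_zero hc0' ht0)
  have hz0 : z ≠ 0 := by intro h; rw [h] at hzK0; exact hzK0 rfl
  have h4 : (cnt P (differentIdeal (𝓞 K) (𝓞 K')) : ℝ) ≤ (ordAt P (z : K') : ℝ) := by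
    exact_mod_cast cnt_le_ordAt differentIdeal_ne_bot' hz0 hmem P
  refine (mul_le_mul_of_nonneg_right h4 (log_absNorm_pos P).le).trans ?_
  have h5 := lg_inr P (z : K')
  rw [hzK, lg_mul _ two_ne_zero (mul_ne_zero hc0' ht0), ← hzK] at h5
  have h6 : 2 * lg (.inr P) (algebraMap K K' c * t) =
      mlt K (.inr P : Pl K') * lg (.inr (P.under (𝓞 K))) (c ^ 2 * γ) := by
    rw [← res_inr, ← lg_algebraMap, map_mul, map_pow, ← ht, ← mul_pow, lg_pow]
    norm_num
  have h7 : -lg (.inr (P.under (𝓞 K))) (c ^ 2 * γ) ≤ h (.inr (P.under (𝓞 K))) := by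
    rw [lg_inr, ordAt_mul _ (pow_ne_zero 2 hc0) hγ, ordAt_pow _ hc0, neg_mul, neg_neg]
    have h8 := log_absNorm_pos (P.under (𝓞 K))
    split_ifs at hc with ho
    · refine le_trans ?_ (hodd _ ho)
      have : ((2 * ordAt (P.under (𝓞 K)) c + ordAt (P.under (𝓞 K)) γ : ℤ) : ℝ) ≤ 1 := by
        exact_mod_cast hc
      push_cast at this ⊢
      nlinarith
    · refine le_trans ?_ (h0 _)
      have : ((2 * ordAt (P.under (𝓞 K)) c + ordAt (P.under (𝓞 K)) γ : ℤ) : ℝ) ≤ 0 := by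
        exact_mod_cast hc
      push_cast at this ⊢
      exact mul_nonpos_of_nonpos_of_nonneg this h8.le
  have h8 := mul_le_mul_of_nonneg_left h7 (Nat.cast_nonneg (α := ℝ) (mlt K (.inr P : Pl K')))
  have h9 := mul_nonneg (arch_nonneg (.inr P : Pl K')) (Real.log_nonneg one_le_two)
  simp only [hg, res_inr]
  linarith

end Sqrt

end HyperellipticBound

namespace HyperellipticBound

section Poly

variable {R : Type*} [CommRing R]

/-- The polynomial `a₀ Xⁿ + ⋯ + aₙ`. -/
def toPoly (n : ℕ) (a : ℕ → R) : Polynomial R :=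
  ∑ j ∈ Finset.range (n + 1), Polynomial.C (a j) * Polynomial.X ^ (n - j)

variable (n : ℕ) (a : ℕ → R)

lemma eval_toPoly (x : R) : (toPoly n a).eval x = ev n a x := by
  simp [toPoly, ev, Polynomial.eval_finsetSum]

lemma map_toPoly {S : Type*} [CommRing S] (f : R →+* S) :
    (toPoly n a).map f = toPoly n (fun j => f (a j)) := by
  simp [toPoly, Polynomial.map_sum]

lemma map_ev {S : Type*} [CommRing S] (f : R →+* S) (x : R) :
    f (ev n a x) = ev n (fun j => f (a j)) (f x) := by
  simp [ev]

lemma map_dev {S : Type*} [CommRing S] (f : R →+* S) (x : R) :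
    f (dev n a x) = dev n (fun j => f (a j)) (f x) := by
  simp [dev]

lemma eval_derivative_toPoly (x : R) : (toPoly n a).derivative.eval x = dev n a x := by
  rw [toPoly, Finset.sum_range_succ, map_add, map_sum, Polynomial.eval_add,
    Polynomial.eval_finsetSum, dev]
  simp only [Nat.sub_self, pow_zero, mul_one, Polynomial.derivative_C, Polynomial.eval_zero,
    add_zero]
  refine Finset.sum_congr rfl fun j _ => ?_
  simp only [Polynomial.derivative_mul, Polynomial.derivative_C, Polynomial.derivative_X_pow,
    Polynomial.eval_mul, Polynomial.eval_C, Polynomial.eval_X, Polynomial.eval_pow, zero_mul,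
    zero_add]
  rw [show n - j - 1 = n - 1 - j by omega]
  ring

lemma coeff_toPoly_self : (toPoly n a).coeff n = a 0 := by
  rw [toPoly, Polynomial.finsetSum_coeff, Finset.sum_eq_single 0]
  · simp
  · intro j hj h0
    rw [Polynomial.coeff_C_mul_X_pow, if_neg]
    have := Finset.mem_range.mp hj
    omega
  · simp

lemma natDegree_toPoly_le : (toPoly n a).natDegree ≤ n :=
  Polynomial.natDegree_sum_le_of_forall_le _ _ fun j _ =>
    (Polynomial.natDegree_C_mul_X_pow_le _ _).trans (Nat.sub_le n j)

lemma natDegree_toPoly (h : a 0 ≠ 0) : (toPoly n a).natDegree = n :=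
  le_antisymm (natDegree_toPoly_le n a)
    (Polynomial.le_natDegree_of_ne_zero (by rwa [coeff_toPoly_self]))

lemma toPoly_ne_zero (h : a 0 ≠ 0) : toPoly n a ≠ 0 := fun h0 => h (by
  rw [← coeff_toPoly_self n a, h0, Polynomial.coeff_zero])

lemma exists_taylor (α e : R) : ∃ k, ev n a (α + e) = ev n a α + dev n a α * e + k * e ^ 2 := by
  obtain ⟨k, hk⟩ := Polynomial.binomExpansion (toPoly n a) α e
  exact ⟨k, by rw [← eval_toPoly, ← eval_toPoly, ← eval_derivative_toPoly, hk]⟩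

lemma map_binDisc {S : Type*} [CommRing S] (f : R →+* S) :
    f (binDisc n a) = binDisc n (fun j => f (a j)) := by
  rw [binDisc, binDisc, RingHom.map_det]
  congr 1
  ext i j
  simp only [discMat, RingHom.mapMatrix_apply, Matrix.map_apply]
  split_ifs <;> simp

variable {n a}

lemma sum_shift {m N i : ℕ} (h : i + m < N) (f g : ℕ → R) :
    ∑ j ∈ Finset.range N, (if i ≤ j ∧ j ≤ i + m then f (j - i) else 0) * g j =
      ∑ k ∈ Finset.range (m + 1), f k * g (i + k) := by
  simp only [ite_mul, zero_mul]
  rw [← Finset.sum_filter]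
  refine Finset.sum_nbij' (fun j => j - i) (fun k => i + k) ?_ ?_ ?_ ?_ ?_
  · intro j hj
    simp only [Finset.mem_filter, Finset.mem_range] at hj ⊢
    omega
  · intro j hj
    simp only [Finset.mem_filter, Finset.mem_range] at hj ⊢
    omega
  · intro j hj
    simp only [Finset.mem_filter, Finset.mem_range] at hj ⊢
    omega
  · intro j hj
    simp
  · intro j hj
    simp only [Finset.mem_filter, Finset.mem_range] at hj ⊢
    rw [show i + (j - i) = j by omega]

/-- If the discriminant is nonzero then every root is simple. -/
lemma dev_ne_zero_of_binDisc {K : Type*} [Field K] {a : ℕ → K} (hn : 2 ≤ n)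
    (hd : binDisc n a ≠ 0) {α : K} (hα : ev n a α = 0) : dev n a α ≠ 0 := by
  intro hα'
  apply hd
  rw [binDisc, ← Matrix.exists_mulVec_eq_zero_iff]
  refine ⟨fun j => α ^ (2 * n - 3 - (j : ℕ)), fun h => ?_, ?_⟩
  · have := congrFun h ⟨2 * n - 3, by omega⟩
    simp at this
  ext i
  simp only [Matrix.mulVec, dotProduct, discMat, Pi.zero_apply]
  have hi := i.2
  split_ifs with h1 h2
  · rw [Fin.sum_univ_eq_sum_range (fun j => (if (i : ℕ) ≤ j ∧ j ≤ (i : ℕ) + n then a (j - i) else 0)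
      * α ^ (2 * n - 3 - j)), sum_shift (by omega) a]
    trans α ^ (n - 3 - i) * ev n a α
    · rw [ev, Finset.mul_sum]
      refine Finset.sum_congr rfl fun j hj => ?_
      have := Finset.mem_range.mp hj
      rw [show 2 * n - 3 - (i + j) = (n - 3 - i) + (n - j) by omega, pow_add]
      ring
    · rw [hα, mul_zero]
  · rw [Fin.sum_univ_eq_sum_range (fun j => (if j + 1 ≤ n then ((j + 1 : ℕ) : K) * a (j + 1) else 0)
      * α ^ (2 * n - 3 - j))]
    have h3 := sum_shift (m := n - 1) (N := 2 * n - 2) (i := 0) (by omega)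
      (fun j => ((j + 1 : ℕ) : K) * a (j + 1)) (fun j => α ^ (2 * n - 3 - j))
    trans α ^ (n - 2) * (n * ev n a α - α * dev n a α)
    · convert h3 using 1
      · refine Finset.sum_congr rfl fun j _ => ?_
        congr 1
        refine if_congr (by omega) (by simp) rfl
      · have h4 : α * dev n a α = ∑ j ∈ Finset.range (n + 1),
            ((n - j : ℕ) : K) * a j * α ^ (n - j) := by
          rw [Finset.sum_range_succ, Nat.sub_self, Nat.cast_zero, zero_mul, zero_mul, add_zero,
            dev, Finset.mul_sum]
          refine Finset.sum_congr rfl fun j hj => ?_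
          have := Finset.mem_range.mp hj
          rw [show n - j = (n - 1 - j) + 1 by omega, pow_succ]
          ring
        rw [h4, ev, Finset.mul_sum, ← Finset.sum_sub_distrib, Finset.sum_range_succ',
          Nat.sub_add_cancel (by omega), mul_add, Finset.mul_sum]
        rw [Nat.sub_zero, ← mul_assoc, sub_self, mul_zero, add_zero]
        refine Finset.sum_congr rfl fun j hj => ?_
        have := Finset.mem_range.mp hj
        rw [show 2 * n - 3 - (0 + j) = (n - 2) + (n - (j + 1)) by omega, pow_add,
          Nat.cast_sub (by omega : j + 1 ≤ n)]
        ring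
    · rw [hα, hα']; ring
  · rw [Fin.sum_univ_eq_sum_range (fun j => (if (i : ℕ) - (n - 1) ≤ j ∧
      j ≤ (i : ℕ) - (n - 1) + (n - 1)
      then ((n - (j - ((i : ℕ) - (n - 1))) : ℕ) : K) * a (j - ((i : ℕ) - (n - 1)))
      else 0) * α ^ (2 * n - 3 - j)), sum_shift (by omega) (fun k => ((n - k : ℕ) : K) * a k),
      Nat.sub_add_cancel (by omega)]
    trans α ^ (n - 2 - (i - (n - 1))) * dev n a α
    · rw [dev, Finset.mul_sum]
      refine Finset.sum_congr rfl fun j hj => ?_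
      have := Finset.mem_range.mp hj
      rw [show 2 * n - 3 - (i - (n - 1) + j) = (n - 2 - (i - (n - 1))) + (n - 1 - j) by omega,
        pow_add]
      ring
    · rw [hα', mul_zero]

end Poly

/-- Every polynomial of degree between `1` and `k` over a number field has a root generating an
extension of degree at most `k`. -/
lemma exists_extension {K : Type} [Field K] [NumberField K] {f : Polynomial K} {k : ℕ}
    (h1 : f.natDegree ≠ 0) (h2 : f.natDegree ≤ k) :
    ∃ (K' : Type) (_ : Field K') (_ : NumberField K') (_ : Algebra K K') (α : K'),
      Polynomial.aeval α f = 0 ∧ Algebra.adjoin K {α} = ⊤ ∧ Module.finrank K K' ≤ k := by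
  obtain ⟨g, hg, hgf⟩ := Polynomial.exists_irreducible_of_natDegree_ne_zero h1
  have : Fact (Irreducible g) := ⟨hg⟩
  have hf : f ≠ 0 := by rintro rfl; simp at h1
  have : FiniteDimensional K (AdjoinRoot g) := (AdjoinRoot.powerBasis hg.ne_zero).finite
  have : CharZero (AdjoinRoot g) := charZero_of_injective_algebraMap (algebraMap K _).injective
  have : FiniteDimensional ℚ (AdjoinRoot g) := Module.Finite.trans K _
  refine ⟨AdjoinRoot g, inferInstance, ⟨⟩, inferInstance, AdjoinRoot.root g, ?_,
    AdjoinRoot.adjoinRoot_eq_top, ?_⟩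
  · obtain ⟨c, rfl⟩ := hgf
    rw [map_mul, AdjoinRoot.aeval_eq, AdjoinRoot.mk_self, zero_mul]
  · rw [(AdjoinRoot.powerBasis hg.ne_zero).finrank, AdjoinRoot.powerBasis_dim]
    exact (Polynomial.natDegree_le_of_dvd hgf hf).trans h2

end HyperellipticBound

namespace HyperellipticBound

/-- A hyperelliptic equation over the `T`-integers of `K` together with a solution; the real
parameters bound the invariants of `K`, `T` and the equation relative to the degree of `K`. -/
structure Eqn (K : Type) [Field K] [NumberField K] (T : Finset (HeightOneSpectrum (𝓞 K)))
    (n : ℕ) (a : ℕ → K) (δ x y : K) (N d t r ρ q h X Y : ℝ) : Prop where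
  hn : 3 ≤ n
  ha0 : a 0 ≠ 0
  hδ0 : δ ≠ 0
  hy0 : y ≠ 0
  hdisc : binDisc n a ≠ 0
  haT : ∀ j ≤ n, ∀ P ∉ T, 0 ≤ ordAt P (a j)
  hδT : ∀ P ∉ T, 0 ≤ ordAt P δ
  hxT : ∀ P ∉ T, 0 ≤ ordAt P x
  heq : ev n a x = δ * y ^ 2
  hN : Module.finrank ℚ K ≤ N * d
  hNt : T.card ≤ N * t
  hNr : Fintype.card (InfinitePlace K) ≤ N * r
  hρ : Real.log |(discr K : ℝ)| ≤ Module.finrank ℚ K * ρ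
  hq : ∑ P ∈ T, Real.log (Ideal.absNorm P.asIdeal) ≤ Module.finrank ℚ K * q
  hh : hA n δ a ≤ Module.finrank ℚ K * h
  hX : ht x = Module.finrank ℚ K * X
  hY : ht y = Module.finrank ℚ K * Y

variable {K : Type} [Field K] [NumberField K] {T : Finset (HeightOneSpectrum (𝓞 K))}
    {n : ℕ} {a : ℕ → K} {δ x y : K} {N d t r ρ q h X Y : ℝ}

lemma card_infinitePlace_extension_le (K : Type*) [Field K] [NumberField K]
    (K' : Type*) [Field K'] [NumberField K'] [Algebra K K'] :
    Fintype.card (InfinitePlace K') ≤ Module.finrank K K' * Fintype.card (InfinitePlace K) := by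
  rw [← Finset.card_univ, ← Finset.card_univ]
  refine Finset.card_le_mul_card_image_of_maps_to (f := fun w => w.comap (algebraMap K K'))
    (fun _ _ => Finset.mem_univ _) _ fun v _ => ?_
  rw [← card_extensions (K' := K') v.embedding]
  refine (Finset.card_le_card fun w hw => ?_).trans (Finset.card_image_le (f := InfinitePlace.mk))
  rw [Finset.mem_filter] at hw
  rw [Finset.mem_image]
  have h1 : InfinitePlace.mk (w.embedding.comp (algebraMap K K')) =
      InfinitePlace.mk v.embedding := by
    rw [InfinitePlace.mk_embedding, ← hw.2, ← InfinitePlace.comap_mk, InfinitePlace.mk_embedding]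
  rcases InfinitePlace.mk_eq_iff.mp h1 with h2 | h2
  · exact ⟨w.embedding, by simpa using h2, InfinitePlace.mk_embedding w⟩
  · refine ⟨ComplexEmbedding.conjugate w.embedding, ?_, ?_⟩
    · simp only [Finset.mem_filter, Finset.mem_univ, true_and]
      exact h2
    · rw [InfinitePlace.mk_conjugate_eq, InfinitePlace.mk_embedding]

lemma Eqn.extend (E : Eqn K T n a δ x y N d t r ρ q h X Y)
    {K' : Type} [Field K'] [NumberField K'] [Algebra K K'] {k : ℕ}
    (hk : Module.finrank K K' ≤ k) {ε : ℝ}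
    (hε : Real.log (Ideal.absNorm (differentIdeal (𝓞 K) (𝓞 K'))) ≤ Module.finrank ℚ K' * ε) :
    Eqn K' (lift K' T) n (fun j => algebraMap K K' (a j)) (algebraMap K K' δ) (algebraMap K K' x)
      (algebraMap K K' y) (N * k) d t r (ρ + ε) q h X Y := by
  have hm : (Module.finrank ℚ K' : ℝ) = Module.finrank K K' * Module.finrank ℚ K := by
    rw [← Module.finrank_mul_finrank ℚ K K']; push_cast; ring
  have hf := finrank_pos_real (K := K)
  have hf' : (0 : ℝ) ≤ Module.finrank K K' := Nat.cast_nonneg _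
  have hk' : (Module.finrank K K' : ℝ) ≤ k := by exact_mod_cast hk
  have hk0 : (0 : ℝ) ≤ k := Nat.cast_nonneg _
  have step : ∀ {A B C : ℝ}, A ≤ Module.finrank K K' * B → 0 ≤ B → B ≤ N * C → A ≤ N * k * C := by
    intro A B C h1 h2 h3
    calc A ≤ k * B := h1.trans (mul_le_mul_of_nonneg_right hk' h2)
      _ ≤ k * (N * C) := mul_le_mul_of_nonneg_left h3 hk0
      _ = _ := by ring
  have hord : ∀ z : K, (∀ P ∉ T, 0 ≤ ordAt P z) →
      ∀ P ∉ lift K' T, 0 ≤ ordAt P (algebraMap K K' z) := by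
    intro z hz P hP
    rw [ordAt_algebraMap (K := K)]
    exact mul_nonneg (Nat.cast_nonneg _) (hz _ (by simpa using hP))
  exact
  { hn := E.hn
    ha0 := by simpa using E.ha0
    hδ0 := by simpa using E.hδ0
    hy0 := by simpa using E.hy0
    hdisc := by
      rw [← map_binDisc n a (algebraMap K K')]
      simpa using E.hdisc
    haT := fun j hj => hord _ (E.haT j hj)
    hδT := hord _ E.hδT
    hxT := hord _ E.hxT
    heq := by rw [← map_ev, E.heq]; simp
    hN := step hm.le hf.le E.hN
    hNt := step (by exact_mod_cast card_lift_le T) (Nat.cast_nonneg _) E.hNt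
    hNr := step (by exact_mod_cast card_infinitePlace_extension_le K K') (Nat.cast_nonneg _) E.hNr
    hρ := by
      rw [log_discr_extension (K := K), mul_add, add_comm]
      have := mul_le_mul_of_nonneg_left E.hρ hf'
      rw [← mul_assoc, ← hm] at this
      exact add_le_add this hε
    hq := (sum_lift_log_le T).trans (by
      have := mul_le_mul_of_nonneg_left E.hq hf'
      rwa [← mul_assoc, ← hm] at this)
    hh := by
      rw [hA_algebraMap, hm, mul_assoc]
      exact mul_le_mul_of_nonneg_left E.hh hf'
    hX := by rw [ht_algebraMap, E.hX, hm, mul_assoc]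
    hY := by rw [ht_algebraMap, E.hY, hm, mul_assoc] }

lemma Eqn.dev_ne_zero (E : Eqn K T n a δ x y N d t r ρ q h X Y) {α : K} (hα : ev n a α = 0) :
    dev n a α ≠ 0 :=
  dev_ne_zero_of_binDisc (by have := E.hn; omega) E.hdisc hα

lemma Eqn.sub_ne_zero (E : Eqn K T n a δ x y N d t r ρ q h X Y) {α : K} (hα : ev n a α = 0) :
    x - α ≠ 0 := by
  intro h0
  have h1 := E.heq
  rw [sub_eq_zero.mp h0, hα] at h1
  exact mul_ne_zero E.hδ0 (pow_ne_zero 2 E.hy0) h1.symm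

/-- Adjoining a root of the polynomial, away from the roots of a proper factor. -/
lemma Eqn.adjoin_root (E : Eqn K T n a δ x y N d t r ρ q h X Y) {G : Polynomial K}
    (hG : G ∣ toPoly n a) (hdeg : G.natDegree < n) :
    ∃ (K' : Type) (_ : Field K') (_ : NumberField K') (_ : Algebra K K') (α : K'),
      ev n (fun j => algebraMap K K' (a j)) α = 0 ∧ Polynomial.aeval α G ≠ 0 ∧
      Eqn K' (lift K' T) n (fun j => algebraMap K K' (a j)) (algebraMap K K' δ) (algebraMap K K' x)
        (algebraMap K K' y) (N * n) d t r (ρ + (n + 1) * (h + Real.log n)) q h X Y := by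
  obtain ⟨H, hH⟩ := hG
  have hF := toPoly_ne_zero n a E.ha0
  have hG0 : G ≠ 0 := by rintro rfl; simp at hH; exact hF hH
  have hH0 : H ≠ 0 := by rintro rfl; simp at hH; exact hF hH
  have h1 := natDegree_toPoly n a E.ha0
  rw [hH, Polynomial.natDegree_mul hG0 hH0] at h1
  obtain ⟨K', i1, i2, i3, α, hα, htop, hk⟩ := exists_extension (f := H) (k := n)
    (by omega) (by omega)
  have hn := E.hn
  have hev : ev n (fun j => algebraMap K K' (a j)) α = 0 := by
    have : Polynomial.aeval α (toPoly n a) = 0 := by rw [hH, map_mul, hα, mul_zero]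
    rwa [Polynomial.aeval_def, ← Polynomial.eval_map, map_toPoly, eval_toPoly] at this
  have hdev : dev n (fun j => algebraMap K K' (a j)) α ≠ 0 := by
    refine dev_ne_zero_of_binDisc (by omega) ?_ hev
    rw [← map_binDisc n a (algebraMap K K')]
    simpa using E.hdisc
  refine ⟨K', i1, i2, i3, α, hev, fun h0 => hdev ?_, E.extend hk ?_⟩
  · rw [← eval_derivative_toPoly, ← map_toPoly, Polynomial.derivative_map, Polynomial.eval_map,
      ← Polynomial.aeval_def, hH, Polynomial.derivative_mul, map_add, map_mul, map_mul, hα, h0]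
    ring
  · have hm : (Module.finrank ℚ K' : ℝ) = Module.finrank K K' * Module.finrank ℚ K := by
      rw [← Module.finrank_mul_finrank ℚ K K']; push_cast; ring
    refine (log_different_root_le (δ := δ) (by omega) E.ha0 hev hdev htop).trans ?_
    have h2 := mul_le_mul_of_nonneg_left E.hh (Nat.cast_nonneg (Module.finrank K K') (α := ℝ))
    rw [← hA_algebraMap, ← mul_assoc, ← hm] at h2
    have h3 := mul_le_mul_of_nonneg_left h2 (by positivity : (0 : ℝ) ≤ n + 1)
    linarith

end HyperellipticBound

namespace HyperellipticBound

section Parity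

variable {K : Type*} [Field K] [NumberField K] {n : ℕ} {a : ℕ → K} {δ : K}

lemma valuation_le_one_iff (P : HeightOneSpectrum (𝓞 K)) (z : K) :
    P.valuation K z ≤ 1 ↔ 0 ≤ ordAt P z := by
  by_cases hz : z = 0
  · simp [hz, ordAt]
  · rw [valuation_eq_exp_ordAt P hz, ← WithZero.exp_zero, WithZero.exp_le_exp]
    omega

lemma lp_inr_eq_zero {P : HeightOneSpectrum (𝓞 K)} {z : K} (h : 0 ≤ ordAt P z) :
    lp (.inr P) z = 0 := by
  rw [lp_inr, max_eq_left (by omega)]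
  simp

lemma ordAt_nonneg_of_lp_le {P : HeightOneSpectrum (𝓞 K)} {z : K} (h : lp (.inr P) z ≤ 0) :
    0 ≤ ordAt P z := by
  by_contra! h1
  have h2 := (lg_le_lp _ _).trans h
  rw [lg_inr] at h2
  have h3 := log_absNorm_pos P
  have h4 : (ordAt P z : ℝ) < 0 := by exact_mod_cast h1
  nlinarith

lemma lA_inr_eq_zero {P : HeightOneSpectrum (𝓞 K)} (hδ : 0 ≤ ordAt P δ)
    (ha : ∀ j ≤ n, 0 ≤ ordAt P (a j)) : lA n δ a (.inr P) = 0 :=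
  le_antisymm (lA_le (lp_inr_eq_zero hδ).le fun j hj => (lp_inr_eq_zero (ha j hj)).le)
    (lA_nonneg _)

lemma lg_eq_zero_of_ordAt {P : HeightOneSpectrum (𝓞 K)} {z : K} (h : ordAt P z = 0) :
    lg (.inr P) z = 0 := by
  rw [lg_inr, h]; simp

lemma ordAt_root_nonneg {P : HeightOneSpectrum (𝓞 K)} (hn : 1 ≤ n) (ha0 : a 0 ≠ 0)
    (ha : ∀ j ≤ n, 0 ≤ ordAt P (a j)) (h0 : ordAt P (a 0) = 0) {α : K} (hα : ev n a α = 0) :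
    0 ≤ ordAt P α := by
  apply ordAt_nonneg_of_lp_le
  refine (lp_root_le (δ := 1) hn ha0 hα _).trans ?_
  rw [lA_inr_eq_zero (by simpa using (valuation_le_one_iff P (1 : K)).mp (by simp)) ha,
    lg_eq_zero_of_ordAt h0]
  simp [arch]

/-- The values of the polynomial and its derivative at integral points, together with the
divided difference, are integral. -/
lemma exists_taylor_integral {P : HeightOneSpectrum (𝓞 K)} (ha : ∀ j ≤ n, 0 ≤ ordAt P (a j))
    {α e : K} (hα : 0 ≤ ordAt P α) (he : 0 ≤ ordAt P e) :
    0 ≤ ordAt P (dev n a α) ∧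
    ∃ k, 0 ≤ ordAt P k ∧ ev n a (α + e) = ev n a α + dev n a α * e + k * e ^ 2 := by
  set A := (P.valuation K).valuationSubring
  have hA : ∀ z : K, z ∈ A ↔ 0 ≤ ordAt P z := fun z => by
    rw [← valuation_le_one_iff]; exact Valuation.mem_valuationSubring_iff _ _
  let b : ℕ → A := fun j => if h : j ≤ n then ⟨a j, (hA _).mpr (ha j h)⟩ else 0
  have hb : ∀ j ≤ n, (b j : K) = a j := fun j hj => by simp [b, hj]
  have hev : ∀ z : A, ((ev n b z : A) : K) = ev n a z := fun z => by
    have := map_ev n b A.subtype z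
    refine this.trans (Finset.sum_congr rfl fun j hj => ?_)
    rw [← hb j (Finset.mem_range_succ_iff.mp hj)]; rfl
  have hdev : ∀ z : A, ((dev n b z : A) : K) = dev n a z := fun z => by
    have := map_dev n b A.subtype z
    refine this.trans (Finset.sum_congr rfl fun j hj => ?_)
    rw [← hb j (Finset.mem_range.mp hj).le]; rfl
  refine ⟨?_, ?_⟩
  · rw [← hA, ← hdev ⟨α, (hA _).mpr hα⟩]
    exact (dev n b _).2
  · obtain ⟨k, hk⟩ := exists_taylor n b ⟨α, (hA _).mpr hα⟩ ⟨e, (hA _).mpr he⟩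
    refine ⟨k, (hA _).mp k.2, ?_⟩
    have := congrArg (fun z : A => (z : K)) hk
    simpa [hev, hdev] using this

lemma ordAt_add_eq_zero {P : HeightOneSpectrum (𝓞 K)} {u w : K} (hu0 : u ≠ 0)
    (hu : ordAt P u = 0) (hw : w = 0 ∨ 0 < ordAt P w) : u + w ≠ 0 ∧ ordAt P (u + w) = 0 := by
  have h1 : P.valuation K u = 1 := by rw [valuation_eq_exp_ordAt P hu0, hu]; simp
  have h2 : P.valuation K w < 1 := by
    by_cases h0 : w = 0
    · simp [h0]
    · rw [valuation_eq_exp_ordAt P h0, ← WithZero.exp_zero, WithZero.exp_lt_exp]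
      have := hw.resolve_left h0
      omega
  have h3 : P.valuation K (u + w) = 1 := by
    rw [Valuation.map_add_eq_of_lt_left _ (by rwa [h1]), h1]
  have h4 : u + w ≠ 0 := by rintro h; rw [h] at h3; simp at h3
  refine ⟨h4, ?_⟩
  rw [valuation_eq_exp_ordAt P h4, ← WithZero.exp_zero] at h3
  have := WithZero.exp_injective h3
  omega

/-- Away from the primes dividing `a₀ δ F'(α)`, the difference `x - α` has even order at any
integral solution of `F(x) = δ y²`. -/
lemma even_ordAt_sub {P : HeightOneSpectrum (𝓞 K)} (hn : 1 ≤ n) (ha0 : a 0 ≠ 0)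
    (ha : ∀ j ≤ n, 0 ≤ ordAt P (a j)) (h0 : ordAt P (a 0) = 0) (hδ0 : δ ≠ 0)
    (hδ : ordAt P δ = 0) {α : K} (hα : ev n a α = 0) (hd0 : dev n a α ≠ 0)
    (hd : ordAt P (dev n a α) = 0) {x y : K} (hx : 0 ≤ ordAt P x) (hy : y ≠ 0)
    (heq : ev n a x = δ * y ^ 2) : Even (ordAt P (x - α)) := by
  have h1 := ordAt_root_nonneg hn ha0 ha h0 hα
  have h2 : 0 ≤ ordAt P (x - α) := by
    rw [← valuation_le_one_iff] at hx h1 ⊢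
    exact (Valuation.map_sub _ _ _).trans (max_le hx h1)
  rcases h2.eq_or_lt with h3 | h3
  · rw [← h3]; exact Even.zero
  obtain ⟨-, k, hk, hk2⟩ := exists_taylor_integral ha h1 h2
  rw [add_sub_cancel, hα, zero_add, heq] at hk2
  have hxα : x - α ≠ 0 := by
    intro h; rw [h] at h3; simp [ordAt] at h3
  have h4 := ordAt_add_eq_zero (w := k * (x - α)) hd0 hd (by
    by_cases hk0 : k = 0
    · simp [hk0]
    · right; rw [ordAt_mul P hk0 hxα]; omega)
  have h5 : δ * y ^ 2 = (x - α) * (dev n a α + k * (x - α)) := by rw [hk2]; ring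
  have h6 := congrArg (ordAt P) h5
  rw [ordAt_mul P hδ0 (pow_ne_zero 2 hy), ordAt_pow P hy, hδ, ordAt_mul P hxα h4.1, h4.2] at h6
  exact ⟨ordAt P y, by push_cast at h6; omega⟩

end Parity

variable {K : Type} [Field K] [NumberField K] {T : Finset (HeightOneSpectrum (𝓞 K))}
    {n : ℕ} {a : ℕ → K} {δ x y : K} {N d t r ρ q h X Y : ℝ}

lemma log_absNorm_le_lp_inv {P : HeightOneSpectrum (𝓞 K)} {z : K} (hz : 0 < ordAt P z) :
    Real.log (Ideal.absNorm P.asIdeal) ≤ lp (.inr P) z⁻¹ := by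
  refine le_trans ?_ (lg_le_lp _ _)
  rw [lg_inr, ordAt_inv]
  have h3 := log_absNorm_pos P
  have h4 : (1 : ℝ) ≤ (ordAt P z : ℝ) := by exact_mod_cast hz
  push_cast
  nlinarith

/-- Adjoining the square root of `(x - α) / (x - β)` for two roots `α`, `β`. -/
lemma Eqn.adjoin_sqrt (E : Eqn K T n a δ x y N d t r ρ q h X Y) {α β : K}
    (hα : ev n a α = 0) (hβ : ev n a β = 0) :
    ∃ (K' : Type) (_ : Field K') (_ : NumberField K') (_ : Algebra K K') (τ : K'),
      τ ^ 2 = algebraMap K K' ((x - α) / (x - β)) ∧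
      Eqn K' (lift K' T) n (fun j => algebraMap K K' (a j)) (algebraMap K K' δ) (algebraMap K K' x)
        (algebraMap K K' y) (N * 2) d t r
        (ρ + (Real.log 2 + q / 2 + (n + 1) * (h + Real.log n))) q h X Y := by
  set γ := (x - α) / (x - β) with hγ
  have hxα := E.sub_ne_zero hα
  have hxβ := E.sub_ne_zero hβ
  have hγ0 : γ ≠ 0 := div_ne_zero hxα hxβ
  have hn := E.hn
  obtain ⟨K', i1, i2, i3, τ, hτ, htop, hk⟩ := exists_extension
    (f := Polynomial.X ^ 2 - Polynomial.C γ) (k := 2)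
    (by rw [Polynomial.natDegree_X_pow_sub_C]; norm_num)
    (by rw [Polynomial.natDegree_X_pow_sub_C])
  have hτ2 : τ ^ 2 = algebraMap K K' γ := by
    simpa [sub_eq_zero] using hτ
  refine ⟨K', i1, i2, i3, τ, hτ2, ?_⟩
  have E' := E.extend (k := 2) hk (ε := Real.log 2 + q / 2 + (n + 1) * (h + Real.log n)) ?_
  · exact_mod_cast E'
  set g : Pl K → ℝ := Sum.elim (fun _ => 0)
    (fun P => if P ∈ T then Real.log (Ideal.absNorm P.asIdeal) else 0) with hg
  have hgf : g.HasFiniteSupport := by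
    apply hasFiniteSupport_of_inr
    refine (T.finite_toSet).subset fun P hP => ?_
    by_contra h
    exact hP (by simp [hg, show P ∉ T from h])
  have hg0 : ∀ v, 0 ≤ g v := by
    rintro (φ | P)
    · simp [hg]
    · simp only [hg, Sum.elim_inr]
      split_ifs
      · exact (log_absNorm_pos P).le
      · exact le_rfl
  have hgs : ∑ᶠ v, g v = ∑ P ∈ T, Real.log (Ideal.absNorm P.asIdeal) := by
    rw [finsum_eq_add_offSum T hgf]
    have h1 : offSum T g = 0 := by
      unfold offSum
      rw [finsum_eq_zero_of_forall_eq_zero]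
      intro P
      split_ifs with hP <;> simp [hg, hP]
    rw [h1, add_zero, Finset.sum_eq_zero (fun φ _ => by simp [hg]), zero_add]
    exact Finset.sum_congr rfl fun P hP => by simp [hg, hP]
  have fl : ∀ z : K, (fun v => lp v z).HasFiniteSupport := fun z => hasFiniteSupport_lp z
  have f1 : (fun v => lp v (dev n a α)⁻¹ + lp v (dev n a β)⁻¹).HasFiniteSupport := (fl _).add (fl _)
  have f2 : (fun v => lp v δ⁻¹ + (lp v (dev n a α)⁻¹ + lp v (dev n a β)⁻¹)).HasFiniteSupport :=
    (fl _).add f1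
  have f3 : (fun v => lp v (a 0)⁻¹ +
      (lp v δ⁻¹ + (lp v (dev n a α)⁻¹ + lp v (dev n a β)⁻¹))).HasFiniteSupport := (fl _).add f2
  have f4 : (fun v => g v + (lp v (a 0)⁻¹ +
      (lp v δ⁻¹ + (lp v (dev n a α)⁻¹ + lp v (dev n a β)⁻¹)))).HasFiniteSupport := hgf.add f3
  have hsum : ∑ᶠ v, (g v + (lp v (a 0)⁻¹ +
      (lp v δ⁻¹ + (lp v (dev n a α)⁻¹ + lp v (dev n a β)⁻¹)))) =
      ∑ P ∈ T, Real.log (Ideal.absNorm P.asIdeal) +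
        (ht (a 0) + (ht δ + (ht (dev n a α) + ht (dev n a β)))) := by
    rw [finsum_add_distrib hgf f3, finsum_add_distrib (fl _) f2, finsum_add_distrib (fl _) f1,
      finsum_add_distrib (fl _) (fl _), hgs]
    simp only [← ht.eq_1, ht_inv]
  refine (log_different_sqrt_le hγ0 hτ2 htop f4 (fun v => ?_) fun P hP => ?_).trans ?_
  · have := hg0 v
    have p1 := lp_nonneg v (a 0)⁻¹
    have p2 := lp_nonneg v δ⁻¹
    have p3 := lp_nonneg v (dev n a α)⁻¹
    have p4 := lp_nonneg v (dev n a β)⁻¹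
    linarith
  · have p1 := lp_nonneg (.inr P) (a 0)⁻¹
    have p2 := lp_nonneg (.inr P) δ⁻¹
    have p3 := lp_nonneg (.inr P) (dev n a α)⁻¹
    have p4 := lp_nonneg (.inr P) (dev n a β)⁻¹
    have p5 := hg0 (.inr P)
    by_cases hPT : P ∈ T
    · have : g (.inr P) = Real.log (Ideal.absNorm P.asIdeal) := by simp [hg, hPT]
      linarith
    have haP := fun j hj => E.haT j hj P hPT
    rcases (haP 0 (Nat.zero_le n)).lt_or_eq with q1 | q1
    · linarith [log_absNorm_le_lp_inv q1]
    rcases (E.hδT P hPT).lt_or_eq with q2 | q2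
    · linarith [log_absNorm_le_lp_inv q2]
    have he : 0 ≤ ordAt P (0 : K) := by simp [ordAt]
    have hdev : ∀ {z : K}, ev n a z = 0 → 0 ≤ ordAt P (dev n a z) := fun {z} hz =>
      (exists_taylor_integral haP (ordAt_root_nonneg (by omega) E.ha0 haP q1.symm hz) he).1
    rcases (hdev hα).lt_or_eq with q3 | q3
    · linarith [log_absNorm_le_lp_inv q3]
    rcases (hdev hβ).lt_or_eq with q4 | q4
    · linarith [log_absNorm_le_lp_inv q4]
    exfalso
    have ev1 := even_ordAt_sub (by omega) E.ha0 haP q1.symm E.hδ0 q2.symm hα (E.dev_ne_zero hα)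
      q3.symm (E.hxT P hPT) E.hy0 E.heq
    have ev2 := even_ordAt_sub (by omega) E.ha0 haP q1.symm E.hδ0 q2.symm hβ (E.dev_ne_zero hβ)
      q4.symm (E.hxT P hPT) E.hy0 E.heq
    rw [hγ, div_eq_mul_inv, ordAt_mul P hxα (inv_ne_zero hxβ), ordAt_inv,
      ← Int.not_even_iff_odd] at hP
    exact hP (ev1.add ev2.neg)
  · rw [hsum]
    have hm : (Module.finrank ℚ K' : ℝ) = Module.finrank K K' * Module.finrank ℚ K := by
      rw [← Module.finrank_mul_finrank ℚ K K']; push_cast; ring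
    have b1 := ht_coeff_le_hA (δ := δ) (a := a) (Nat.zero_le n)
    have b2 := ht_le_hA (n := n) (δ := δ) (a := a)
    have b3 := ht_dev_root_le (δ := δ) (by omega) E.ha0 hα
    have b4 := ht_dev_root_le (δ := δ) (by omega) E.ha0 hβ
    have b5 := mul_le_mul_of_nonneg_left E.hh (by positivity : (0 : ℝ) ≤ 2 * (n + 1))
    have b6 := E.hq
    have b7 : ∑ P ∈ T, Real.log (Ideal.absNorm P.asIdeal) +
        (ht (a 0) + (ht δ + (ht (dev n a α) + ht (dev n a β)))) ≤
        Module.finrank ℚ K * (q + 2 * (n + 1) * (h + Real.log n)) := by linarith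
    have b8 := mul_le_mul_of_nonneg_left b7 (Nat.cast_nonneg (Module.finrank K K') (α := ℝ))
    rw [← mul_assoc, ← hm] at b8
    linarith

lemma ev_algebraMap {F E : Type*} [Field F] [Field E] [Algebra F E] {a : ℕ → F} {α : F}
    (hα : ev n a α = 0) : ev n (fun j => algebraMap F E (a j)) (algebraMap F E α) = 0 := by
  rw [← map_ev, hα, map_zero]

/-- The field over which the hyperelliptic equation is turned into a unit equation. -/
lemma Eqn.exists_tower (E : Eqn K T n a δ x y N d t r ρ q h X Y) :
    ∃ (M : Type) (_ : Field M) (_ : NumberField M) (T' : Finset (HeightOneSpectrum (𝓞 M)))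
      (a' : ℕ → M) (δ' x' y' α₁ α₂ α₃ τ₂ τ₃ : M),
      Eqn M T' n a' δ' x' y' (N * (4 * n ^ 3)) d t r
        (ρ + (q + 2 * Real.log 2 + 5 * ((n + 1) * (h + Real.log n)))) q h X Y ∧
      ev n a' α₁ = 0 ∧ ev n a' α₂ = 0 ∧ ev n a' α₃ = 0 ∧ α₁ ≠ α₂ ∧ α₁ ≠ α₃ ∧ α₂ ≠ α₃ ∧
      τ₂ ^ 2 = (x' - α₂) / (x' - α₁) ∧ τ₃ ^ 2 = (x' - α₃) / (x' - α₁) := by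
  have hn := E.hn
  obtain ⟨K₁, _, _, _, α, hα, -, E₁⟩ := E.adjoin_root (G := 1) (one_dvd _) (by simp; omega)
  clear E
  generalize lift K₁ T = T₁ at E₁
  generalize (fun j => algebraMap K K₁ (a j)) = a₁ at *
  generalize algebraMap K K₁ δ = δ₁ at *
  generalize algebraMap K K₁ x = x₁ at *
  generalize algebraMap K K₁ y = y₁ at *
  have d1 : Polynomial.X - Polynomial.C α ∣ toPoly n a₁ := by
    rw [Polynomial.dvd_iff_isRoot, Polynomial.IsRoot, eval_toPoly, hα]
  obtain ⟨K₂, _, _, _, β, hβ, hαβ, E₂⟩ := E₁.adjoin_root d1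
    (by rw [Polynomial.natDegree_X_sub_C]; omega)
  clear E₁
  replace hα := ev_algebraMap (E := K₂) hα
  simp only [map_sub, Polynomial.aeval_X, Polynomial.aeval_C] at hαβ
  generalize lift K₂ T₁ = T₂ at E₂
  generalize (fun j => algebraMap K₁ K₂ (a₁ j)) = a₂ at *
  generalize algebraMap K₁ K₂ δ₁ = δ₂ at *
  generalize algebraMap K₁ K₂ x₁ = x₂ at *
  generalize algebraMap K₁ K₂ y₁ = y₂ at *
  generalize algebraMap K₁ K₂ α = α₂ at *
  have d2 : (Polynomial.X - Polynomial.C α₂) * (Polynomial.X - Polynomial.C β) ∣ toPoly n a₂ := by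
    refine IsCoprime.mul_dvd ?_ ?_ ?_
    · exact Polynomial.isCoprime_X_sub_C_of_isUnit_sub
        (isUnit_iff_ne_zero.mpr fun h0 => hαβ (by rw [← neg_sub, h0, neg_zero]))
    · rw [Polynomial.dvd_iff_isRoot, Polynomial.IsRoot, eval_toPoly, hα]
    · rw [Polynomial.dvd_iff_isRoot, Polynomial.IsRoot, eval_toPoly, hβ]
  obtain ⟨K₃, _, _, _, γ, hγ, hγ0, E₃⟩ := E₂.adjoin_root d2 (by
    rw [Polynomial.natDegree_mul (Polynomial.X_sub_C_ne_zero _) (Polynomial.X_sub_C_ne_zero _),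
      Polynomial.natDegree_X_sub_C, Polynomial.natDegree_X_sub_C]
    omega)
  clear E₂
  replace hα := ev_algebraMap (E := K₃) hα
  replace hβ := ev_algebraMap (E := K₃) hβ
  replace hαβ : algebraMap K₂ K₃ β - algebraMap K₂ K₃ α₂ ≠ 0 := by
    rw [← map_sub]; exact (map_ne_zero _).mpr hαβ
  simp only [map_mul, map_sub, Polynomial.aeval_X, Polynomial.aeval_C] at hγ0
  generalize lift K₃ T₂ = T₃ at E₃
  generalize (fun j => algebraMap K₂ K₃ (a₂ j)) = a₃ at *
  generalize algebraMap K₂ K₃ δ₂ = δ₃ at *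
  generalize algebraMap K₂ K₃ x₂ = x₃ at *
  generalize algebraMap K₂ K₃ y₂ = y₃ at *
  generalize algebraMap K₂ K₃ α₂ = α₃ at *
  generalize algebraMap K₂ K₃ β = β₃ at *
  have hαγ := left_ne_zero_of_mul hγ0
  have hβγ := right_ne_zero_of_mul hγ0
  obtain ⟨K₄, _, _, _, τ, hτ, E₄⟩ := E₃.adjoin_sqrt hβ hα
  replace hα := ev_algebraMap (E := K₄) hα
  replace hγ := ev_algebraMap (E := K₄) hγ
  obtain ⟨K₅, _, _, _, σ, hσ, E₅⟩ := E₄.adjoin_sqrt hγ hα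
  have e1 : N * n * n * n * 2 * 2 = N * (4 * n ^ 3) := by ring
  have e2 : ρ + (n + 1) * (h + Real.log n) + (n + 1) * (h + Real.log n)
      + (n + 1) * (h + Real.log n) + (Real.log 2 + q / 2 + (n + 1) * (h + Real.log n))
      + (Real.log 2 + q / 2 + (n + 1) * (h + Real.log n)) =
      ρ + (q + 2 * Real.log 2 + 5 * ((n + 1) * (h + Real.log n))) := by ring
  rw [e1, e2] at E₅
  refine ⟨K₅, inferInstance, inferInstance, _, _, _, _, _, algebraMap K₄ K₅ (algebraMap K₃ K₄ α₃),
    algebraMap K₄ K₅ (algebraMap K₃ K₄ β₃), algebraMap K₄ K₅ (algebraMap K₃ K₄ γ),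
    algebraMap K₄ K₅ τ, σ, E₅, ev_algebraMap hα, ev_algebraMap (ev_algebraMap hβ),
    ev_algebraMap hγ, ?_, ?_, ?_, ?_, ?_⟩
  · intro h0
    rw [(algebraMap K₄ K₅).injective.eq_iff, (algebraMap K₃ K₄).injective.eq_iff] at h0
    exact hαβ (by rw [h0, sub_self])
  · intro h0
    rw [(algebraMap K₄ K₅).injective.eq_iff, (algebraMap K₃ K₄).injective.eq_iff] at h0
    exact hαγ (by rw [h0, sub_self])
  · intro h0
    rw [(algebraMap K₄ K₅).injective.eq_iff, (algebraMap K₃ K₄).injective.eq_iff] at h0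
    exact hβγ (by rw [h0, sub_self])
  · rw [← map_pow, hτ]
    simp
  · rw [hσ]
    simp

end HyperellipticBound

namespace HyperellipticBound

section Local

variable {K : Type*} [Field K]

/-- The data of the unit equation: three distinct numbers `α₁, α₂, α₃`, and square roots
`t₂, t₃` of `(x - αᵢ) / (x - α₁)`. -/
structure UnitData (x α₁ α₂ α₃ t₂ t₃ : K) : Prop where
  h12 : α₁ ≠ α₂
  h13 : α₁ ≠ α₃
  h23 : α₂ ≠ α₃
  hx₁ : x - α₁ ≠ 0
  hx₂ : x - α₂ ≠ 0
  hx₃ : x - α₃ ≠ 0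
  ht₂ : t₂ ^ 2 = (x - α₂) / (x - α₁)
  ht₃ : t₃ ^ 2 = (x - α₃) / (x - α₁)

namespace UnitData

variable {x α₁ α₂ α₃ t₂ t₃ : K}

lemma mul₂ (U : UnitData x α₁ α₂ α₃ t₂ t₃) : t₂ ^ 2 * (x - α₁) = x - α₂ := by
  rw [U.ht₂, div_mul_cancel₀ _ U.hx₁]

lemma mul₃ (U : UnitData x α₁ α₂ α₃ t₂ t₃) : t₃ ^ 2 * (x - α₁) = x - α₃ := by
  rw [U.ht₃, div_mul_cancel₀ _ U.hx₁]

lemma eq₂ (U : UnitData x α₁ α₂ α₃ t₂ t₃) : (1 - t₂) * (1 + t₂) * (x - α₁) = α₂ - α₁ := by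
  linear_combination -U.mul₂

lemma eq₃ (U : UnitData x α₁ α₂ α₃ t₂ t₃) : (1 - t₃) * (1 + t₃) * (x - α₁) = α₃ - α₁ := by
  linear_combination -U.mul₃

lemma eq₂₃ (U : UnitData x α₁ α₂ α₃ t₂ t₃) : (t₂ - t₃) * (t₂ + t₃) * (x - α₁) = α₃ - α₂ := by
  linear_combination U.mul₂ - U.mul₃

lemma ne₂ (U : UnitData x α₁ α₂ α₃ t₂ t₃) : 1 - t₂ ≠ 0 ∧ 1 + t₂ ≠ 0 := by
  have h := U.eq₂
  constructor <;> intro h0 <;> rw [h0] at h <;> simp at h <;>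
    exact U.h12 (sub_eq_zero.mp h.symm).symm

lemma ne₃ (U : UnitData x α₁ α₂ α₃ t₂ t₃) : 1 - t₃ ≠ 0 ∧ 1 + t₃ ≠ 0 := by
  have h := U.eq₃
  constructor <;> intro h0 <;> rw [h0] at h <;> simp at h <;>
    exact U.h13 (sub_eq_zero.mp h.symm).symm

lemma ne₂₃ (U : UnitData x α₁ α₂ α₃ t₂ t₃) : t₂ - t₃ ≠ 0 ∧ t₂ + t₃ ≠ 0 := by
  have h := U.eq₂₃
  constructor <;> intro h0 <;> rw [h0] at h <;> simp at h <;>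
    exact U.h23 (sub_eq_zero.mp h.symm).symm

lemma ne_t (U : UnitData x α₁ α₂ α₃ t₂ t₃) : t₂ ≠ 0 ∧ t₃ ≠ 0 := by
  have h2 := U.mul₂
  have h3 := U.mul₃
  constructor <;> rintro rfl
  · simp at h2; exact U.hx₂ h2.symm
  · simp at h3; exact U.hx₃ h3.symm

lemma one_sub (U : UnitData x α₁ α₂ α₃ t₂ t₃) :
    1 - (1 - t₂) / (1 - t₃) = (t₂ - t₃) / (1 - t₃) := by
  have := U.ne₃.1
  field_simp
  ring

end UnitData

variable [NumberField K]

lemma av_le_exp_of_lg_le {v : Pl K} {z : K} {c : ℝ} (hz : z ≠ 0) (h : lg v z ≤ c) :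
    av v z ≤ Real.exp c := by
  rwa [lg, Real.log_le_iff_le_exp (av_pos v hz)] at h

lemma lg_add_le_of_av_le {P : HeightOneSpectrum (𝓞 K)} {z w : K} {c : ℝ} (h0 : z + w ≠ 0)
    (hz : av (.inr P) z ≤ Real.exp c) (hw : av (.inr P) w ≤ Real.exp c) :
    lg (.inr P) (z + w) ≤ c := by
  rw [lg, Real.log_le_iff_le_exp (av_pos _ h0)]
  have := av_add_le (.inr P) z w
  simp only [arch, zero_mul, Real.exp_zero, one_mul] at this
  exact this.trans (max_le hz hw)

lemma lg_sub_le_of_av_le {P : HeightOneSpectrum (𝓞 K)} {z w : K} {c : ℝ} (h0 : z - w ≠ 0)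
    (hz : av (.inr P) z ≤ Real.exp c) (hw : av (.inr P) w ≤ Real.exp c) :
    lg (.inr P) (z - w) ≤ c := by
  rw [sub_eq_add_neg] at h0 ⊢
  exact lg_add_le_of_av_le h0 hz (by rwa [map_neg_eq_map])

namespace UnitData

variable {x α₁ α₂ α₃ t₂ t₃ : K}

lemma local_bounds (U : UnitData x α₁ α₂ α₃ t₂ t₃) {P : HeightOneSpectrum (𝓞 K)} {b : ℝ}
    (hx : lp (.inr P) x ≤ b) (h1 : lp (.inr P) α₁ ≤ b) (h2 : lp (.inr P) α₂ ≤ b)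
    (h3 : lp (.inr P) α₃ ≤ b) :
    lg (.inr P) ((1 - t₂) / (1 - t₃)) ≤ b - lg (.inr P) (α₃ - α₁) ∧
    -lg (.inr P) ((1 - t₂) / (1 - t₃)) ≤ b - lg (.inr P) (α₂ - α₁) ∧
    -lg (.inr P) ((t₂ - t₃) / (1 - t₃)) ≤ b - lg (.inr P) (α₃ - α₂) := by
  set v : Pl K := .inr P with hv
  have av_le : ∀ {z : K}, lp v z ≤ b → av v z ≤ Real.exp b := fun {z} hz =>
    (av_le_exp v z).trans (Real.exp_le_exp.mpr hz)
  have X1 := lg_sub_le_of_av_le U.hx₁ (av_le hx) (av_le h1)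
  have X2 := lg_sub_le_of_av_le U.hx₂ (av_le hx) (av_le h2)
  have X3 := lg_sub_le_of_av_le U.hx₃ (av_le hx) (av_le h3)
  have e2 := congrArg (lg v) U.mul₂
  have e3 := congrArg (lg v) U.mul₃
  rw [lg_mul v (pow_ne_zero 2 U.ne_t.1) U.hx₁, lg_pow] at e2
  rw [lg_mul v (pow_ne_zero 2 U.ne_t.2) U.hx₁, lg_pow] at e3
  push_cast at e2 e3
  rw [← hv] at X1 X2 X3
  set c := (b - lg v (x - α₁)) / 2 with hc
  have a1 : av v (1 : K) ≤ Real.exp c := by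
    rw [map_one]; exact Real.one_le_exp (by linarith)
  have a2 : av v t₂ ≤ Real.exp c := av_le_exp_of_lg_le U.ne_t.1 (by linarith)
  have a3 : av v t₃ ≤ Real.exp c := av_le_exp_of_lg_le U.ne_t.2 (by linarith)
  have m2 := lg_sub_le_of_av_le U.ne₂.1 a1 a2
  have m2' := lg_add_le_of_av_le U.ne₂.2 a1 a2
  have m3 := lg_sub_le_of_av_le U.ne₃.1 a1 a3
  have m3' := lg_add_le_of_av_le U.ne₃.2 a1 a3
  have m23' := lg_add_le_of_av_le U.ne₂₃.2 a2 a3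
  have f2 := congrArg (lg v) U.eq₂
  have f3 := congrArg (lg v) U.eq₃
  have f23 := congrArg (lg v) U.eq₂₃
  rw [lg_mul v (mul_ne_zero U.ne₂.1 U.ne₂.2) U.hx₁, lg_mul v U.ne₂.1 U.ne₂.2] at f2
  rw [lg_mul v (mul_ne_zero U.ne₃.1 U.ne₃.2) U.hx₁, lg_mul v U.ne₃.1 U.ne₃.2] at f3
  rw [lg_mul v (mul_ne_zero U.ne₂₃.1 U.ne₂₃.2) U.hx₁, lg_mul v U.ne₂₃.1 U.ne₂₃.2] at f23
  rw [lg_div v U.ne₂.1 U.ne₃.1, lg_div v U.ne₂₃.1 U.ne₃.1]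
  rw [← hv] at m2 m2' m3 m3' m23'
  refine ⟨by linarith, by linarith, by linarith⟩

lemma recover (U : UnitData x α₁ α₂ α₃ t₂ t₃) {u p : K} (hu : u = (1 - t₂) / (1 - t₃))
    (hp : p = ((α₂ - α₁) - u * (α₃ - α₁)) / (u * (1 - u))) :
    x - α₁ = ((α₃ - α₁) + p) ^ 2 / (4 * p) := by
  have h2 := U.ne₂.1
  have h3 := U.ne₃.1
  have hu0 : u ≠ 0 := by rw [hu]; exact div_ne_zero h2 h3
  have hu1 : 1 - u ≠ 0 := by rw [hu, U.one_sub]; exact div_ne_zero U.ne₂₃.1 h3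
  have ht2 : t₂ = 1 - u * (1 - t₃) := by rw [hu, div_mul_cancel₀ _ h3]; ring
  have hp' : p = (1 - t₃) ^ 2 * (x - α₁) := by
    rw [hp, ← U.eq₂, ← U.eq₃, ht2, div_eq_iff (mul_ne_zero hu0 hu1)]
    ring
  have hp0 : p ≠ 0 := by rw [hp']; exact mul_ne_zero (pow_ne_zero 2 h3) U.hx₁
  have h4 : (4 : K) ≠ 0 := by norm_num
  rw [eq_div_iff (mul_ne_zero h4 hp0), ← U.eq₃, hp']
  ring

lemma ht_le (U : UnitData x α₁ α₂ α₃ t₂ t₃) {A D : ℝ} (hD : D = Module.finrank ℚ K)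
    (h1 : ht α₁ ≤ A) (h2 : ht α₂ ≤ A) (h3 : ht α₃ ≤ A) :
    ht x ≤ 9 * ht ((1 - t₂) / (1 - t₃)) + 17 * A + 19 * (D * Real.log 2) := by
  set u := (1 - t₂) / (1 - t₃) with hu
  set p := ((α₂ - α₁) - u * (α₃ - α₁)) / (u * (1 - u)) with hp
  have hx : x = α₁ + ((α₃ - α₁) + p) ^ 2 / (4 * p) := by rw [← U.recover hu hp]; ring
  have c2 := ht_sub_le α₂ α₁
  have c3 := ht_sub_le α₃ α₁
  have c4 := ht_sub_le 1 u
  have c5 := ht_sub_le (α₂ - α₁) (u * (α₃ - α₁))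
  have c6 := ht_mul_le u (α₃ - α₁)
  have c7 := ht_mul_le (α₂ - α₁ - u * (α₃ - α₁)) (u * (1 - u))⁻¹
  have c8 := ht_mul_le u (1 - u)
  have c9 := ht_add_le (α₃ - α₁) p
  have c10 := ht_mul_le ((α₃ - α₁ + p) ^ 2) (4 * p)⁻¹
  have c11 := ht_mul_le 4 p
  have c12 := ht_add_le α₁ (((α₃ - α₁) + p) ^ 2 / (4 * p))
  have c13 : ht (4 : K) ≤ D * (2 * Real.log 2) := by
    have := ht_add_le (1 : K) 1
    have h0 : ht (1 : K) = 0 := by simp [ht, lp]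
    have h4 := ht_mul_le (2 : K) 2
    rw [one_add_one_eq_two, h0, ← hD] at this
    norm_num at h4 this
    linarith
  have h0 : ht (1 : K) = 0 := by simp [ht, lp]
  rw [ht_inv] at c7 c10
  rw [ht_pow] at c10
  rw [← div_eq_mul_inv] at c7 c10
  rw [← hp] at c7
  rw [← hx] at c12
  rw [← hD] at *
  push_cast at c10
  linarith

end UnitData

end Local

end HyperellipticBound

namespace HyperellipticBound

section OffSum

variable {K : Type*} [Field K] [NumberField K]

lemma offSum_le_finsum {T : Finset (HeightOneSpectrum (𝓞 K))} {f g : Pl K → ℝ}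
    (hf : f.HasFiniteSupport) (hg : g.HasFiniteSupport) (h0 : ∀ v, 0 ≤ g v)
    (h : ∀ P ∉ T, f (.inr P) ≤ g (.inr P)) : offSum T f ≤ ∑ᶠ v, g v := by
  rw [finsum_split hg, offSum]
  have h1 : 0 ≤ ∑ φ, g (.inl φ) := Finset.sum_nonneg fun φ _ => h0 _
  have h2 : ∑ᶠ P, (if P ∈ T then 0 else f (.inr P)) ≤ ∑ᶠ P, g (.inr P) := by
    refine finsum_le_finsum_of_le (hasFiniteSupport_off T hf) (hasFiniteSupport_inr hg) fun P => ?_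
    split_ifs with hP
    · exact h0 _
    · exact h P hP
  linarith

lemma finsum_lp_add (x y : K) : ∑ᶠ v : Pl K, (lp v x + lp v y) = ht x + ht y :=
  finsum_add_distrib (hasFiniteSupport_lp x) (hasFiniteSupport_lp y)

lemma hasFiniteSupport_lp_add (x y : K) :
    (fun v : Pl K => lp v x + lp v y).HasFiniteSupport :=
  (hasFiniteSupport_lp x).add (hasFiniteSupport_lp y)

/-- If `w` is almost integral outside `T`, then it is small at some place of `T` or at infinity. -/
lemma exists_lg_le (T : Finset (HeightOneSpectrum (𝓞 K))) {w : K} {h₀ c D m : ℝ}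
    (hD : D = Module.finrank ℚ K) (hm : m = T.card) (hc : 0 ≤ c)
    (hoff : offSum T (fun v => lp v w⁻¹) ≤ h₀) (h : (D + m) * c + h₀ < ht w) :
    ∃ v₀ : Pl K, (∀ P, v₀ = .inr P → P ∈ T) ∧ c ≤ -lg v₀ w := by
  by_contra! hcon
  have hlp : ∀ v : Pl K, (∀ P, v = .inr P → P ∈ T) → lp v w⁻¹ ≤ c := fun v hv =>
    lp_le_of_le hc (by rw [lg_inv]; exact (hcon v hv).le)
  have h1 : ∑ φ : K →+* ℂ, lp (.inl φ) w⁻¹ ≤ D * c := by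
    refine (Finset.sum_le_card_nsmul _ _ c fun φ _ => hlp _ (by simp)).trans (le_of_eq ?_)
    rw [Finset.card_univ, Embeddings.card, nsmul_eq_mul, hD]
  have h2 : ∑ P ∈ T, lp (.inr P) w⁻¹ ≤ m * c := by
    refine (Finset.sum_le_card_nsmul _ _ c fun P hP => hlp _ ?_).trans (le_of_eq ?_)
    · rintro Q hQ; rwa [← Sum.inr.inj hQ]
    · rw [nsmul_eq_mul, hm]
  have h3 := finsum_eq_add_offSum T (hasFiniteSupport_lp w⁻¹)
  rw [← ht_inv, ht, h3] at h
  linarith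

theorem ht_le_of_offSum {u : K} (hu : u ≠ 0) (T : Finset (HeightOneSpectrum (𝓞 K)))
    {h₀ δ δ₀ D m Λ N₀ : ℝ} {L J : ℕ}
    (hD : D = Module.finrank ℚ K) (hm : m = T.card) (hh₀ : 0 ≤ h₀)
    (hoff : offSum T (fun v => |lg v u|) ≤ h₀)
    (hoff' : offSum T (fun v => lp v (1 - u)⁻¹) ≤ h₀)
    (hδ : 0 < δ) (hLδ : 2000 * L * δ ≤ 1) (hE : 1 ≤ Real.log (1 / δ))
    (hL : 64 * (D + 1) * Real.log (1 / δ) ≤ L) (hLs : 1200000 * (L ^ 2 * δ * (D + m)) ≤ 1)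
    (hδ₀ : δ₀ = δ / (8 * (D + m))) (hΛ : Λ = Real.log (2 * √|(discr K : ℝ)|))
    (hN₀ : 1 ≤ N₀) (hTN₀ : ∀ P ∈ T, (Ideal.absNorm P.asIdeal : ℝ) ≤ N₀)
    (hJ : (2 * √|(discr K : ℝ)|) * √(2 * √|(discr K : ℝ)|) * Real.exp (4 * D)
      * (∏ P ∈ T, (Real.log (Ideal.absNorm P.asIdeal) / δ₀ + 1))
      * (Λ / δ₀ + 1) ^ Fintype.card (InfinitePlace K) * (27 / δ * N₀) < J + 1) :
    ht u ≤ max (2 * (h₀ + D * Real.log 2) + 2 * (D + m)) (8 * J * (J + h₀) / δ) := by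
  rw [le_max_iff, or_iff_not_imp_left, not_le]
  intro hbig
  have hD0 : 1 ≤ D := by rw [hD]; exact_mod_cast Module.finrank_pos (R := ℚ) (M := K)
  have hm0 : 0 ≤ m := by rw [hm]; positivity
  have hl2 : 0 ≤ D * Real.log 2 := mul_nonneg (by linarith) (Real.log_nonneg (by norm_num))
  have hsub : ht u ≤ ht (1 - u) + D * Real.log 2 := by
    have h := ht_sub_le 1 (1 - u)
    have h1 : ht (1 : K) = 0 := by simp [ht, lp]
    rw [sub_sub_cancel, h1, ← hD] at h
    linarith
  obtain ⟨v₀, hv₀, hc⟩ := exists_lg_le T (w := 1 - u) (c := ht u / (2 * (D + m))) hD hm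
    (div_nonneg (ht_nonneg u) (by positivity)) hoff' (by
      have : (D + m) * (ht u / (2 * (D + m))) = ht u / 2 := by
        field_simp
      rw [this]; linarith)
  refine unit_bound hu T v₀ hv₀ hD hm hh₀ hoff ?_ (by linarith) hδ hLδ hE hL hLs hδ₀ hΛ ?_
  · rwa [← lg_neg, neg_sub]
  · refine lt_of_le_of_lt ?_ hJ
    have hpl : (plNorm v₀ : ℝ) ≤ N₀ := by
      rcases v₀ with φ | P
      · simpa [plNorm] using hN₀
      · exact hTN₀ P (hv₀ P rfl)
    have hδ0' : 0 ≤ δ₀ := by rw [hδ₀]; positivity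
    have hprod : 0 ≤ ∏ P ∈ T, (Real.log (Ideal.absNorm P.asIdeal) / δ₀ + 1) :=
      Finset.prod_nonneg fun P _ => by
        have := (log_absNorm_pos P).le
        positivity
    have hdisc : (1 : ℝ) ≤ |(discr K : ℝ)| := by
      exact_mod_cast Int.one_le_abs (discr_ne_zero K)
    have hΛ0 : 0 ≤ Λ := by
      rw [hΛ]
      refine Real.log_nonneg ?_
      have : (1 : ℝ) ≤ √|(discr K : ℝ)| := Real.one_le_sqrt.mpr hdisc
      linarith
    gcongr

end OffSum

section Global

variable {K : Type} [Field K] [NumberField K] {T : Finset (HeightOneSpectrum (𝓞 K))} {n : ℕ}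
  {a : ℕ → K} {δ x y : K} {N d t r ρ q h X Y : ℝ} {α₁ α₂ α₃ t₂ t₃ : K}

lemma Eqn.lp_root_le_lp_inv (E : Eqn K T n a δ x y N d t r ρ q h X Y) {α : K}
    (hα : ev n a α = 0) {P : HeightOneSpectrum (𝓞 K)} (hP : P ∉ T) :
    lp (.inr P) α ≤ lp (.inr P) (a 0)⁻¹ := by
  have h1 := lp_root_le (δ := δ) (le_trans (by norm_num) E.hn) E.ha0 hα (.inr P)
  rw [lA_inr_eq_zero (E.hδT P hP) fun j hj => E.haT j hj P hP] at h1
  have h2 := lg_le_lp (.inr P) (a 0)⁻¹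
  rw [lg_inv] at h2
  simp only [arch, zero_mul] at h1
  linarith

lemma Eqn.off_bounds (E : Eqn K T n a δ x y N d t r ρ q h X Y)
    (U : UnitData x α₁ α₂ α₃ t₂ t₃) (h1 : ev n a α₁ = 0) (h2 : ev n a α₂ = 0)
    (h3 : ev n a α₃ = 0) :
    offSum T (fun v => |lg v ((1 - t₂) / (1 - t₃))|)
      ≤ ht (a 0) + (ht (α₂ - α₁) + ht (α₃ - α₁)) ∧
    offSum T (fun v => lp v (1 - (1 - t₂) / (1 - t₃))⁻¹) ≤ ht (a 0) + ht (α₃ - α₂) := by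
  have hloc : ∀ P ∉ T, _ := fun P hP => U.local_bounds (P := P) (b := lp (.inr P) (a 0)⁻¹)
    (by rw [lp_inr_eq_zero (E.hxT P hP)]; exact lp_nonneg _ _)
    (E.lp_root_le_lp_inv h1 hP) (E.lp_root_le_lp_inv h2 hP) (E.lp_root_le_lp_inv h3 hP)
  have hle : ∀ (v : Pl K) (z : K), -lg v z ≤ lp v z⁻¹ := fun v z => by
    rw [← lg_inv]; exact lg_le_lp _ _
  constructor
  · have hs :
        (fun v : Pl K => lp v (a 0)⁻¹ + (lp v (α₂ - α₁)⁻¹ + lp v (α₃ - α₁)⁻¹)).HasFiniteSupport :=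
      (hasFiniteSupport_lp _).add (hasFiniteSupport_lp_add _ _)
    have hsum := finsum_add_distrib (hasFiniteSupport_lp (a 0)⁻¹)
      (hasFiniteSupport_lp_add (α₂ - α₁)⁻¹ (α₃ - α₁)⁻¹)
    rw [finsum_lp_add, ht_inv, ht_inv, ← ht, ht_inv] at hsum
    rw [← hsum]
    refine offSum_le_finsum (hasFiniteSupport_abs_lg _) hs (fun v => ?_) fun P hP => ?_
    · have := lp_nonneg v (a 0)⁻¹
      have := lp_nonneg v (α₂ - α₁)⁻¹
      have := lp_nonneg v (α₃ - α₁)⁻¹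
      positivity
    · obtain ⟨hu1, hu2, -⟩ := hloc P hP
      have e1 := hle (.inr P) (α₂ - α₁)
      have e2 := hle (.inr P) (α₃ - α₁)
      have e3 := lp_nonneg (.inr P) (α₂ - α₁)⁻¹
      have e4 := lp_nonneg (.inr P) (α₃ - α₁)⁻¹
      rw [abs_le]
      constructor <;> linarith
  · have hsum := finsum_lp_add (a 0)⁻¹ (α₃ - α₂)⁻¹
    rw [ht_inv, ht_inv] at hsum
    rw [← hsum]
    refine offSum_le_finsum (hasFiniteSupport_lp _) (hasFiniteSupport_lp_add _ _)
      (fun v => add_nonneg (lp_nonneg _ _) (lp_nonneg _ _)) fun P hP => ?_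
    obtain ⟨-, -, hw⟩ := hloc P hP
    have e1 := hle (.inr P) (α₃ - α₂)
    refine lp_le_of_le (add_nonneg (lp_nonneg _ _) (lp_nonneg _ _)) ?_
    rw [lg_inv, U.one_sub]
    linarith

/-- The off-`T` contributions are bounded by the height of the equation. -/
lemma Eqn.off_le (E : Eqn K T n a δ x y N d t r ρ q h X Y)
    (U : UnitData x α₁ α₂ α₃ t₂ t₃) (h1 : ev n a α₁ = 0) (h2 : ev n a α₂ = 0)
    (h3 : ev n a α₃ = 0) {D h₀ : ℝ} (hD : D = Module.finrank ℚ K)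
    (hh₀ : h₀ = 5 * (D * h) + D * (4 * Real.log n + 2 * Real.log 2)) :
    0 ≤ h₀ ∧ offSum T (fun v => |lg v ((1 - t₂) / (1 - t₃))|) ≤ h₀ ∧
    offSum T (fun v => lp v (1 - (1 - t₂) / (1 - t₃))⁻¹) ≤ h₀ := by
  obtain ⟨o1, o2⟩ := E.off_bounds U h1 h2 h3
  have hn1 : 1 ≤ n := le_trans (by norm_num) E.hn
  have r1 := ht_root_le (δ := δ) hn1 E.ha0 h1
  have r2 := ht_root_le (δ := δ) hn1 E.ha0 h2
  have r3 := ht_root_le (δ := δ) hn1 E.ha0 h3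
  have s21 := ht_sub_le α₂ α₁
  have s31 := ht_sub_le α₃ α₁
  have s32 := ht_sub_le α₃ α₂
  have ha := ht_coeff_le_hA (δ := δ) (a := a) (Nat.zero_le n)
  have hh := E.hh
  have hD0 : 0 ≤ D := by rw [hD]; positivity
  rw [← hD] at *
  have p1 := ht_nonneg (α₂ - α₁)
  have p2 := ht_nonneg (α₃ - α₁)
  have p3 := ht_nonneg (a 0)
  have hub : ht (a 0) + (ht (α₂ - α₁) + ht (α₃ - α₁)) ≤ h₀ := by rw [hh₀]; linarith
  have q0 : 0 ≤ hA n δ a := p3.trans ha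
  have l1 : 0 ≤ D * Real.log n := mul_nonneg hD0
    (Real.log_nonneg (by exact_mod_cast hn1))
  have l2 : 0 ≤ D * Real.log 2 := mul_nonneg hD0
    (Real.log_nonneg (by norm_num))
  refine ⟨by linarith, o1.trans hub, o2.trans ?_⟩
  rw [hh₀]; linarith

end Global

end HyperellipticBound

namespace HyperellipticBound

section BoxCount

lemma log_div_add_one_le {N δ₀ : ℝ} (h0 : 0 < δ₀) (h1 : δ₀ ≤ 1) :
    Real.log N / δ₀ + 1 ≤ Real.exp (Real.log (4 / δ₀) + Real.log N / 4) := by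
  rw [Real.exp_add, Real.exp_log (by positivity)]
  have h := Real.add_one_le_exp (Real.log N / 4)
  have h2 : (1 : ℝ) ≤ 1 / δ₀ := by rw [le_div_iff₀ h0]; linarith
  calc Real.log N / δ₀ + 1 ≤ Real.log N / δ₀ + 4 * (1 / δ₀) := by linarith
    _ = 4 / δ₀ * (Real.log N / 4 + 1) := by ring
    _ ≤ _ := by gcongr

lemma prod_log_div_add_one_le {ι : Type*} (T : Finset ι) {N : ι → ℝ} {δ₀ : ℝ}
    (hN : ∀ i ∈ T, 1 ≤ N i) (h0 : 0 < δ₀) (h1 : δ₀ ≤ 1) :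
    ∏ i ∈ T, (Real.log (N i) / δ₀ + 1)
      ≤ Real.exp (T.card * Real.log (4 / δ₀) + (∑ i ∈ T, Real.log (N i)) / 4) := by
  calc _ ≤ ∏ i ∈ T, Real.exp (Real.log (4 / δ₀) + Real.log (N i) / 4) :=
        Finset.prod_le_prod (fun i hi => by have := Real.log_nonneg (hN i hi); positivity)
          fun i hi => log_div_add_one_le h0 h1
    _ = _ := by
      rw [← Real.exp_sum, Finset.sum_add_distrib, Finset.sum_const, nsmul_eq_mul,
        Finset.sum_div]

lemma div_add_one_pow_le {Λ δ₀ : ℝ} {R : ℕ} (hΛ : 0 ≤ Λ) (hR : 1 ≤ R) (h0 : 0 < δ₀)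
    (h1 : δ₀ ≤ 1) :
    (Λ / δ₀ + 1) ^ R ≤ Real.exp (R * Real.log (8 * R / δ₀) + (Λ + 1) / 8) := by
  have hR' : (1 : ℝ) ≤ R := by exact_mod_cast hR
  have h2 : (1 : ℝ) ≤ 1 / δ₀ := by rw [le_div_iff₀ h0]; linarith
  have key : Λ / δ₀ + 1 ≤ Real.exp (Real.log (8 * R / δ₀) + (Λ + 1) / (8 * R)) := by
    rw [Real.exp_add, Real.exp_log (by positivity)]
    have h := Real.add_one_le_exp ((Λ + 1) / (8 * R))
    calc Λ / δ₀ + 1 ≤ Λ / δ₀ + 1 / δ₀ := by linarith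
      _ = 8 * R / δ₀ * ((Λ + 1) / (8 * R)) := by field_simp
      _ ≤ _ := by gcongr; linarith
  refine (pow_le_pow_left₀ (by positivity) key R).trans (le_of_eq ?_)
  rw [← Real.exp_nat_mul]
  congr 1
  field_simp

/-- The number of boxes in the pigeonhole argument. -/
lemma boxes_le {ι : Type*} (T : Finset ι) {N : ι → ℝ} {δ δ₀ Δ Λ D N₀ : ℝ} {R : ℕ}
    (hN : ∀ i ∈ T, 1 ≤ N i) (hδ : 0 < δ) (h0 : 0 < δ₀) (h1 : δ₀ ≤ 1) (hR : 1 ≤ R)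
    (hΔ : 1 ≤ Δ) (hΛ : Λ = Real.log (2 * √Δ)) (hN₀ : 0 < N₀) :
    (2 * √Δ) * √(2 * √Δ) * Real.exp (4 * D) * (∏ i ∈ T, (Real.log (N i) / δ₀ + 1))
      * (Λ / δ₀ + 1) ^ R * (27 / δ * N₀)
    ≤ Real.exp (3 / 2 * Λ + 4 * D
      + (T.card * Real.log (4 / δ₀) + (∑ i ∈ T, Real.log (N i)) / 4)
      + (R * Real.log (8 * R / δ₀) + (Λ + 1) / 8)
      + (Real.log (27 / δ) + Real.log N₀)) := by
  have hs : 1 ≤ √Δ := Real.one_le_sqrt.mpr hΔ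
  have hΛ0 : 0 ≤ Λ := by rw [hΛ]; exact Real.log_nonneg (by linarith)
  have he : 2 * √Δ = Real.exp Λ := by rw [hΛ, Real.exp_log (by positivity)]
  have he2 : √(2 * √Δ) = Real.exp (Λ / 2) := by rw [he, Real.exp_half]
  rw [he2, he, Real.exp_add, Real.exp_add, Real.exp_add, Real.exp_add,
    Real.exp_add (Real.log (27 / δ)), Real.exp_log (by positivity), Real.exp_log hN₀,
    ← Real.exp_add Λ, show Λ + Λ / 2 = 3 / 2 * Λ by ring]
  have hp := prod_log_div_add_one_le T hN h0 h1
  have hq := div_add_one_pow_le hΛ0 hR h0 h1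
  have hp0 : 0 ≤ ∏ i ∈ T, (Real.log (N i) / δ₀ + 1) :=
    Finset.prod_nonneg fun i hi => by have := Real.log_nonneg (hN i hi); positivity
  gcongr

end BoxCount

section Numerics

/-- The basic inequalities between the degrees and `Y = 4ns`. -/
structure Sizes (n s d t r D m R Y l : ℝ) : Prop where
  hn : 3 ≤ n
  hs : s = t + r
  ht : 0 ≤ t
  hr : 1 ≤ r
  hd0 : 0 ≤ d
  hd : d ≤ 2 * r
  hD0 : 1 ≤ D
  hD : D ≤ 4 * n ^ 3 * d
  hm0 : 0 ≤ m
  hm : m ≤ 4 * n ^ 3 * t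
  hR0 : 1 ≤ R
  hR : R ≤ 4 * n ^ 3 * r
  hY : Y = 4 * n * s
  hl : l = Real.log Y

namespace Sizes

variable {n s d t r D m R Y l : ℝ}

lemma one_le_s (S : Sizes n s d t r D m R Y l) : 1 ≤ s := by linarith [S.hs, S.ht, S.hr]

lemma twelve_le (S : Sizes n s d t r D m R Y l) : 12 ≤ Y := by
  have := S.one_le_s; have := S.hn; rw [S.hY]; nlinarith

lemma cube_le (S : Sizes n s d t r D m R Y l) : 64 * n ^ 3 * s ≤ Y ^ 3 := by
  have h1 := S.one_le_s
  have hn := S.hn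
  rw [S.hY, show (4 * n * s) ^ 3 = 64 * n ^ 3 * (s * s ^ 2) by ring, mul_assoc]
  rw [mul_assoc]
  have : s ≤ s * s ^ 2 := le_mul_of_one_le_right (by linarith) (one_le_pow₀ h1)
  gcongr

lemma D_add_m_le (S : Sizes n s d t r D m R Y l) : D + m ≤ 8 * n ^ 3 * s := by
  have hn := S.hn
  have h3 : 0 ≤ n ^ 3 := by positivity
  have := S.hD; have := S.hm; have := S.hd; have := S.ht
  rw [S.hs]
  nlinarith [mul_le_mul_of_nonneg_left S.hd h3, mul_nonneg h3 S.ht]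

lemma D_le (S : Sizes n s d t r D m R Y l) : D ≤ 8 * n ^ 3 * s := by
  linarith [S.D_add_m_le, S.hm0]

lemma m_add_R_le (S : Sizes n s d t r D m R Y l) : m + R ≤ 4 * n ^ 3 * s := by
  rw [S.hs]; linarith [S.hm, S.hR]

lemma l_ge (S : Sizes n s d t r D m R Y l) : 2 ≤ l := by
  rw [S.hl, Real.le_log_iff_exp_le (by linarith [S.twelve_le])]
  have h := Real.exp_one_lt_d9
  have : Real.exp 2 = Real.exp 1 * Real.exp 1 := by rw [← Real.exp_add]; norm_num
  nlinarith [S.twelve_le, Real.exp_pos 1]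

lemma l_le (S : Sizes n s d t r D m R Y l) : l ≤ Y / 4 + 1 := by
  have h12 := S.twelve_le
  have h1 : Real.log (Y / 4) ≤ Y / 4 - 1 := Real.log_le_sub_one_of_pos (by linarith)
  rw [Real.log_div (by linarith) (by norm_num), ← S.hl] at h1
  have h2 : Real.log 4 = 2 * Real.log 2 := by
    rw [show (4 : ℝ) = 2 ^ 2 by norm_num, Real.log_pow]; norm_num
  have := Real.log_two_lt_d9
  linarith

lemma log_n_le (S : Sizes n s d t r D m R Y l) : Real.log n + 2 * Real.log 2 ≤ l := by
  have hn := S.hn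
  have h2 : 2 * Real.log 2 = Real.log 4 := by
    rw [show (4 : ℝ) = 2 ^ 2 by norm_num, Real.log_pow]; norm_num
  rw [h2, S.hl, ← Real.log_mul (by linarith) (by norm_num)]
  refine Real.log_le_log (by linarith) ?_
  rw [S.hY]; nlinarith [S.one_le_s]

variable {δ δ₀ : ℝ} {L : ℕ}

lemma parameters (S : Sizes n s d t r D m R Y l) (hL : (L : ℝ) = Y ^ 6)
    (hδ : δ = (Y ^ 21)⁻¹) (hδ₀ : δ₀ = δ / (8 * (D + m))) :
    0 < δ ∧ 2000 * L * δ ≤ 1 ∧ Real.log (1 / δ) = 21 * l ∧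
    64 * (D + 1) * Real.log (1 / δ) ≤ L ∧ 1200000 * (L ^ 2 * δ * (D + m)) ≤ 1 ∧
    0 < δ₀ ∧ δ₀ ≤ 1 ∧ Real.log (1 / δ₀) ≤ 24 * l := by
  have h12 := S.twelve_le
  have hY : 0 < Y := by linarith
  have hDm := S.D_add_m_le
  have hc := S.cube_le
  have hD0 := S.hD0
  have hm0 := S.hm0
  have hDmY : 8 * (D + m) ≤ Y ^ 3 := by linarith
  have hδp : 0 < δ := by rw [hδ]; positivity
  have hlog : Real.log (1 / δ) = 21 * l := by
    rw [hδ, one_div, inv_inv, Real.log_pow, S.hl]; norm_num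
  refine ⟨hδp, ?_, hlog, ?_, ?_, by rw [hδ₀]; positivity, ?_, ?_⟩
  · rw [hL, hδ, mul_inv_le_iff₀ (by positivity), one_mul,
      show Y ^ 21 = Y ^ 15 * Y ^ 6 by ring]
    gcongr
    calc (2000 : ℝ) ≤ 12 ^ 15 := by norm_num
      _ ≤ Y ^ 15 := by gcongr
  · rw [hlog, hL]
    have hl := S.l_le
    have hl0 := S.l_ge
    have h3 : (1728 : ℝ) ≤ Y ^ 3 := by
      calc (1728 : ℝ) = 12 ^ 3 := by norm_num
        _ ≤ Y ^ 3 := by gcongr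
    have a1 : 64 * (D + 1) ≤ 9 * Y ^ 3 := by linarith
    have a2 : 21 * l ≤ 7 * Y := by linarith
    calc 64 * (D + 1) * (21 * l) ≤ 9 * Y ^ 3 * (7 * Y) := by gcongr
      _ = 63 * Y ^ 4 := by ring
      _ ≤ Y ^ 2 * Y ^ 4 := by gcongr; nlinarith
      _ = Y ^ 6 := by ring
  · rw [hL, hδ]
    have h6 : (150000 : ℝ) ≤ Y ^ 6 := by
      calc (150000 : ℝ) ≤ 12 ^ 6 := by norm_num
        _ ≤ Y ^ 6 := by gcongr
    calc 1200000 * ((Y ^ 6) ^ 2 * (Y ^ 21)⁻¹ * (D + m))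
        = 150000 * (8 * (D + m)) * (Y ^ 9)⁻¹ := by field_simp; ring
      _ ≤ Y ^ 6 * Y ^ 3 * (Y ^ 9)⁻¹ := by gcongr
      _ = 1 := by field_simp
  · rw [hδ₀, div_le_one (by positivity), hδ]
    refine (inv_le_one_of_one_le₀ (one_le_pow₀ (by linarith))).trans (by linarith)
  · rw [S.hl, show (24 : ℝ) * Real.log Y = Real.log (Y ^ 24) by rw [Real.log_pow]; norm_num]
    refine Real.log_le_log (by rw [hδ₀]; positivity) ?_
    rw [hδ₀, hδ]
    calc 1 / ((Y ^ 21)⁻¹ / (8 * (D + m))) = Y ^ 21 * (8 * (D + m)) := by field_simp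
      _ ≤ Y ^ 21 * Y ^ 3 := by gcongr
      _ = Y ^ 24 := by ring

/-- The exponent of the box count. -/
lemma exponent_le (S : Sizes n s d t r D m R Y l) {Λ G q₁ lΔ lQ h : ℝ} (hδp : 0 < δ)
    (hδ₀p : 0 < δ₀) (hδl : Real.log (1 / δ) = 21 * l) (hδ₀l : Real.log (1 / δ₀) ≤ 24 * l)
    (hh : 0 ≤ h)
    (hΛ : Λ ≤ Real.log 2 + G / 2)
    (hG : G = 4 * n ^ 3 * (lΔ + lQ + d * (2 * Real.log 2 + 5 * ((n + 1) * (h + Real.log n)))))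
    (hq₁ : q₁ ≤ 4 * n ^ 3 * lQ) :
    3 / 2 * Λ + 4 * D + (m * Real.log (4 / δ₀) + q₁ / 4)
      + (R * Real.log (8 * R / δ₀) + (Λ + 1) / 8) + (Real.log (27 / δ) + 4 * n ^ 3 * lQ)
    ≤ 23 * l + 80 * n ^ 4 * s * l + 13 / 4 * n ^ 3 * lΔ + 33 / 4 * n ^ 3 * lQ
      + 22 * n ^ 4 * (d * h) := by
  have hn := S.hn
  have hl0 := S.l_ge
  have h12 := S.twelve_le
  have hs := S.one_le_s
  have hR0 := S.hR0
  have hlog4 : Real.log 4 = 2 * Real.log 2 := by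
    rw [show (4 : ℝ) = 2 ^ 2 by norm_num, Real.log_pow]; norm_num
  have l2a := Real.log_two_lt_d9
  have l2b := Real.log_two_gt_d9
  have hln := S.log_n_le
  have e1 : m * Real.log (4 / δ₀) ≤ m * (27 * l) := by
    refine mul_le_mul_of_nonneg_left ?_ S.hm0
    rw [div_eq_mul_one_div, Real.log_mul (by norm_num) (by positivity)]
    linarith
  have e2 : R * Real.log (8 * R / δ₀) ≤ R * (27 * l) := by
    refine mul_le_mul_of_nonneg_left ?_ (by linarith)
    rw [div_eq_mul_one_div, Real.log_mul (by positivity) (by positivity)]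
    have : Real.log (8 * R) ≤ 3 * l := by
      rw [S.hl, show (3 : ℝ) * Real.log Y = Real.log (Y ^ 3) by rw [Real.log_pow]; norm_num]
      refine Real.log_le_log (by positivity) ?_
      have := S.m_add_R_le; have := S.hm0; have := S.cube_le
      have : 0 ≤ n ^ 3 * s := by positivity
      linarith
    linarith
  have e3 : Real.log (27 / δ) + 13 / 8 * Real.log 2 + 1 / 8 ≤ 23 * l := by
    rw [div_eq_mul_one_div, Real.log_mul (by norm_num) (by positivity), hδl]
    have h1 : Real.log 27 + 2 * Real.log 2 ≤ 2 * l := by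
      rw [← hlog4, ← Real.log_mul (by norm_num) (by norm_num), S.hl,
        show (2 : ℝ) * Real.log Y = Real.log (Y ^ 2) by rw [Real.log_pow]; norm_num]
      exact Real.log_le_log (by norm_num) (by nlinarith)
    linarith
  have e4 : (m + R) * (27 * l) ≤ 36 * n ^ 4 * s * l := by
    calc (m + R) * (27 * l) ≤ 4 * n ^ 3 * s * (27 * l) := by
          have := S.m_add_R_le; gcongr
      _ = 36 * (3 * n ^ 3) * s * l := by ring
      _ ≤ 36 * (n * n ^ 3) * s * l := by gcongr
      _ = _ := by ring
  have hlog : 0 ≤ Real.log n := Real.log_nonneg (by linarith)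
  have e5 : d * (2 * Real.log 2 + 5 * ((n + 1) * Real.log n)) ≤
      2 * s * (5 * ((n + 1) * l) - 26) := by
    have hd : d ≤ 2 * s := by linarith [S.hd, S.hs, S.ht]
    have : (n + 1) * (2 * Real.log 2) ≥ 4 * (2 * Real.log 2) := by gcongr; linarith
    have h1 : (n + 1) * Real.log n ≤ (n + 1) * (l - 2 * Real.log 2) := by gcongr; linarith
    have h2 : 2 * Real.log 2 + 5 * ((n + 1) * Real.log n) ≤ 5 * ((n + 1) * l) - 26 := by
      nlinarith
    have h3 : 0 ≤ 2 * Real.log 2 + 5 * ((n + 1) * Real.log n) := by positivity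
    calc _ ≤ 2 * s * (2 * Real.log 2 + 5 * ((n + 1) * Real.log n)) := by gcongr
      _ ≤ _ := by gcongr
  have e6 : 4 * D ≤ 32 * n ^ 3 * s := by linarith [S.D_le]
  have e7 : 13 / 16 * (4 * n ^ 3 * (d * (2 * Real.log 2 + 5 * ((n + 1) * Real.log n))))
      ≤ 44 * n ^ 4 * s * l - 32 * n ^ 3 * s := by
    have h1 : 13 / 16 * (4 * n ^ 3 * (d * (2 * Real.log 2 + 5 * ((n + 1) * Real.log n)))) ≤
        13 / 16 * (4 * n ^ 3 * (2 * s * (5 * ((n + 1) * l) - 26))) := by gcongr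
    have h2 : (n + 1) * (n ^ 3 * s * l) ≤ 4 / 3 * n * (n ^ 3 * s * l) := by
      gcongr; linarith
    have h3 : 0 ≤ n ^ 3 * s := by positivity
    have h4 : 0 ≤ n ^ 4 * s * l := by positivity
    nlinarith
  have e8 : 13 / 16 * (4 * n ^ 3 * (d * (5 * ((n + 1) * h)))) ≤ 22 * n ^ 4 * (d * h) := by
    have h2 : (n + 1) * (n ^ 3 * (d * h)) ≤ 4 / 3 * n * (n ^ 3 * (d * h)) := by
      have := S.hd0
      gcongr; linarith
    have h4 : 0 ≤ n ^ 4 * (d * h) := by have := S.hd0; positivity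
    nlinarith
  have hG' : 13 / 16 * G = 13 / 4 * n ^ 3 * lΔ + 13 / 4 * n ^ 3 * lQ
      + 13 / 16 * (4 * n ^ 3 * (d * (2 * Real.log 2 + 5 * ((n + 1) * Real.log n))))
      + 13 / 16 * (4 * n ^ 3 * (d * (5 * ((n + 1) * h)))) := by rw [hG]; ring
  linarith

end Sizes

end Numerics

end HyperellipticBound

namespace HyperellipticBound

namespace Sizes

variable {n s d t r D m R Y l δ : ℝ}

lemma h₀_le (S : Sizes n s d t r D m R Y l) {h h₀ : ℝ} (hh : 0 ≤ h)
    (hh₀ : h₀ = 5 * (D * h) + D * (4 * Real.log n + 2 * Real.log 2)) :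
    h₀ + D * Real.log 2 + (D + m) ≤ 7 * n ^ 4 * (d * h) + 20 * n ^ 4 * s * l := by
  have hn := S.hn
  have hl0 := S.l_ge
  have hs := S.one_le_s
  have hD0 := S.hD0
  have hd0 := S.hd0
  have l2a := Real.log_two_gt_d9
  have hln := S.log_n_le
  have h1 : D * h ≤ 4 / 3 * n ^ 4 * (d * h) := by
    calc D * h ≤ 4 * n ^ 3 * d * h := by have := S.hD; gcongr
      _ = 4 / 3 * (3 * n ^ 3) * (d * h) := by ring
      _ ≤ 4 / 3 * (n * n ^ 3) * (d * h) := by gcongr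
      _ = _ := by ring
  have h2 : D * (4 * l) ≤ 32 / 3 * n ^ 4 * s * l := by
    calc D * (4 * l) ≤ 8 * n ^ 3 * s * (4 * l) := by have := S.D_le; gcongr
      _ = 32 / 3 * (3 * n ^ 3) * s * l := by ring
      _ ≤ 32 / 3 * (n * n ^ 3) * s * l := by gcongr
      _ = _ := by ring
  have h3 : D * (4 * Real.log n + 2 * Real.log 2) + D * Real.log 2 ≤ D * (4 * l) := by
    rw [← mul_add]; gcongr; linarith
  have h4 : D + m ≤ 4 / 3 * n ^ 4 * s * l := by
    calc D + m ≤ 8 * n ^ 3 * s := S.D_add_m_le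
      _ = 4 / 3 * (3 * n ^ 3) * s * 2 := by ring
      _ ≤ 4 / 3 * (n * n ^ 3) * s * l := by gcongr
      _ = _ := by ring
  have h5 : 0 ≤ n ^ 4 * s * l := by positivity
  have h6 : 0 ≤ n ^ 4 * (d * h) := by positivity
  rw [hh₀]
  linarith

lemma max_le_exp (S : Sizes n s d t r D m R Y l) {lΔ lQ h h₀ J U Hx Hy e : ℝ} (hd1 : 1 ≤ d)
    (hh : 0 ≤ h) (hlΔ : 0 ≤ lΔ) (hlQ : 0 ≤ lQ) (hδ : δ = (Y ^ 21)⁻¹)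
    (hh₀ : h₀ = 5 * (D * h) + D * (4 * Real.log n + 2 * Real.log 2))
    (he : e = 23 * l + 80 * n ^ 4 * s * l + 13 / 4 * n ^ 3 * lΔ + 33 / 4 * n ^ 3 * lQ
      + 22 * n ^ 4 * (d * h)) (hJ0 : 0 ≤ J) (hJ : J ≤ Real.exp e)
    (hU : U ≤ max (2 * (h₀ + D * Real.log 2) + 2 * (D + m)) (8 * J * (J + h₀) / δ))
    (hX : D * Hx ≤ 9 * U + 17 * (D * h + D * Real.log n) + 19 * (D * Real.log 2))
    (hHy : Hy ≤ h + n * Hx / 2 + Real.log (n + 1) / 2) :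
    max Hx Hy ≤ Real.exp (2 * e + 25 * l) := by
  have hn := S.hn
  have hl0 := S.l_ge
  have hs := S.one_le_s
  have hD0 := S.hD0
  have h12 := S.twelve_le
  have l2 : 0 < Real.log 2 := Real.log_pos (by norm_num)
  have hln := S.log_n_le
  have hlog : 0 ≤ Real.log n := Real.log_nonneg (by linarith)
  have hb := S.h₀_le hh hh₀
  have hn3 : 0 ≤ n ^ 3 := by positivity
  have hn4 : (81 : ℝ) ≤ n ^ 4 := by
    calc (81 : ℝ) = 3 ^ 4 := by norm_num
      _ ≤ n ^ 4 := by gcongr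
  have hn4n : n ≤ n ^ 4 := le_self_pow₀ (by linarith) (by norm_num)
  have p1 : 0 ≤ 13 / 4 * n ^ 3 * lΔ := by positivity
  have p2 : 0 ≤ 33 / 4 * n ^ 3 * lQ := by positivity
  have p3 : n ^ 4 * l ≤ n ^ 4 * s * l := by
    gcongr; exact le_mul_of_one_le_right (by positivity) hs
  have p4 : 81 * h ≤ n ^ 4 * (d * h) := by
    gcongr; exact le_mul_of_one_le_left hh hd1
  have p5 : 81 * l ≤ n ^ 4 * l := by gcongr
  have p6 : n * 2 ≤ n ^ 4 * l := by gcongr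
  set A := Real.exp e with hA
  have hA1 : e + 1 ≤ A := Real.add_one_le_exp e
  have hA0 : 1 ≤ A := by linarith
  have hh₀A : h₀ ≤ A := by
    have : 0 ≤ D * Real.log 2 := by positivity
    linarith [S.hm0]
  have hh₀0 : 0 ≤ h₀ := by rw [hh₀]; positivity
  set B := 16 * A ^ 2 * Y ^ 21 with hB
  have hY21 : 1 ≤ Y ^ 21 := one_le_pow₀ (by linarith)
  have hAB : A ≤ B := by
    calc A = 1 * A * 1 := by ring
      _ ≤ 16 * A ^ 2 * Y ^ 21 := by gcongr; norm_num; exact le_self_pow₀ hA0 (by norm_num)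
  have hUB : U ≤ B := by
    refine hU.trans (max_le ?_ ?_)
    · linarith
    · rw [hδ, div_inv_eq_mul]
      calc 8 * J * (J + h₀) * Y ^ 21 ≤ 8 * A * (A + A) * Y ^ 21 := by gcongr
        _ = B := by rw [hB]; ring
  have hXB : Hx ≤ 10 * B := by
    have h1 : D * Hx ≤ D * (9 * B + 17 * (h + Real.log n) + 19 * Real.log 2) := by
      have : B ≤ D * B := le_mul_of_one_le_left (by linarith) hD0
      linarith
    have h2 := le_of_mul_le_mul_left h1 (by linarith)
    linarith
  have hYB : Hy ≤ 6 * n * B := by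
    have h1 : Real.log (n + 1) ≤ n := by
      have := Real.log_le_sub_one_of_pos (x := n + 1) (by linarith)
      linarith
    have h2 : n * Hx ≤ n * (10 * B) := by gcongr
    have h3 : B ≤ n * B := le_mul_of_one_le_left (by linarith) (by linarith)
    linarith
  have hexp : Real.exp (2 * e + 25 * l) = A ^ 2 * Y ^ 25 := by
    rw [Real.exp_add, two_mul, Real.exp_add, ← hA, S.hl, ← Real.log_rpow (by linarith),
      Real.exp_log (by positivity), sq]
    norm_cast
  have hnY : 4 * n ≤ Y := by
    rw [S.hY]; exact le_mul_of_one_le_right (by linarith) hs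
  have hfin : ∀ c : ℝ, c ≤ 10 * n → c * B ≤ Real.exp (2 * e + 25 * l) := by
    intro c hc
    have h1 : 16 * c ≤ Y ^ 4 := by
      calc 16 * c ≤ 40 * Y := by linarith
        _ ≤ Y ^ 3 * Y := by
          gcongr
          calc (40 : ℝ) ≤ 12 ^ 3 := by norm_num
            _ ≤ Y ^ 3 := by gcongr
        _ = Y ^ 4 := by ring
    rw [hexp, hB]
    calc c * (16 * A ^ 2 * Y ^ 21) = 16 * c * (A ^ 2 * Y ^ 21) := by ring
      _ ≤ Y ^ 4 * (A ^ 2 * Y ^ 21) := by gcongr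
      _ = _ := by ring
  exact max_le (hXB.trans (hfin 10 (by linarith))) (hYB.trans (hfin (6 * n) (by linarith)))

end Sizes

/-- The exponential bound in the shape of the theorem. -/
lemma exp_le_final {n s : ℕ} {d h Δ Q l e : ℝ} (hn : 3 ≤ n) (hs : 1 ≤ s) (hd : 0 ≤ d)
    (hh : 0 ≤ h) (hΔ : 1 ≤ Δ) (hQ : 1 ≤ Q) (hl : l = Real.log (4 * n * s)) (hl0 : 0 ≤ l)
    (he : e = 23 * l + 80 * n ^ 4 * s * l + 13 / 4 * n ^ 3 * Real.log Δ
      + 33 / 4 * n ^ 3 * Real.log Q + 22 * n ^ 4 * (d * h)) :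
    Real.exp (2 * e + 25 * l) ≤ (4 * (n : ℝ) * s) ^ (212 * n ^ 4 * s) * Δ ^ (8 * n ^ 3)
      * Q ^ (20 * n ^ 3) * Real.exp (50 * (n : ℝ) ^ 4 * d * h) := by
  have hn' : (3 : ℝ) ≤ n := by exact_mod_cast hn
  have hs' : (1 : ℝ) ≤ s := by exact_mod_cast hs
  have hpow : ∀ (z : ℝ) (k : ℕ), 0 < z → z ^ k = Real.exp (k * Real.log z) := fun z k hz => by
    rw [Real.exp_nat_mul, Real.exp_log hz]
  rw [hpow (4 * n * s) _ (by positivity), hpow Δ _ (by linarith), hpow Q _ (by linarith),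
    ← Real.exp_add, ← Real.exp_add, ← Real.exp_add, ← hl, Real.exp_le_exp]
  push_cast
  have hΔ0 := Real.log_nonneg hΔ
  have hQ0 := Real.log_nonneg hQ
  have h1 : 0 ≤ (n : ℝ) ^ 3 * Real.log Δ := by positivity
  have h2 : 0 ≤ (n : ℝ) ^ 3 * Real.log Q := by positivity
  have h3 : 0 ≤ (n : ℝ) ^ 4 * (d * h) := by positivity
  have h4 : 81 * l ≤ (n : ℝ) ^ 4 * s * l := by
    gcongr
    calc (81 : ℝ) = 3 ^ 4 * 1 := by norm_num
      _ ≤ n ^ 4 * s := by gcongr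
  rw [he]
  linarith

end HyperellipticBound

namespace HyperellipticBound

variable {K : Type} [Field K] [NumberField K] {T : Finset (HeightOneSpectrum (𝓞 K))} {n : ℕ}
  {a : ℕ → K} {δ x y : K} {N d t r ρ q h X Y : ℝ} {α₁ α₂ α₃ t₂ t₃ : K}

lemma ht_div_le (z w : K) : ht (z / w) ≤ ht z + ht w := by
  rw [div_eq_mul_inv, ← ht_inv w]; exact ht_mul_le z w⁻¹

lemma wHeight_y_le (hδ0 : δ ≠ 0) (heq : ev n a x = δ * y ^ 2) {D : ℝ}
    (hD : D = Module.finrank ℚ K) :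
    2 * ht y ≤ 2 * hA n δ a + n * ht x + D * Real.log (n + 1) := by
  have h1 : ht (y ^ 2) ≤ ht (ev n a x) + ht δ := by
    rw [show y ^ 2 = ev n a x / δ by rw [heq]; field_simp]
    exact ht_div_le _ _
  rw [ht_pow] at h1
  have h2 := ht_ev_le (n := n) (δ := δ) (a := a) x
  have h3 := ht_le_hA (n := n) (δ := δ) (a := a)
  rw [← hD] at h2
  push_cast at h1 h2
  linarith

lemma Eqn.h_nonneg (E : Eqn K T n a δ x y N d t r ρ q h X Y) : 0 ≤ h := by
  have h1 := hA_nonneg (n := n) (δ := δ) (a := a)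
  exact nonneg_of_mul_nonneg_right (h1.trans E.hh) finrank_pos_real

lemma Eqn.sizes (E : Eqn K T n a δ x y (4 * n ^ 3) d t r ρ q h X Y) {s : ℝ} (hs : s = t + r)
    (ht0 : 0 ≤ t) (hr : 1 ≤ r) (hd0 : 0 ≤ d) (hd : d ≤ 2 * r) :
    Sizes n s d t r (Module.finrank ℚ K) T.card (Fintype.card (InfinitePlace K)) (4 * n * s)
      (Real.log (4 * n * s)) where
  hn := by exact_mod_cast E.hn
  hs := hs
  ht := ht0
  hr := hr
  hd0 := hd0
  hd := hd
  hD0 := by exact_mod_cast Module.finrank_pos (R := ℚ) (M := K)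
  hD := E.hN
  hm0 := Nat.cast_nonneg _
  hm := E.hNt
  hR0 := by exact_mod_cast Fintype.card_pos (α := InfinitePlace K)
  hR := E.hNr
  hY := rfl
  hl := rfl

theorem Eqn.max_le (E : Eqn K T n a δ x y (4 * n ^ 3) d t r ρ q h X Y)
    (U : UnitData x α₁ α₂ α₃ t₂ t₃) (h1 : ev n a α₁ = 0) (h2 : ev n a α₂ = 0)
    (h3 : ev n a α₃ = 0) {s : ℕ} {l lΔ lQ e : ℝ} (hs : (s : ℝ) = t + r) (ht0 : 0 ≤ t)
    (hr : 1 ≤ r) (hd1 : 1 ≤ d) (hd : d ≤ 2 * r) (hl : l = Real.log (4 * n * s))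
    (hρ0 : 0 ≤ ρ) (hlΔ : 0 ≤ lΔ) (hlQ : 0 ≤ lQ) (hq0 : 0 ≤ q)
    (hρd : d * ρ = lΔ + lQ + d * (2 * Real.log 2 + 5 * ((n + 1) * (h + Real.log n))))
    (hqd : d * q = lQ)
    (he : e = 23 * l + 80 * n ^ 4 * s * l + 13 / 4 * n ^ 3 * lΔ + 33 / 4 * n ^ 3 * lQ
      + 22 * n ^ 4 * (d * h)) :
    max X Y ≤ Real.exp (2 * e + 25 * l) := by
  have S := E.sizes hs ht0 hr (by linarith) hd
  have hh := E.h_nonneg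
  obtain ⟨D, hD⟩ : ∃ D : ℝ, D = Module.finrank ℚ K := ⟨_, rfl⟩
  obtain ⟨m, hm⟩ : ∃ m : ℝ, m = T.card := ⟨_, rfl⟩
  rw [← hD, ← hm, ← hl] at S
  obtain ⟨h₀, hh₀⟩ : ∃ h₀, h₀ = 5 * (D * h) + D * (4 * Real.log n + 2 * Real.log 2) := ⟨_, rfl⟩
  obtain ⟨o0, o1, o2⟩ := E.off_le U h1 h2 h3 hD hh₀
  obtain ⟨η, hη⟩ : ∃ η : ℝ, η = ((4 * (n : ℝ) * s) ^ 21)⁻¹ := ⟨_, rfl⟩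
  obtain ⟨η₀, hη₀⟩ : ∃ η₀ : ℝ, η₀ = η / (8 * (D + m)) := ⟨_, rfl⟩
  obtain ⟨Λ, hΛ⟩ : ∃ Λ : ℝ, Λ = Real.log (2 * √|(discr K : ℝ)|) := ⟨_, rfl⟩
  obtain ⟨hηp, p1, p2, p3, p4, hη₀p, p5, p6⟩ :=
    S.parameters (L := (4 * n * s) ^ 6) (by push_cast; ring) hη hη₀
  have hdisc : (1 : ℝ) ≤ |(discr K : ℝ)| := by
    exact_mod_cast Int.one_le_abs (discr_ne_zero K)
  have hDq : D * q ≤ 4 * n ^ 3 * lQ := by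
    rw [← hqd, ← mul_assoc]; exact mul_le_mul_of_nonneg_right S.hD hq0
  have hTq : ∑ P ∈ T, Real.log (Ideal.absNorm P.asIdeal) ≤ 4 * n ^ 3 * lQ :=
    (hD ▸ E.hq).trans hDq
  have hΛ' : Λ ≤ Real.log 2 + (D * ρ) / 2 := by
    rw [hΛ, Real.log_mul (by norm_num) (by positivity), Real.log_sqrt (abs_nonneg _)]
    have := E.hρ
    rw [← hD] at this
    linarith
  have hΛG : Λ ≤ Real.log 2 + (4 * n ^ 3 *
      (lΔ + lQ + d * (2 * Real.log 2 + 5 * ((n + 1) * (h + Real.log n))))) / 2 := by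
    refine hΛ'.trans ?_
    rw [← hρd, ← mul_assoc]
    have := mul_le_mul_of_nonneg_right S.hD hρ0
    linarith
  have hboxes := boxes_le T (N := fun P => (Ideal.absNorm P.asIdeal : ℝ)) (D := D)
    (N₀ := Real.exp (4 * n ^ 3 * lQ)) (R := Fintype.card (InfinitePlace K)) (fun P _ => by
      have := two_le_absNorm P
      exact_mod_cast (by omega : 1 ≤ Ideal.absNorm P.asIdeal)) hηp hη₀p p5 Fintype.card_pos hdisc
    hΛ (Real.exp_pos _)
  rw [← hm, Real.log_exp] at hboxes
  replace hboxes := hboxes.trans (Real.exp_le_exp.mpr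
    (S.exponent_le hηp hη₀p p2 p6 hh hΛG rfl hTq))
  rw [← he] at hboxes
  have hu : ht ((1 - t₂) / (1 - t₃)) ≤ _ := ht_le_of_offSum
    (div_ne_zero U.ne₂.1 U.ne₃.1) T (h₀ := h₀) (δ := η) (δ₀ := η₀) (D := D) (m := m) (Λ := Λ)
    (L := (4 * n * s) ^ 6) (J := ⌊Real.exp e⌋₊) (N₀ := Real.exp (4 * n ^ 3 * lQ))
    hD hm o0 o1 o2 hηp p1 (by rw [p2]; linarith [S.l_ge]) p3 p4 hη₀ hΛ
    (Real.one_le_exp (by positivity)) (fun P hP => by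
      have hN0 : (0 : ℝ) < Ideal.absNorm P.asIdeal := by
        have := two_le_absNorm P
        exact_mod_cast (by omega : 0 < Ideal.absNorm P.asIdeal)
      rw [← Real.log_le_iff_le_exp hN0]
      exact (Finset.single_le_sum (f := fun P : HeightOneSpectrum (𝓞 K) =>
        Real.log (Ideal.absNorm P.asIdeal)) (fun P _ => (log_absNorm_pos P).le) hP).trans hTq)
    (hboxes.trans_lt (Nat.lt_floor_add_one _))
  have hn1 : 1 ≤ n := le_trans (by norm_num) E.hn
  have hAh := E.hh
  rw [← hD] at hAh
  have hroot : ∀ α, ev n a α = 0 → ht α ≤ D * h + D * Real.log n := fun α hα => by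
    have := ht_root_le (δ := δ) hn1 E.ha0 hα
    rw [← hD] at this
    linarith
  have hx := U.ht_le hD (hroot _ h1) (hroot _ h2) (hroot _ h3)
  have hy := wHeight_y_le E.hδ0 E.heq hD
  rw [E.hX, ← hD] at hx hy
  rw [E.hY, ← hD] at hy
  refine S.max_le_exp hd1 hh hlΔ hlQ hη hh₀ he (Nat.cast_nonneg _)
    (Nat.floor_le (Real.exp_pos _).le) hu hx ?_
  refine le_of_mul_le_mul_left (a := 2 * D) ?_ (by linarith [S.hD0])
  linarith

end HyperellipticBound

namespace HyperellipticBound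

section Base

variable {K : Type} [Field K] [NumberField K] {T : Finset (HeightOneSpectrum (𝓞 K))} {n : ℕ}
  {a : ℕ → K} {δ x y : K}

lemma sum_log_absNorm_le {Q : ℕ} (hQ : (T = ∅ ∧ Q = 2) ∨
      (T.Nonempty ∧ Q = Ideal.absNorm (∏ v ∈ T, v.asIdeal))) :
    1 ≤ (Q : ℝ) ∧ ∑ P ∈ T, Real.log (Ideal.absNorm P.asIdeal) ≤ Real.log Q := by
  rcases hQ with ⟨rfl, rfl⟩ | ⟨-, rfl⟩
  · exact ⟨by norm_num, by simpa using Real.log_nonneg (by norm_num)⟩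
  · have h := log_absNorm_prod T fun _ => 1
    simp only [pow_one, Nat.cast_one, one_mul] at h
    refine ⟨?_, h.ge⟩
    rw [map_prod]
    exact_mod_cast Finset.one_le_prod' fun P _ => one_le_two.trans (two_le_absNorm P)

lemma finrank_le_two_mul_card_infinitePlace :
    (Module.finrank ℚ K : ℝ) ≤ 2 * Fintype.card (InfinitePlace K) := by
  rw [← InfinitePlace.sum_mult_eq, Nat.cast_sum]
  refine (Finset.sum_le_card_nsmul _ _ 2 fun w _ => ?_).trans (le_of_eq ?_)
  · rw [InfinitePlace.mult]; split_ifs <;> norm_num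
  · rw [Finset.card_univ, nsmul_eq_mul, mul_comm]

lemma wHeight_zero : wHeight (0 : K) = 0 := by
  have h := finrank_mul_wHeight (0 : K)
  simpa [ht, lp, (finrank_pos_real (K := K)).ne'] using h

lemma wHeight_root_le (hn : 1 ≤ n) (ha0 : a 0 ≠ 0) (hx : ev n a x = 0) :
    wHeight x ≤ hhat n δ a + Real.log n := by
  have h1 := ht_root_le (δ := δ) hn ha0 hx
  have h2 := hA_le_finrank_mul_hhat (n := n) (δ := δ) (a := a)
  rw [← finrank_mul_wHeight] at h1
  refine le_of_mul_le_mul_left (a := (Module.finrank ℚ K : ℝ)) ?_ finrank_pos_real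
  linarith

lemma hhat_nonneg : 0 ≤ hhat n δ a :=
  nonneg_of_mul_nonneg_right (hA_nonneg.trans hA_le_finrank_mul_hhat) (finrank_pos_real (K := K))

lemma max_wHeight_le (hn : 3 ≤ n) (ha0 : a 0 ≠ 0) (hdisc : binDisc n a ≠ 0)
    (haT : ∀ j ≤ n, ∀ P ∉ T, 0 ≤ ordAt P (a j)) (hδ0 : δ ≠ 0)
    (hδT : ∀ P ∉ T, 0 ≤ ordAt P δ) (hxT : ∀ P ∉ T, 0 ≤ ordAt P x)
    (heq : ev n a x = δ * y ^ 2) {s : ℕ} (hs : s = T.card + Fintype.card (InfinitePlace K))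
    {l lQ e d h : ℝ} (hd : d = Module.finrank ℚ K) (hh : h = hhat n δ a)
    (hl : l = Real.log (4 * n * s)) (hlQ0 : 0 ≤ lQ)
    (hlQ : ∑ P ∈ T, Real.log (Ideal.absNorm P.asIdeal) ≤ lQ)
    (he : e = 23 * l + 80 * n ^ 4 * s * l + 13 / 4 * n ^ 3 * Real.log |(discr K : ℝ)|
      + 33 / 4 * n ^ 3 * lQ + 22 * n ^ 4 * (d * h)) :
    max (wHeight x) (wHeight y) ≤ Real.exp (2 * e + 25 * l) := by
  have hdisc1 : (1 : ℝ) ≤ |(discr K : ℝ)| := by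
    exact_mod_cast Int.one_le_abs (discr_ne_zero K)
  have hlΔ := Real.log_nonneg hdisc1
  have hd1 : 1 ≤ d := by rw [hd]; exact_mod_cast Module.finrank_pos (R := ℚ) (M := K)
  have hh0 : 0 ≤ h := hh ▸ hhat_nonneg
  have hr : 1 ≤ (Fintype.card (InfinitePlace K) : ℝ) := by
    exact_mod_cast Fintype.card_pos (α := InfinitePlace K)
  have hn' : (3 : ℝ) ≤ n := by exact_mod_cast hn
  have hlog := Real.log_nonneg (by linarith : (1 : ℝ) ≤ n)
  have hl2 := Real.log_nonneg one_le_two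
  rcases eq_or_ne y 0 with rfl | hy0
  · have hx := wHeight_root_le (δ := δ) (le_trans (by norm_num) hn) ha0 (x := x)
      (by rw [heq]; simp)
    rw [wHeight_zero]
    refine max_le (hx.trans ?_) (Real.exp_pos _).le
    refine le_trans ?_ (Real.add_one_le_exp _)
    have hs1 : (1 : ℝ) ≤ s := by
      rw [hs]; push_cast; linarith [(Nat.cast_nonneg T.card : (0 : ℝ) ≤ _)]
    have hln : Real.log n ≤ l := by
      rw [hl]
      refine Real.log_le_log (by linarith) ?_
      nlinarith
    have hl0 : 0 ≤ l := hlog.trans hln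
    have p0 : h ≤ n ^ 4 * (d * h) := by
      have : h ≤ d * h := le_mul_of_one_le_left hh0 hd1
      exact this.trans (le_mul_of_one_le_left (by positivity) (one_le_pow₀ (by linarith)))
    have p1 : 0 ≤ (n : ℝ) ^ 3 * Real.log |(discr K : ℝ)| := by positivity
    have p2 : 0 ≤ (n : ℝ) ^ 3 * lQ := by positivity
    have p3 : 0 ≤ (n : ℝ) ^ 4 * s * l := by positivity
    rw [← hh]
    linarith
  · have hd0 : d ≠ 0 := by linarith
    have E : Eqn K T n a δ x y 1 d T.card (Fintype.card (InfinitePlace K))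
        (Real.log |(discr K : ℝ)| / d) (lQ / d) h (wHeight x) (wHeight y) :=
      { hn := hn, ha0 := ha0, hδ0 := hδ0, hy0 := hy0, hdisc := hdisc, haT := haT, hδT := hδT
        hxT := hxT, heq := heq
        hN := by rw [hd, one_mul]
        hNt := by rw [one_mul]
        hNr := by rw [one_mul]
        hρ := by rw [← hd, mul_div_cancel₀ _ hd0]
        hq := by rwa [← hd, mul_div_cancel₀ _ hd0]
        hh := by rw [hh]; exact hA_le_finrank_mul_hhat
        hX := (finrank_mul_wHeight x).symm
        hY := (finrank_mul_wHeight y).symm }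
    obtain ⟨M, _, _, T', a', δ', x', y', α₁, α₂, α₃, τ₂, τ₃, E', r1, r2, r3, n12, n13, n23,
      s2, s3⟩ := E.exists_tower
    rw [one_mul] at E'
    refine E'.max_le ⟨n12, n13, n23, E'.sub_ne_zero r1, E'.sub_ne_zero r2, E'.sub_ne_zero r3,
      s2, s3⟩ r1 r2 r3 (by rw [hs]; push_cast; rfl) (Nat.cast_nonneg _) hr hd1
      (by rw [hd]; exact finrank_le_two_mul_card_infinitePlace) hl ?_ hlΔ hlQ0 ?_ ?_ ?_ he
    · positivity
    · positivity
    · field_simp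
      ring
    · field_simp

end Base

end HyperellipticBound

/-- **Proposition 6.5** (Theorem 2.2 of Bérczes–Evertse–Győry): effective bounds for
hyperelliptic equations over the `S`-integers of a number field. -/
theorem hyperelliptic_number_field_bound
    (L : Type) [Field L] [NumberField L]
    (T : Finset (HeightOneSpectrum (𝓞 L)))
    (s : ℕ) (hs : s = T.card + Fintype.card (InfinitePlace L))
    (Q : ℕ)
    (hQ : (T = ∅ ∧ Q = 2) ∨
      (T.Nonempty ∧ Q = Ideal.absNorm (∏ v ∈ T, v.asIdeal)))
    (n : ℕ) (hn : 3 ≤ n)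
    (a : ℕ → L) (ha0 : a 0 ≠ 0) (hdisc : binDisc n a ≠ 0)
    (haS : ∀ i, i ≤ n → ∀ v : HeightOneSpectrum (𝓞 L), v ∉ T → 0 ≤ ordAt v (a i))
    (δ : L) (hδ0 : δ ≠ 0)
    (hδS : ∀ v : HeightOneSpectrum (𝓞 L), v ∉ T → 0 ≤ ordAt v δ)
    (x y : L)
    (hx : ∀ v : HeightOneSpectrum (𝓞 L), v ∉ T → 0 ≤ ordAt v x)
    (hy : ∀ v : HeightOneSpectrum (𝓞 L), v ∉ T → 0 ≤ ordAt v y)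
    (heq : (∑ j ∈ Finset.range (n + 1), a j * x ^ (n - j)) = δ * y ^ 2) :
    max (wHeight x) (wHeight y) ≤
      (4 * (n : ℝ) * s) ^ (212 * n ^ 4 * s) *
        ((|NumberField.discr L| : ℤ) : ℝ) ^ (8 * n ^ 3) *
        (Q : ℝ) ^ (20 * n ^ 3) *
        Real.exp (50 * (n : ℝ) ^ 4 * (Module.finrank ℚ L : ℝ) * hhat n δ a) := by
  obtain ⟨hQ1, hlQ⟩ := HyperellipticBound.sum_log_absNorm_le hQ
  have hs1 : 1 ≤ s := by
    have := Fintype.card_pos (α := InfinitePlace L)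
    omega
  have hΔ : (1 : ℝ) ≤ ((|discr L| : ℤ) : ℝ) := by
    exact_mod_cast Int.one_le_abs (discr_ne_zero L)
  have h4 : (1 : ℝ) ≤ 4 * n * s := by
    exact_mod_cast Nat.mul_pos (by omega : 0 < 4 * n) hs1
  refine (HyperellipticBound.max_wHeight_le hn ha0 hdisc haS hδ0 hδS hx heq hs rfl rfl rfl
    (Real.log_nonneg hQ1) hlQ rfl).trans
    (HyperellipticBound.exp_le_final hn hs1 (Nat.cast_nonneg _) HyperellipticBound.hhat_nonneg
      hΔ hQ1 rfl (Real.log_nonneg h4) ?_)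
  rw [Int.cast_abs]
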